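/- Let K ⊂ ℝ² be a compact strictly convex set with nonempty interior, C¹ boundary Γ = ∂K, C² support function p, and radius of curvature ρ = p + p'' of class C^r for some integer r > 4. Then for every N > 0, the union of all homotopically nontrivial Φ-invariant circles Ω with Hausdorff distance d_H(Ω, Γ) > N has positive two-dimensional Lebesgue measure. -/

import Mathlib

open Real MeasureTheory

noncomputable def suppFn (K : Set (ℝ × ℝ)) (θ : ℝ) : ℝ :=
  sSup ((fun z : ℝ × ℝ => z.1 * Real.cos θ + z.2 * Real.sin θ) '' K)

def DBInvCircle (K : Set (ℝ × ℝ)) (Φ : ℝ × ℝ → ℝ × ℝ) (Ω : Set (ℝ × ℝ)) : Prop :=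
  Ω ⊆ Kᶜ ∧ IsCompact Ω ∧ Φ '' Ω = Ω ∧
    ∃ ℓ : C(AddCircle (2 * Real.pi), (Kᶜ : Set (ℝ × ℝ))),
      Function.Injective ℓ ∧ ¬ ContinuousMap.Nullhomotopic ℓ ∧
      Ω = Subtype.val '' Set.range ℓ

namespace DualBilliard

/-- The open horizontal strip of half-width `R`. -/
def strip (R : ℝ) : Set ℂ := {z | |z.im| < R}

lemma mem_strip {R : ℝ} {z : ℂ} : z ∈ strip R ↔ |z.im| < R := Iff.rfl

lemma isOpen_strip (R : ℝ) : IsOpen (strip R) :=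
  isOpen_lt (continuous_abs.comp Complex.continuous_im) continuous_const

lemma strip_mono {R R' : ℝ} (h : R ≤ R') : strip R ⊆ strip R' :=
  fun _ hz => lt_of_lt_of_le hz h

lemma convex_strip (R : ℝ) : Convex ℝ (strip R) := by
  have : strip R = Complex.imLm ⁻¹' (Metric.ball 0 R) := by
    ext z; simp [strip]
  rw [this]
  exact (convex_ball 0 R).linear_preimage Complex.imLm

lemma ofReal_mem_strip {R : ℝ} (hR : 0 < R) (x : ℝ) : (x : ℂ) ∈ strip R := by
  simpa [strip] using hR

lemma add_real_mem_strip {R : ℝ} {z : ℂ} (hz : z ∈ strip R) (x : ℝ) : z + x ∈ strip R := by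
  simpa [strip] using hz

lemma ball_subset_strip {R ρ : ℝ} {z : ℂ} (hz : z ∈ strip (R - ρ)) :
    Metric.closedBall z ρ ⊆ strip R := by
  intro w hw
  rw [Metric.mem_closedBall, dist_eq_norm] at hw
  have h1 : |(w - z).im| ≤ ρ := (Complex.abs_im_le_norm _).trans hw
  have h2 := mem_strip.1 hz
  rw [mem_strip]
  have h3 : w.im = (w - z).im + z.im := by simp
  rw [h3]
  exact lt_of_le_of_lt (abs_add_le _ _) (by linarith)

/-- Cauchy estimate on strips. -/
lemma norm_deriv_le_strip {R ρ M : ℝ} (hρ : 0 < ρ) {f : ℂ → ℂ}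
    (hf : DifferentiableOn ℂ f (strip R)) (hM : ∀ z ∈ strip R, ‖f z‖ ≤ M)
    {z : ℂ} (hz : z ∈ strip (R - ρ)) : ‖deriv f z‖ ≤ M / ρ := by
  refine Complex.norm_deriv_le_of_forall_mem_sphere_norm_le hρ ?_ ?_
  · refine DifferentiableOn.diffContOnCl ?_
    exact hf.mono ((Metric.closure_ball_subset_closedBall).trans (ball_subset_strip hz))
  · intro w hw
    exact hM w (ball_subset_strip hz (Metric.sphere_subset_closedBall hw))

/-- Fourier coefficients of a `2π`-periodic function on the line. -/
noncomputable def fc (F : ℝ → ℂ) (k : ℤ) : ℂ :=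
  (1 / (2 * π) : ℝ) • ∫ x in (0 : ℝ)..(2 * π), Complex.exp (-(k * x * Complex.I)) * F x

lemma fourier_two_pi (k : ℤ) (x : ℝ) :
    (fourier k (x : AddCircle (2 * π - 0)) : ℂ) = Complex.exp (k * x * Complex.I) := by
  rw [fourier_coe_apply]
  congr 1
  have : (π : ℂ) ≠ 0 := by exact_mod_cast Real.pi_ne_zero
  push_cast
  field_simp
  ring

lemma fc_eq (F : ℝ → ℂ) (k : ℤ) : fc F k = fourierCoeffOn Real.two_pi_pos F k := by
  rw [fourierCoeffOn_eq_integral, fc]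
  congr 1
  · rw [sub_zero]
  refine intervalIntegral.integral_congr fun x _ => ?_
  have := fourier_two_pi (-k) x
  rw [this, smul_eq_mul]
  simp

lemma hasSum_fc {F : ℝ → ℂ} (hF : Continuous F) (hper : Function.Periodic F (2 * π))
    (hs : Summable (fc F)) (x : ℝ) :
    HasSum (fun k : ℤ => fc F k * Complex.exp (k * x * Complex.I)) (F x) := by
  have : Fact (0 < 2 * π) := ⟨Real.two_pi_pos⟩
  have hc : Continuous (hper.lift : AddCircle (2 * π) → ℂ) := by
    exact continuous_coinduced_dom.mpr hF
  let f : C(AddCircle (2 * π), ℂ) := ⟨hper.lift, hc⟩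
  have hk : ∀ k, fourierCoeff f k = fc F k := by
    intro k
    rw [fourierCoeff_eq_intervalIntegral _ _ 0, fc]
    simp only [zero_add]
    congr 1
    refine intervalIntegral.integral_congr fun x _ => ?_
    have := fourier_two_pi (-k) x
    rw [sub_zero] at this
    rw [this, smul_eq_mul]
    simp [f]
  have h1 := has_pointwise_sum_fourier_series_of_summable (f := f)
    (by simpa [funext hk] using hs) (x : AddCircle (2 * π))
  have h2 : f (x : AddCircle (2 * π)) = F x := rfl
  rw [h2] at h1
  convert h1 using 2 with k
  have := fourier_two_pi k x
  rw [sub_zero] at this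
  rw [hk, this, smul_eq_mul]

lemma norm_fc_le {F : ℝ → ℂ} {M : ℝ} (hM : ∀ x, ‖F x‖ ≤ M) (k : ℤ) : ‖fc F k‖ ≤ M := by
  have h := intervalIntegral.norm_integral_le_of_norm_le_const (a := 0) (b := 2 * π) (C := M)
    (f := fun x : ℝ => Complex.exp (-(k * x * Complex.I)) * F x) (fun x _ => by
      have h1 : Complex.exp (-(k * x * Complex.I)) = Complex.exp ((-(k * x) : ℝ) * Complex.I) := by
        congr 1; push_cast; ring
      rw [norm_mul, h1, Complex.norm_exp_ofReal_mul_I, one_mul]; exact hM x)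
  rw [fc, norm_smul, Real.norm_of_nonneg (by positivity)]
  rw [sub_zero, abs_of_pos Real.two_pi_pos] at h
  calc _ ≤ 1 / (2 * π) * (M * (2 * π)) := by gcongr
    _ = M := by field_simp

/-- Shifting the contour. -/
lemma fc_shift {R : ℝ} {f : ℂ → ℂ} (hf : DifferentiableOn ℂ f (strip R))
    (hper : ∀ z ∈ strip R, f (z + 2 * π) = f z) {a : ℝ} (ha : |a| < R) (k : ℤ) :
    fc (fun x => f (x + a * Complex.I)) k = Complex.exp (-(k * a : ℝ)) * fc (fun x => f x) k := by
  set G : ℂ → ℂ := fun z => Complex.exp (-(k * z * Complex.I)) * f z with hG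
  have hR : 0 < R := lt_of_le_of_lt (abs_nonneg _) ha
  have hsub : (Set.uIcc (0:ℂ).re (2 * π + a * Complex.I : ℂ).re ×ℂ
      Set.uIcc (0:ℂ).im (2 * π + a * Complex.I : ℂ).im) ⊆ strip R := by
    intro z hz
    have h2 := hz.2
    simp [Set.mem_uIcc] at h2
    rw [mem_strip]
    rcases h2 with h2 | h2 <;> rw [abs_lt] at ha ⊢ <;> constructor <;> linarith [ha.1, ha.2, h2.1, h2.2]
  have hGd : DifferentiableOn ℂ G (strip R) := by
    refine DifferentiableOn.mul ?_ hf
    fun_prop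
  have hGper : ∀ z ∈ strip R, G (z + 2 * π) = G z := by
    intro z hz
    simp only [hG, hper z hz]
    congr 1
    rw [Complex.exp_eq_exp_iff_exists_int]
    exact ⟨-k, by push_cast; ring⟩
  have key := Complex.integral_boundary_rect_eq_zero_of_differentiableOn G 0 (2 * π + a * Complex.I)
    (hGd.mono hsub)
  have hv : (∫ y : ℝ in (0:ℝ)..a, G (2 * π + y * Complex.I)) = ∫ y : ℝ in (0:ℝ)..a, G (y * Complex.I) := by
    refine intervalIntegral.integral_congr fun y hy => ?_
    have : (y * Complex.I : ℂ) ∈ strip R := by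
      rw [mem_strip]; simp
      simp [Set.mem_uIcc] at hy
      rcases hy with h2 | h2 <;> rw [abs_lt] at ha ⊢ <;> constructor <;> linarith [ha.1, ha.2, h2.1, h2.2]
    rw [add_comm, hGper _ this]
  simp at key
  rw [hv] at key
  have key2 : (∫ x in (0:ℝ)..(2 * π), G (x + a * Complex.I)) = ∫ x in (0:ℝ)..(2 * π), G x := by
    linear_combination -key
  have h3 : (∫ x in (0:ℝ)..(2 * π), Complex.exp (-(k * x * Complex.I)) * f (x + a * Complex.I))
      = Complex.exp (-(k * a : ℝ)) * ∫ x in (0:ℝ)..(2 * π), G (x + a * Complex.I) := by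
    rw [← intervalIntegral.integral_const_mul]
    refine intervalIntegral.integral_congr fun x _ => ?_
    simp only [hG]
    rw [← mul_assoc, ← Complex.exp_add]
    congr 2
    push_cast
    ring_nf
    simp
  simp only [fc]
  rw [h3, key2, mul_smul_comm]

lemma norm_fc_strip_le {R M : ℝ} {f : ℂ → ℂ} (hf : DifferentiableOn ℂ f (strip R))
    (hper : ∀ z ∈ strip R, f (z + 2 * π) = f z) (hM : ∀ z ∈ strip R, ‖f z‖ ≤ M)
    (hR : 0 < R) (k : ℤ) :
    ‖fc (fun x => f x) k‖ ≤ M * Real.exp (-(|(k : ℝ)| * R)) := by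
  have h1 : ∀ b : ℝ, 0 ≤ b → b < R → ‖fc (fun x => f x) k‖ ≤ M * Real.exp (-(|(k : ℝ)| * b)) := by
    intro b hb hbR
    obtain ⟨s, hs, hs2⟩ : ∃ s : ℝ, |s| = 1 ∧ s * k = -|(k:ℝ)| := by
      rcases le_total 0 (k : ℝ) with h | h
      · exact ⟨-1, by simp, by rw [abs_of_nonneg h]; ring⟩
      · exact ⟨1, by simp, by rw [abs_of_nonpos h]; ring⟩
    have hsb : |s * b| < R := by rw [abs_mul, hs, one_mul, abs_of_nonneg hb]; exact hbR
    have h2 := fc_shift hf hper hsb k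
    have h3 : ‖fc (fun x => f (x + (s * b : ℝ) * Complex.I)) k‖ ≤ M := by
      refine norm_fc_le (fun x => hM _ ?_) k
      simpa [strip] using hsb
    rw [h2, norm_mul, ← Complex.ofReal_neg, Complex.norm_exp_ofReal] at h3
    have h4 : -(k * (s * b)) = |(k:ℝ)| * b := by linear_combination (-b) * hs2
    rw [h4] at h3
    rw [Real.exp_neg, ← div_eq_mul_inv, le_div_iff₀ (Real.exp_pos _)]
    linarith
  have h5 : Filter.Tendsto (fun b : ℝ => M * Real.exp (-(|(k : ℝ)| * b))) (nhdsWithin R (Set.Iio R))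
      (nhds (M * Real.exp (-(|(k : ℝ)| * R)))) := by
    refine Filter.Tendsto.mono_left (Continuous.tendsto ?_ R) nhdsWithin_le_nhds
    fun_prop
  refine ge_of_tendsto h5 ?_
  filter_upwards [Ioo_mem_nhdsLT hR] with b hb
  exact h1 b hb.1.le hb.2

end DualBilliard

namespace DualBilliard

lemma fc_conj {F : ℝ → ℂ} (hF : ∀ x, (F x).im = 0) (k : ℤ) :
    fc F (-k) = (starRingEnd ℂ) (fc F k) := by
  rw [fc, fc, Complex.real_smul, Complex.real_smul, map_mul, Complex.conj_ofReal,
    intervalIntegral.integral_of_le Real.two_pi_pos.le,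
    intervalIntegral.integral_of_le Real.two_pi_pos.le, ← integral_conj]
  congr 1
  refine integral_congr_ae (Filter.Eventually.of_forall fun x => ?_)
  have h2 : (starRingEnd ℂ) (F x) = F x := Complex.conj_eq_iff_im.2 (hF x)
  simp only [map_mul, h2, ← Complex.exp_conj]
  simp

lemma fc_zero_real {F : ℝ → ℂ} (hF : ∀ x, (F x).im = 0) : ((fc F 0).re : ℂ) = fc F 0 := by
  have h := fc_conj hF 0
  rw [neg_zero] at h
  exact Complex.conj_eq_iff_re.1 h.symm

lemma fc_zero_sub_const {F : ℝ → ℂ} (hF : Continuous F) (c : ℂ) :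
    fc (fun x => F x - c) 0 = fc F 0 - c := by
  simp only [fc]
  simp only [Int.cast_zero, zero_mul, neg_zero, Complex.exp_zero, one_mul]
  rw [intervalIntegral.integral_sub (hF.intervalIntegrable _ _) (by simp)]
  rw [smul_sub]
  congr 1
  simp
  have : (π : ℂ) ≠ 0 := by exact_mod_cast Real.pi_ne_zero
  field_simp

lemma fc_zero_sub_mul_const {F G : ℝ → ℂ} (hF : Continuous F) (hG : Continuous G) (c : ℂ) :
    fc (fun x => F x - c * G x) 0 = fc F 0 - c * fc G 0 := by
  simp only [fc]
  simp only [Int.cast_zero, zero_mul, neg_zero, Complex.exp_zero, one_mul]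
  rw [intervalIntegral.integral_sub (hF.intervalIntegrable _ _)
    (Continuous.intervalIntegrable (by fun_prop : Continuous fun x => c * G x) _ _), intervalIntegral.integral_const_mul,
    smul_sub, mul_smul_comm]

lemma hasSum_exp_int {τ : ℝ} (hτ : 0 < τ) (hτ1 : τ ≤ 1) :
    ∃ S, HasSum (fun k : ℤ => Real.exp (-(|(k : ℝ)| * τ))) S ∧ S ≤ 4 / τ := by
  set r := Real.exp (-τ) with hr
  have hr0 : 0 < r := Real.exp_pos _
  have hr1 : r < 1 := by rw [hr, Real.exp_lt_one_iff]; linarith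
  have hr2 : τ / 2 ≤ 1 - r := by
    have h1 : τ + 1 ≤ Real.exp τ := Real.add_one_le_exp τ
    have h2 : r * Real.exp τ = 1 := by rw [hr, ← Real.exp_add]; simp
    nlinarith
  have h := hasSum_geometric_of_lt_one hr0.le hr1
  have hpow : ∀ n : ℕ, Real.exp (-((n : ℝ) * τ)) = r ^ n := by
    intro n; rw [hr, ← Real.exp_nat_mul]; congr 1; ring
  refine ⟨_, HasSum.of_nat_of_neg_add_one (m := (1 - r)⁻¹) (m' := r * (1 - r)⁻¹) ?_ ?_, ?_⟩
  · simpa [hpow] using h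
  · refine (h.mul_left r).congr_fun fun n => ?_
    rw [← pow_succ', ← hpow]
    congr 2
    push_cast
    rw [abs_neg, abs_of_nonneg (by positivity)]
  · have h1 : 0 < 1 - r := by linarith
    have h2 : (1 - r)⁻¹ ≤ (τ / 2)⁻¹ := inv_anti₀ (by positivity) hr2
    have h3 : (τ / 2)⁻¹ = 2 / τ := by field_simp
    have h4 : r * (1 - r)⁻¹ ≤ 1 * (1 - r)⁻¹ := by gcongr
    calc _ ≤ 2 / τ + 2 / τ := by linarith
      _ = 4 / τ := by ring

lemma rpow_mul_exp_le {q k : ℝ} (hq : 0 < q) (hk : 0 ≤ k) :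
    k ^ (9 / 8 : ℝ) * Real.exp (-(k * (q ^ 8 / 8))) * q ^ 9 ≤ 512 * Real.exp (-(k * (q ^ 8 / 16))) := by
  have h1 : k ^ (9 / 8 : ℝ) * q ^ 9 = (k * q ^ 8) ^ (9 / 8 : ℝ) := by
    rw [Real.mul_rpow hk (by positivity)]
    congr 1
    rw [← Real.rpow_natCast, ← Real.rpow_natCast, ← Real.rpow_mul hq.le]
    norm_num
  set x := k * q ^ 8 with hx
  have hx0 : 0 ≤ x := by positivity
  have h2 : x ^ (9 / 8 : ℝ) ≤ 1 + x ^ 2 := by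
    rcases le_total x 1 with h | h
    · have := Real.rpow_le_one hx0 h (by norm_num : (0:ℝ) ≤ 9 / 8)
      nlinarith
    · have := Real.rpow_le_rpow_of_exponent_le h (by norm_num : (9 / 8 : ℝ) ≤ (2 : ℕ))
      rw [Real.rpow_natCast] at this
      linarith
  have h3 : 1 + x ^ 2 ≤ 512 * Real.exp (x / 16) := by
    have := Real.quadratic_le_exp_of_nonneg (by positivity : 0 ≤ x / 16)
    nlinarith
  have h4 : Real.exp (-(k * (q ^ 8 / 16))) = Real.exp (x / 16) * Real.exp (-(k * (q ^ 8 / 8))) := by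
    rw [← Real.exp_add]; congr 1; rw [hx]; ring
  rw [h4]
  have h5 := Real.exp_pos (-(k * (q ^ 8 / 8)))
  calc _ = x ^ (9 / 8 : ℝ) * Real.exp (-(k * (q ^ 8 / 8))) := by rw [← h1]; ring
    _ ≤ (512 * Real.exp (x / 16)) * Real.exp (-(k * (q ^ 8 / 8))) := by gcongr; linarith
    _ = _ := by ring

/-- The Diophantine condition on the rotation number `α`, normalised by `ε`. -/
def Dioph (γ ε α : ℝ) : Prop :=
  ∀ k : ℤ, k ≠ 0 → γ * ε ≤ ‖Complex.exp (k * α * Complex.I) - 1‖ * |(k : ℝ)| ^ (9 / 8 : ℝ)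

lemma norm_exp_mul_I (k : ℤ) (z : ℂ) :
    ‖Complex.exp (k * z * Complex.I)‖ = Real.exp (-(k * z.im)) := by
  rw [Complex.norm_exp]; simp

/-- Solution of the cohomological equation with loss of analyticity. -/
theorem exists_cohom {q γ ε α R M : ℝ} (hq : 0 < q) (hq1 : q ≤ 1) (hγ : 0 < γ) (hε : 0 < ε)
    (hα : Dioph γ ε α) {f : ℂ → ℂ} (hf : DifferentiableOn ℂ f (strip R))
    (hper : ∀ z ∈ strip R, f (z + 2 * π) = f z) (hreal : ∀ x : ℝ, (f x).im = 0)
    (hmean : fc (fun x => f x) 0 = 0) (hM : ∀ z ∈ strip R, ‖f z‖ ≤ M) (hqR : q ^ 8 / 8 < R) :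
    ∃ g : ℂ → ℂ, DifferentiableOn ℂ g (strip (R - q ^ 8 / 8)) ∧ (∀ z, g (z + 2 * π) = g z) ∧
      (∀ x : ℝ, (g x).im = 0) ∧ (∀ z ∈ strip (R - q ^ 8 / 8), g (z + α) - g z = ε * f z) ∧
      ∀ z ∈ strip (R - q ^ 8 / 8), ‖g z‖ * q ^ 17 ≤ 32768 / γ * M := by
  set ρ := q ^ 8 / 8 with hρ
  have hρ0 : 0 < ρ := by positivity
  have hR : 0 < R := hρ0.trans hqR
  have hM0 : 0 ≤ M := (norm_nonneg _).trans (hM 0 (by simpa [strip] using hR))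
  set c := fc (fun x : ℝ => f x) with hc
  set D : ℤ → ℂ := fun k => Complex.exp (k * α * Complex.I) - 1 with hD
  have hDne : ∀ k ≠ 0, D k ≠ 0 := by
    intro k hk h0
    have := hα k hk
    simp only [hD] at h0
    rw [h0, norm_zero, zero_mul] at this
    exact absurd this (not_le.2 (by positivity))
  set d : ℤ → ℂ := fun k => ε * c k / D k with hd
  obtain ⟨S, hS, hS4⟩ := hasSum_exp_int (τ := q ^ 8 / 16) (by positivity)
    (by have := pow_le_one₀ hq.le hq1 (n := 8); linarith)
  set v : ℤ → ℝ := fun k => M / γ * (512 / q ^ 9) * Real.exp (-(|(k : ℝ)| * (q ^ 8 / 16))) with hv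
  have hvsum : HasSum v (M / γ * (512 / q ^ 9) * S) := hS.mul_left _
  have hc_le : ∀ k, ‖c k‖ ≤ M * Real.exp (-(|(k : ℝ)| * R)) := fun k =>
    norm_fc_strip_le hf hper hM hR k
  have hexp_le : ∀ k : ℤ, ∀ z ∈ strip (R - ρ), ‖Complex.exp (k * z * Complex.I)‖ ≤
      Real.exp (|(k : ℝ)| * (R - ρ)) := by
    intro k z hz
    rw [norm_exp_mul_I]
    refine Real.exp_le_exp.2 ?_
    calc -(k * z.im) ≤ |(k : ℝ) * z.im| := neg_le_abs _
      _ = |(k : ℝ)| * |z.im| := abs_mul _ _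
      _ ≤ _ := by have := (mem_strip.1 hz).le; gcongr
  have hd_le : ∀ k : ℤ, ∀ z ∈ strip (R - ρ), ‖d k * Complex.exp (k * z * Complex.I)‖ ≤ v k := by
    intro k z hz
    rcases eq_or_ne k 0 with rfl | hk
    · simp only [hd, hmean, mul_zero, zero_div, zero_mul, norm_zero, hv]
      positivity
    have hk0 : 0 < |(k : ℝ)| := by positivity
    have h1 := hα k hk
    have hD0 : 0 < ‖D k‖ := norm_pos_iff.2 (hDne k hk)
    have h2 : ε / ‖D k‖ ≤ |(k : ℝ)| ^ (9 / 8 : ℝ) / γ := by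
      rw [div_le_div_iff₀ hD0 hγ]; linarith
    have h3 : ‖d k‖ ≤ |(k : ℝ)| ^ (9 / 8 : ℝ) / γ * (M * Real.exp (-(|(k : ℝ)| * R))) := by
      have : ‖d k‖ = ε / ‖D k‖ * ‖c k‖ := by
        simp only [hd, norm_div, norm_mul, Complex.norm_real, Real.norm_of_nonneg hε.le]; ring
      rw [this]
      exact mul_le_mul h2 (hc_le k) (norm_nonneg _) (by positivity)
    rw [norm_mul]
    calc _ ≤ |(k : ℝ)| ^ (9 / 8 : ℝ) / γ * (M * Real.exp (-(|(k : ℝ)| * R))) *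
          Real.exp (|(k : ℝ)| * (R - ρ)) := by
          have := hexp_le k z hz
          gcongr
      _ = M / γ * (|(k : ℝ)| ^ (9 / 8 : ℝ) * Real.exp (-(|(k : ℝ)| * (q ^ 8 / 8)))) := by
          have : Real.exp (-(|(k : ℝ)| * (q ^ 8 / 8))) =
            Real.exp (-(|(k : ℝ)| * R)) * Real.exp (|(k : ℝ)| * (R - ρ)) := by
            rw [← Real.exp_add]; congr 1; rw [hρ]; ring
          rw [this]; ring
      _ ≤ M / γ * (512 / q ^ 9 * Real.exp (-(|(k : ℝ)| * (q ^ 8 / 16)))) := by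
          have := rpow_mul_exp_le hq hk0.le
          refine mul_le_mul_of_nonneg_left ?_ (by positivity)
          rw [div_mul_eq_mul_div, le_div_iff₀ (by positivity)]
          exact this
      _ = v k := by simp only [hv]; ring
  have hsumm : ∀ z ∈ strip (R - ρ), Summable fun k : ℤ => d k * Complex.exp (k * z * Complex.I) :=
    fun z hz => Summable.of_norm_bounded hvsum.summable fun k => hd_le k z hz
  refine ⟨fun z => ∑' k : ℤ, d k * Complex.exp (k * z * Complex.I), ?_, ?_, ?_, ?_, ?_⟩
  · refine Complex.differentiableOn_tsum_of_summable_norm hvsum.summable (fun k => ?_)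
      (isOpen_strip _) fun k z hz => hd_le k z hz
    fun_prop
  · intro z
    refine tsum_congr fun k => ?_
    congr 1
    rw [Complex.exp_eq_exp_iff_exists_int]
    exact ⟨k, by ring⟩
  · intro x
    rw [← Complex.conj_eq_iff_im]
    rw [Complex.conj_tsum, ← (Equiv.neg ℤ).tsum_eq]
    refine tsum_congr fun k => ?_
    have hDc : (starRingEnd ℂ) (D (-k)) = D k := by
      simp only [hD, map_sub, ← Complex.exp_conj, map_mul, Complex.conj_I, Complex.conj_ofReal,
        map_one, map_intCast]
      push_cast
      congr 2; ring
    have hcc : (starRingEnd ℂ) (c (-k)) = c k := by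
      rw [hc, fc_conj (fun x => hreal x), Complex.conj_conj]
    simp only [Equiv.neg_apply, hd, map_mul, map_div₀, hDc, hcc, Complex.conj_ofReal,
      ← Complex.exp_conj, Complex.conj_I, map_intCast]
    congr 2
    push_cast; ring
  · intro z hz
    have hz' : z + α ∈ strip (R - ρ) := add_real_mem_strip hz α
    rw [← (hsumm _ hz').tsum_sub (hsumm z hz)]
    have hzR : |z.im| < R := lt_of_lt_of_le (mem_strip.1 hz) (by linarith)
    have hcoef := fun k => fc_shift hf hper hzR k
    have hterm : ∀ k : ℤ, d k * Complex.exp (k * (z + α) * Complex.I) -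
        d k * Complex.exp (k * z * Complex.I) =
        ε * (fc (fun x => f (x + z.im * Complex.I)) k * Complex.exp (k * z.re * Complex.I)) := by
      intro k
      rw [hcoef k]
      have e1 : Complex.exp (k * (z + α) * Complex.I) =
          Complex.exp (k * α * Complex.I) * Complex.exp (k * z * Complex.I) := by
        rw [← Complex.exp_add]; congr 1; ring
      have e2 : Complex.exp (k * z * Complex.I) =
          Complex.exp (-(k * z.im : ℝ)) * Complex.exp (k * z.re * Complex.I) := by
        rw [← Complex.exp_add]; congr 1
        conv_lhs => rw [← Complex.re_add_im z]
        push_cast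
        linear_combination (k * z.im) * Complex.I_sq
      have e3 : d k * D k = ε * c k := by
        rcases eq_or_ne k 0 with rfl | hk
        · simp only [hd, hmean]; simp
        · exact div_mul_cancel₀ _ (hDne k hk)
      calc _ = (d k * D k) * Complex.exp (k * z * Complex.I) := by rw [e1]; simp only [hD]; ring
        _ = _ := by rw [e3, e2]; ring
    rw [tsum_congr hterm, tsum_mul_left]
    congr 1
    have hcont : Continuous fun x : ℝ => f (x + z.im * Complex.I) := by
      refine hf.continuousOn.comp_continuous (by fun_prop) fun x => ?_
      simpa [strip] using hzR
    have hsm : Summable (fc fun x : ℝ => f (x + z.im * Complex.I)) := by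
      obtain ⟨S', hS', -⟩ := hasSum_exp_int (τ := min 1 ρ) (by positivity) (min_le_left _ _)
      refine Summable.of_norm_bounded (hS'.summable.mul_left M) fun k => ?_
      rw [hcoef k, norm_mul, ← Complex.ofReal_neg, Complex.norm_exp_ofReal]
      calc Real.exp (-(k * z.im)) * ‖c k‖ ≤ Real.exp (|(k : ℝ)| * (R - ρ)) *
            (M * Real.exp (-(|(k : ℝ)| * R))) := by
            have := hexp_le k z hz
            rw [norm_exp_mul_I] at this
            exact mul_le_mul this (hc_le k) (norm_nonneg _) (by positivity)
        _ = M * Real.exp (-(|(k : ℝ)| * ρ)) := by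
            rw [mul_left_comm, ← Real.exp_add]; congr 2; ring
        _ ≤ _ := by gcongr; exact min_le_right _ _
    have h := hasSum_fc hcont (fun x => ?_) hsm z.re
    · rw [h.tsum_eq]; rw [Complex.re_add_im]
    · have : (x + z.im * Complex.I : ℂ) ∈ strip R := by simpa [strip] using hzR
      simp only
      rw [← hper _ this]; congr 1; push_cast; ring
  · intro z hz
    have h1 : ‖∑' k : ℤ, d k * Complex.exp (k * z * Complex.I)‖ ≤ M / γ * (512 / q ^ 9) * S :=
      tsum_of_norm_bounded hvsum fun k => hd_le k z hz
    calc _ ≤ (M / γ * (512 / q ^ 9) * (4 / (q ^ 8 / 16))) * q ^ 17 := by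
          gcongr
          exact h1.trans (by gcongr)
      _ = _ := by field_simp; ring

end DualBilliard

namespace DualBilliard

/-- Partial derivative in the second variable. -/
noncomputable def ds (F : ℂ × ℂ → ℂ) (z : ℂ × ℂ) : ℂ := fderiv ℂ F z (0, 1)

/-- Partial derivative in the first variable. -/
noncomputable def dx (F : ℂ × ℂ → ℂ) (z : ℂ × ℂ) : ℂ := fderiv ℂ F z (1, 0)

lemma analyticAt_ds {F : ℂ × ℂ → ℂ} {z : ℂ × ℂ} (hF : AnalyticAt ℂ F z) : AnalyticAt ℂ (ds F) z :=
  ((ContinuousLinearMap.apply ℂ ℂ ((0, 1) : ℂ × ℂ)).analyticAt _).comp hF.fderiv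

lemma hasDerivAt_ds {F : ℂ × ℂ → ℂ} {y s : ℂ} (hF : AnalyticAt ℂ F (y, s)) :
    HasDerivAt (fun s' => F (y, s')) (ds F (y, s)) s := by
  have h1 : HasDerivAt (fun s' : ℂ => ((y, s') : ℂ × ℂ)) (0, 1) s :=
    (hasDerivAt_const s y).prodMk (hasDerivAt_id s)
  exact hF.differentiableAt.hasFDerivAt.comp_hasDerivAt s h1

lemma hasDerivAt_dx {F : ℂ × ℂ → ℂ} {y s : ℂ} (hF : AnalyticAt ℂ F (y, s)) :
    HasDerivAt (fun y' => F (y', s)) (dx F (y, s)) y := by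
  have h1 : HasDerivAt (fun y' : ℂ => ((y', s) : ℂ × ℂ)) (1, 0) y :=
    (hasDerivAt_id y).prodMk (hasDerivAt_const y s)
  exact hF.differentiableAt.hasFDerivAt.comp_hasDerivAt y h1

/-- Product of a strip and a disc. -/
def dom (σ : ℝ) : Set (ℂ × ℂ) := {z | |z.1.im| < σ ∧ ‖z.2‖ < σ}

lemma isOpen_dom (σ : ℝ) : IsOpen (dom σ) := by
  exact (isOpen_lt (continuous_abs.comp (Complex.continuous_im.comp continuous_fst))
    continuous_const).inter (isOpen_lt (continuous_norm.comp continuous_snd) continuous_const)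

lemma analyticAt_comp_strip {R : ℝ} {w : ℂ → ℂ} (hw : DifferentiableOn ℂ w (strip R))
    {L : ℂ × ℂ → ℂ} {z : ℂ × ℂ} (hL : AnalyticAt ℂ L z) (hz : L z ∈ strip R) :
    AnalyticAt ℂ (fun z => w (L z)) z :=
  (hw.analyticAt ((isOpen_strip R).mem_nhds hz)).fun_comp hL

/-- Derivative of a function which is real on the real axis. -/
lemma deriv_im_eq_zero {f : ℂ → ℂ} (hf : ∀ x : ℝ, (f x).im = 0) {x : ℝ}
    (hd : DifferentiableAt ℂ f x) : (deriv f x).im = 0 := by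
  have h1 : HasDerivAt (fun y : ℝ => f y) (deriv f x) x := hd.hasDerivAt.comp_ofReal
  have h2 : HasDerivAt (fun y : ℝ => (f y).im) (deriv f x).im x := by
    exact (Complex.imCLM.hasFDerivAt.comp_hasDerivAt x h1)
  have h3 : (fun y : ℝ => (f y).im) = fun _ => 0 := funext hf
  rw [h3] at h2
  exact h2.unique (hasDerivAt_const x 0)

lemma deriv_periodic {f : ℂ → ℂ} {c : ℂ} (hf : ∀ z, f (z + c) = f z) (z : ℂ) :
    deriv f (z + c) = deriv f z := by
  rw [← deriv_comp_add_const]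
  congr 1
  exact funext hf

lemma norm_sub_le_strip {R C : ℝ} {f : ℂ → ℂ} (hf : DifferentiableOn ℂ f (strip R))
    (hC : ∀ z ∈ strip R, ‖deriv f z‖ ≤ C) {z w : ℂ} (hz : z ∈ strip R) (hw : w ∈ strip R) :
    ‖f w - f z‖ ≤ C * ‖w - z‖ :=
  (convex_strip R).norm_image_sub_le_of_norm_deriv_le
    (fun x hx => (hf x hx).differentiableAt ((isOpen_strip R).mem_nhds hx)) hC hz hw

lemma norm_sub_le_ball {R C : ℝ} {f f' : ℂ → ℂ}
    (hf : ∀ s ∈ Metric.ball (0 : ℂ) R, HasDerivAt f (f' s) s)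
    (hC : ∀ s ∈ Metric.ball (0 : ℂ) R, ‖f' s‖ ≤ C) {z w : ℂ} (hz : z ∈ Metric.ball (0 : ℂ) R)
    (hw : w ∈ Metric.ball (0 : ℂ) R) : ‖f w - f z‖ ≤ C * ‖w - z‖ :=
  (convex_ball (0 : ℂ) R).norm_image_sub_le_of_norm_hasDerivWithin_le
    (fun x hx => (hf x hx).hasDerivWithinAt) hC hz hw

/-- First order Taylor estimate with a bound on the derivative of `f'` obtained from a bound on
its oscillation on a larger disc. -/
lemma taylor_ball {r C : ℝ} (hr : 0 < r) {f f' : ℂ → ℂ}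
    (hf : ∀ s ∈ Metric.ball (0 : ℂ) (2 * r), HasDerivAt f (f' s) s)
    (hf' : DifferentiableOn ℂ f' (Metric.ball (0 : ℂ) (2 * r)))
    (hC : ∀ s ∈ Metric.ball (0 : ℂ) (2 * r), ‖f' s‖ ≤ C) {s : ℂ} (hs : ‖s‖ < r) :
    ‖f s - f 0 - f' 0 * s‖ ≤ C / r * ‖s‖ * ‖s‖ := by
  have h1 : ∀ t ∈ Metric.ball (0 : ℂ) r, ‖deriv f' t‖ ≤ C / r := by
    intro t ht
    have hsub : Metric.closedBall t r ⊆ Metric.ball 0 (2 * r) := by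
      intro u hu
      rw [Metric.mem_closedBall] at hu
      rw [Metric.mem_ball] at ht ⊢
      linarith [dist_triangle u t 0]
    refine Complex.norm_deriv_le_of_forall_mem_sphere_norm_le hr ?_ ?_
    · exact (hf'.mono ((Metric.closure_ball_subset_closedBall).trans hsub)).diffContOnCl
    · exact fun u hu => hC u (hsub (Metric.sphere_subset_closedBall hu))
  have hsub : Metric.ball (0 : ℂ) r ⊆ Metric.ball 0 (2 * r) := Metric.ball_subset_ball (by linarith)
  have h2 : ∀ t ∈ Metric.ball (0 : ℂ) r, ‖f' t - f' 0‖ ≤ C / r * ‖t‖ := by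
    intro t ht
    have := norm_sub_le_ball (f := f') (f' := deriv f') (R := r) (C := C / r) (fun u hu =>
      ((hf' u (hsub hu)).differentiableAt (Metric.isOpen_ball.mem_nhds (hsub hu))).hasDerivAt) h1
      (z := 0) (w := t) (by simpa using hr) ht
    simpa using this
  have h0C : 0 ≤ C / r := (norm_nonneg _).trans (h1 0 (by simpa using hr))
  have hsr := hs
  rcases eq_or_ne s 0 with rfl | hs0
  · simp
  have hsp : 0 < ‖s‖ := norm_pos_iff.2 hs0
  have h3 : ∀ n : ℝ, ‖s‖ < n → n < r → ‖f s - f 0 - f' 0 * s‖ ≤ C / r * n * ‖s‖ := by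
    intro n hn hnr
    have := norm_sub_le_ball (f := fun t => f t - f' 0 * t) (f' := fun t => f' t - f' 0) (R := n)
      (C := C / r * n) (fun u hu => ?_) (fun u hu => ?_) (z := 0) (w := s) ?_ ?_
    · simp only [mul_zero, sub_zero] at this
      rw [show f s - f 0 - f' 0 * s = f s - f' 0 * s - f 0 by ring]
      exact this
    · have hu' : u ∈ Metric.ball (0:ℂ) (2 * r) := Metric.ball_subset_ball (by linarith) hu
      simpa using (hf u hu').fun_sub ((hasDerivAt_id u).const_mul (f' 0))
    · refine (h2 u (Metric.ball_subset_ball hnr.le hu)).trans ?_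
      have : ‖u‖ ≤ n := by simpa using (Metric.mem_ball.1 hu).le
      gcongr
    · simpa using hsp.trans hn
    · simpa using hn
  have h5 : Filter.Tendsto (fun n : ℝ => C / r * n * ‖s‖) (nhdsWithin ‖s‖ (Set.Ioi ‖s‖))
      (nhds (C / r * ‖s‖ * ‖s‖)) := by
    refine Filter.Tendsto.mono_left (Continuous.tendsto ?_ _) nhdsWithin_le_nhds
    fun_prop
  refine ge_of_tendsto h5 ?_
  filter_upwards [Ioo_mem_nhdsGT hsr] with b hb
  exact h3 b hb.1 hb.2

lemma norm_inv_le_four {a : ℂ} (ha : ‖a - 1‖ ≤ 3 / 4) : a ≠ 0 ∧ ‖a‖⁻¹ ≤ 4 ∧ ‖a‖ ≤ 2 := by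
  have h1 : 1 / 4 ≤ ‖a‖ := by
    have := norm_sub_norm_le (1 : ℂ) a
    rw [norm_one, norm_sub_rev] at this
    linarith
  refine ⟨fun h => by rw [h, norm_zero] at h1; linarith, ?_, ?_⟩
  · rw [inv_le_comm₀ (by linarith) (by norm_num)]; linarith
  · have := norm_sub_norm_le a 1
    rw [norm_one] at this
    linarith

/-- Choice of the constant making the right-hand side of the second cohomological equation have
zero mean. -/
lemma exists_mean_zero {a b : ℝ → ℂ} {β : ℝ} (ha : Continuous a) (hb : Continuous b)
    (har : ∀ x, (a x).im = 0) (hbr : ∀ x, (b x).im = 0) (ha1 : ∀ x, ‖a x - 1‖ ≤ 3 / 4)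
    (hbβ : ∀ x, ‖b x‖ ≤ β) :
    ∃ κ : ℝ, |κ| ≤ 7 * β ∧ fc (fun x => -((b x - κ) / a x)) 0 = 0 := by
  have hane : ∀ x, a x ≠ 0 := fun x => (norm_inv_le_four (ha1 x)).1
  have hia : Continuous fun x => (a x)⁻¹ := ha.inv₀ hane
  set A := fc (fun x => (a x)⁻¹) 0 with hA
  set N := fc (fun x => b x / a x) 0 with hN
  have hAre : (A.re : ℂ) = A := fc_zero_real fun x => by
    rw [Complex.inv_im, har]; simp
  have hNre : (N.re : ℂ) = N := fc_zero_real fun x => by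
    rw [Complex.div_im, har, hbr]; simp
  have hN4 : ‖N‖ ≤ 4 * β := norm_fc_le (fun x => by
    have := (norm_inv_le_four (ha1 x)).2.1
    have h0 := (norm_nonneg _).trans (hbβ x)
    rw [norm_div, div_eq_mul_inv, mul_comm]
    exact mul_le_mul this (hbβ x) (norm_nonneg _) (by norm_num)) _
  have hA4 : 4 / 7 ≤ ‖A‖ := by
    have h1 : ‖A - (16 / 7 : ℂ)‖ ≤ 12 / 7 := by
      rw [hA, ← fc_zero_sub_const hia]
      refine norm_fc_le (fun x => ?_) 0
      have hx : (((a x).re : ℝ) : ℂ) = a x := Complex.conj_eq_iff_re.1 (Complex.conj_eq_iff_im.2 (har x))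
      have h2 := ha1 x
      rw [← hx] at h2 ⊢
      set t := (a x).re
      have h3 : |t - 1| ≤ 3 / 4 := by
        have : ((t : ℂ) - 1) = ((t - 1 : ℝ) : ℂ) := by push_cast; ring
        rwa [this, Complex.norm_real] at h2
      have h4 : ((t : ℂ)⁻¹ - 16 / 7) = ((t⁻¹ - 16 / 7 : ℝ) : ℂ) := by push_cast; ring
      rw [h4, Complex.norm_real, Real.norm_eq_abs]
      rw [abs_le] at h3 ⊢
      have ht : 0 < t := by linarith
      constructor
      · have : (7 / 4 : ℝ)⁻¹ ≤ t⁻¹ := inv_anti₀ ht (by linarith)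
        norm_num at this; linarith
      · have : t⁻¹ ≤ (1 / 4 : ℝ)⁻¹ := inv_anti₀ (by norm_num) (by linarith)
        norm_num at this; linarith
    have h2 := norm_sub_norm_le (16 / 7 : ℂ) A
    rw [norm_sub_rev] at h2
    norm_num at h2
    linarith
  have hA0 : A ≠ 0 := by rintro h; rw [h, norm_zero] at hA4; norm_num at hA4
  refine ⟨N.re / A.re, ?_, ?_⟩
  · have h1 : |N.re / A.re| = ‖N‖ / ‖A‖ := by
      rw [abs_div]
      nth_rw 2 [← hNre]; nth_rw 2 [← hAre]
      simp
    rw [h1, div_le_iff₀ (by linarith)]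
    have h0 := (norm_nonneg _).trans hN4
    nlinarith
  · have h1 : (fun x => -((b x - (N.re / A.re : ℝ)) / a x)) =
        fun x => (fun _ => (0 : ℂ)) x - 1 * (fun x => b x / a x - (N / A) * (a x)⁻¹) x := by
      funext x
      push_cast
      rw [hNre, hAre]
      have := hane x
      field_simp
      ring
    have hq : Continuous fun x => b x / a x := hb.div ha hane
    have hq2 : Continuous fun x => b x / a x - (N / A) * (a x)⁻¹ := by fun_prop
    rw [h1, fc_zero_sub_mul_const continuous_const hq2, fc_zero_sub_mul_const hq hia]
    have h0 : fc (fun _ => (0 : ℂ)) 0 = 0 := by simp [fc]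
    rw [h0, ← hN, ← hA]
    field_simp
    ring

end DualBilliard

namespace DualBilliard

lemma norm_deriv_le_strip' {R R' ρ M : ℝ} (hρ : 0 < ρ) (hR : R' + ρ ≤ R) {f : ℂ → ℂ}
    (hf : DifferentiableOn ℂ f (strip R)) (hM : ∀ z ∈ strip R, ‖f z‖ ≤ M)
    {z : ℂ} (hz : z ∈ strip R') : ‖deriv f z‖ ≤ M / ρ :=
  norm_deriv_le_strip hρ hf hM (strip_mono (by linarith) hz)

lemma ds_periodic {F : ℂ × ℂ → ℂ} {c : ℂ} (hF : ∀ y s, F (y + c, s) = F (y, s)) (y s : ℂ) :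
    ds F (y + c, s) = ds F (y, s) := by
  have h : (fun z => F (z + (c, 0))) = F := by
    funext z
    obtain ⟨a, b⟩ := z
    simpa using hF a b
  have h2 := fderiv_comp_add_right (𝕜 := ℂ) (f := F) (x := (y, s)) (c, 0)
  rw [h] at h2
  simp only [ds, h2]
  simp

lemma ds_real {F : ℂ × ℂ → ℂ} (hF : ∀ y s : ℝ, (F (y, s)).im = 0) {y s : ℝ}
    (h : AnalyticAt ℂ F (y, s)) : (ds F (y, s)).im = 0 := by
  have h1 := hasDerivAt_ds h
  have h2 := deriv_im_eq_zero (f := fun s' => F (y, s')) (fun x => hF y x) h1.differentiableAt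
  rwa [h1.deriv] at h2

lemma deriv_differentiableOn_strip {R : ℝ} {g : ℂ → ℂ} (hg : DifferentiableOn ℂ g (strip R)) :
    DifferentiableOn ℂ (deriv g) (strip R) := hg.deriv (isOpen_strip R)

lemma differentiableAt_strip {R : ℝ} {g : ℂ → ℂ} (hg : DifferentiableOn ℂ g (strip R)) {z : ℂ}
    (hz : z ∈ strip R) : DifferentiableAt ℂ g z :=
  (hg z hz).differentiableAt ((isOpen_strip R).mem_nhds hz)

lemma zero_mem_dom {σ : ℝ} (hσ : 0 < σ) {y : ℂ} (hy : y ∈ strip σ) : (y, (0 : ℂ)) ∈ dom σ :=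
  ⟨hy, by simpa using hσ⟩

/-- The solutions of the two cohomological equations of one step of the iteration. -/
lemma kam_solve {γ M B W q ε α : ℝ} (hγ : 0 < γ) (hM : 1 ≤ M) (hB : 32768 / γ ≤ B) (hB1 : 1 ≤ B)
    (hW : W = 1000 * B ^ 2 * M) (hq : 0 < q) (hWq : 1000 * W * q ≤ 1) (hε : 0 < ε) (hε1 : ε ≤ 1 / 4)
    (hα : Dioph γ ε α) {𝓗 : ℂ × ℂ → ℂ} (han : AnalyticOnNhd ℂ 𝓗 (dom (q ^ 8)))
    (hper : ∀ y s, 𝓗 (y + 2 * π, s) = 𝓗 (y, s)) (hreal : ∀ y s : ℝ, (𝓗 (y, s)).im = 0)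
    (h0 : ∀ y ∈ strip (q ^ 8), ‖𝓗 (y, 0)‖ ≤ M * q ^ 51)
    (h1 : ∀ y ∈ strip (q ^ 8), ‖ds 𝓗 (y, 0)‖ ≤ M * q ^ 26)
    (h2 : ∀ z ∈ dom (q ^ 8), ‖ds (ds 𝓗) z - 1‖ ≤ 1 / 2) :
    ∃ (g w ω : ℂ → ℂ) (κ c : ℝ),
      (DifferentiableOn ℂ g (strip (7 * (q ^ 8 / 8))) ∧ (∀ z, g (z + 2 * π) = g z) ∧
        (∀ x : ℝ, (g x).im = 0) ∧
        (∀ z ∈ strip (7 * (q ^ 8 / 8)), g (z + α) - g z = ε * (𝓗 (z, 0) - c)) ∧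
        (∀ z ∈ strip (6 * (q ^ 8 / 8)), ‖deriv g z‖ ≤ W * q ^ 26) ∧
        (∀ z ∈ strip (5 * (q ^ 8 / 8)), ‖deriv (deriv g) z‖ ≤ W * q ^ 18)) ∧
      (DifferentiableOn ℂ w (strip (4 * (q ^ 8 / 8))) ∧ (∀ z, w (z + 2 * π) = w z) ∧
        (∀ x : ℝ, (w x).im = 0) ∧
        (∀ z ∈ strip (4 * (q ^ 8 / 8)), w (z + α) - w z = ε * ω z) ∧
        (∀ z ∈ strip (4 * (q ^ 8 / 8)), ‖w z‖ ≤ W * q ^ 9)) ∧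
      (DifferentiableOn ℂ ω (strip (5 * (q ^ 8 / 8))) ∧
        (∀ z ∈ strip (5 * (q ^ 8 / 8)), ‖ω z‖ ≤ W * q ^ 26)) ∧
      |κ| ≤ W * q ^ 26 ∧
      (∀ z ∈ strip (5 * (q ^ 8 / 8)), ‖ds 𝓗 (z, 0) - deriv g (z + α)‖ ≤ W * q ^ 26 ∧
        ‖ds (ds 𝓗) (z, 0) - ε * deriv (deriv g) (z + α) - 1‖ ≤ 3 / 4 ∧
        ds 𝓗 (z, 0) - deriv g (z + α) - κ +
          (ds (ds 𝓗) (z, 0) - ε * deriv (deriv g) (z + α)) * ω z = 0) := by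
  set ρ := q ^ 8 / 8 with hρ
  have hσ : q ^ 8 = 8 * ρ := by rw [hρ]; ring
  have hρ0 : 0 < ρ := by positivity
  have hB2 : B ≤ B ^ 2 := by nlinarith
  have hBM : B * M ≤ B ^ 2 * M := by gcongr
  have hBM1 : 1 ≤ B * M := by nlinarith
  have hMB : M ≤ B * M := by nlinarith
  have hW1 : 1 ≤ W := by rw [hW]; nlinarith
  have hq1 : q ≤ 1 := by nlinarith
  have hqp : ∀ n : ℕ, q ^ n ≤ 1 := fun n => pow_le_one₀ hq.le hq1
  set C : ℂ → ℂ := fun y => 𝓗 (y, 0) with hC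
  have hCd : DifferentiableOn ℂ C (strip (8 * ρ)) := fun y hy =>
    (hasDerivAt_dx (han _ (zero_mem_dom (by positivity) (hσ ▸ hy)))).differentiableAt.differentiableWithinAt
  have hCreal : ∀ x : ℝ, (C x).im = 0 := fun x => by simpa using hreal x 0
  have hcontC : Continuous fun x : ℝ => C x := hCd.continuousOn.comp_continuous
    Complex.continuous_ofReal fun x => ofReal_mem_strip (by positivity) x
  set c := (fc (fun x : ℝ => C x) 0).re with hc
  have hcc : (c : ℂ) = fc (fun x : ℝ => C x) 0 := fc_zero_real hCreal
  have hcle : ‖(c : ℂ)‖ ≤ M * q ^ 51 := by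
    rw [hcc]; exact norm_fc_le (fun x => h0 x (ofReal_mem_strip (by positivity) x)) 0
  obtain ⟨g, hgd, hgper, hgreal, hgeq, hgle⟩ := exists_cohom (R := 8 * ρ) (M := 2 * M * q ^ 51)
    (f := fun z => C z - c) hq hq1 hγ hε hα (hCd.sub_const _) (fun z _ => by simp only [hC, hper])
    (fun x => by simp [hCreal]) (by rw [fc_zero_sub_const hcontC, hcc, sub_self])
    (fun z hz => by
      refine (norm_sub_le _ _).trans ?_
      have := h0 z (by rw [hσ]; exact hz)
      linarith) (by rw [← hρ]; linarith)
  rw [← hρ, show 8 * ρ - ρ = 7 * ρ by ring] at hgd hgeq hgle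
  have hg34 : ∀ z ∈ strip (7 * ρ), ‖g z‖ ≤ 2 * (B * M) * q ^ 34 := by
    intro z hz
    refine le_of_mul_le_mul_right ?_ (by positivity : 0 < q ^ 17)
    calc _ ≤ _ := hgle z hz
      _ ≤ B * (2 * M * q ^ 51) := by gcongr
      _ = _ := by ring
  have hg' : ∀ z ∈ strip (6 * ρ), ‖deriv g z‖ ≤ 16 * (B * M) * q ^ 26 := by
    intro z hz
    refine (norm_deriv_le_strip' hρ0 (by linarith) hgd hg34 hz).trans (le_of_eq ?_)
    rw [hρ]; field_simp; ring
  have hg'd := deriv_differentiableOn_strip hgd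
  have hg'' : ∀ z ∈ strip (5 * ρ), ‖deriv (deriv g) z‖ ≤ 128 * (B * M) * q ^ 18 := by
    intro z hz
    refine (norm_deriv_le_strip' (R := 6 * ρ) hρ0 (by linarith)
      (hg'd.mono (strip_mono (by linarith))) hg' hz).trans (le_of_eq ?_)
    rw [hρ]; field_simp; ring
  have hg''d := deriv_differentiableOn_strip hg'd
  set b : ℂ → ℂ := fun z => ds 𝓗 (z, 0) - deriv g (z + α) with hb
  set a : ℂ → ℂ := fun z => ds (ds 𝓗) (z, 0) - ε * deriv (deriv g) (z + α) with ha
  have hsub5 : strip (5 * ρ) ⊆ strip (8 * ρ) := strip_mono (by linarith)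
  have hdshift : ∀ {f : ℂ → ℂ}, DifferentiableOn ℂ f (strip (7 * ρ)) →
      DifferentiableOn ℂ (fun z => f (z + α)) (strip (5 * ρ)) := by
    intro f hf
    refine hf.comp (by fun_prop) fun z hz => ?_
    exact add_real_mem_strip (strip_mono (by linarith) hz) α
  have hbd : DifferentiableOn ℂ b (strip (5 * ρ)) := by
    refine DifferentiableOn.sub (fun y hy => ?_) (hdshift hg'd)
    exact (hasDerivAt_dx (analyticAt_ds (han _ (zero_mem_dom (by positivity)
      (hσ ▸ hsub5 hy))))).differentiableAt.differentiableWithinAt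
  have had : DifferentiableOn ℂ a (strip (5 * ρ)) := by
    refine DifferentiableOn.sub (fun y hy => ?_) ((hdshift hg''d).const_mul _)
    exact (hasDerivAt_dx (analyticAt_ds (analyticAt_ds (han _ (zero_mem_dom (by positivity)
      (hσ ▸ hsub5 hy)))))).differentiableAt.differentiableWithinAt
  have hble : ∀ z ∈ strip (5 * ρ), ‖b z‖ ≤ 17 * (B * M) * q ^ 26 := by
    intro z hz
    have e1 := h1 z (hσ ▸ hsub5 hz)
    have e2 := hg' _ (add_real_mem_strip (strip_mono (by linarith) hz) α)
    refine (norm_sub_le _ _).trans ?_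
    have : 0 < q ^ 26 := by positivity
    nlinarith
  have hale : ∀ z ∈ strip (5 * ρ), ‖a z - 1‖ ≤ 3 / 4 := by
    intro z hz
    have e1 := h2 (z, 0) (zero_mem_dom (by positivity) (hσ ▸ hsub5 hz))
    have e2 := hg'' _ (add_real_mem_strip hz α)
    have e3 : a z - 1 = (ds (ds 𝓗) (z, 0) - 1) - ε * deriv (deriv g) (z + α) := by
      simp only [ha]; ring
    rw [e3]
    refine (norm_sub_le _ _).trans ?_
    rw [norm_mul, Complex.norm_real, Real.norm_of_nonneg hε.le]
    have e4 : 128 * (B * M) * q ^ 18 ≤ 1 := by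
      calc 128 * (B * M) * q ^ 18 = 128 * (B * M) * q * q ^ 17 := by ring
        _ ≤ 128 * (B ^ 2 * M) * q * 1 := by have := hqp 17; gcongr
        _ ≤ 1 := by rw [hW] at hWq; nlinarith [mul_pos (lt_of_lt_of_le one_pos (hBM1.trans hBM)) hq]
    nlinarith [norm_nonneg (deriv (deriv g) (z + α))]
  have hrR : ∀ x : ℝ, (x : ℂ) ∈ strip (5 * ρ) := fun x => ofReal_mem_strip (by positivity) x
  have hdom0 : ∀ x : ℝ, ((x : ℂ), ((0 : ℝ) : ℂ)) ∈ dom (q ^ 8) := fun x => by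
    rw [Complex.ofReal_zero]; exact zero_mem_dom (by positivity) (hσ ▸ hsub5 (hrR x))
  have hg'real : ∀ x : ℝ, (deriv g (x : ℂ)).im = 0 := fun x =>
    deriv_im_eq_zero hgreal (differentiableAt_strip hgd (strip_mono (by linarith) (hrR x)))
  have hg''real : ∀ x : ℝ, (deriv (deriv g) (x : ℂ)).im = 0 := fun x =>
    deriv_im_eq_zero hg'real (differentiableAt_strip hg'd (strip_mono (by linarith) (hrR x)))
  have hbreal : ∀ x : ℝ, (b x).im = 0 := fun x => by
    have e1 := ds_real hreal (han _ (hdom0 x))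
    have e2 := hg'real (x + α)
    rw [Complex.ofReal_zero] at e1
    push_cast at e2
    simp [hb, e1, e2]
  have hdss : ∀ x : ℝ, (ds (ds 𝓗) (x, 0)).im = 0 := fun x => by
    have f1 := hasDerivAt_ds (analyticAt_ds (han _ (hdom0 x)))
    have f3 : ∀ᶠ s : ℝ in nhds 0, (ds 𝓗 (x, s)).im = 0 := by
      have : ∀ᶠ s : ℝ in nhds 0, ((x : ℂ), (s : ℂ)) ∈ dom (q ^ 8) := by
        refine (Continuous.isOpen_preimage (f := fun s : ℝ => ((x : ℂ), (s : ℂ))) (by fun_prop) _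
          (isOpen_dom _)).mem_nhds (hdom0 x)
      filter_upwards [this] with s hs
      exact ds_real hreal (han _ hs)
    have f4 : HasDerivAt (fun s : ℝ => (ds 𝓗 (x, s)).im) (ds (ds 𝓗) (x, (0 : ℝ))).im 0 :=
      Complex.imCLM.hasFDerivAt.comp_hasDerivAt (0 : ℝ) f1.comp_ofReal
    have f5 := (f4.congr_of_eventuallyEq (f3.mono fun s hs => hs.symm)).unique (hasDerivAt_const 0 0)
    simpa using f5
  have hareal : ∀ x : ℝ, (a x).im = 0 := fun x => by
    have e2 := hg''real (x + α)
    push_cast at e2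
    simp [ha, hdss x, e2]
  have hcont : ∀ {f : ℂ → ℂ}, DifferentiableOn ℂ f (strip (5 * ρ)) → Continuous fun x : ℝ => f x :=
    fun hf => hf.continuousOn.comp_continuous Complex.continuous_ofReal hrR
  obtain ⟨κ, hκ, hκ0⟩ := exists_mean_zero (hcont had) (hcont hbd) hareal hbreal
    (fun x => hale x (hrR x)) (fun x => hble x (hrR x))
  set ω : ℂ → ℂ := fun z => -((b z - κ) / a z) with hω
  have hane : ∀ z ∈ strip (5 * ρ), a z ≠ 0 := fun z hz => (norm_inv_le_four (hale z hz)).1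
  have hωd : DifferentiableOn ℂ ω (strip (5 * ρ)) := ((hbd.sub_const _).div had hane).neg
  have hωle : ∀ z ∈ strip (5 * ρ), ‖ω z‖ ≤ 544 * (B * M) * q ^ 26 := by
    intro z hz
    simp only [hω, norm_neg, div_eq_mul_inv, norm_mul, norm_inv]
    have e1 : ‖b z - κ‖ ≤ 136 * (B * M) * q ^ 26 := by
      refine (norm_sub_le _ _).trans ?_
      rw [Complex.norm_real, Real.norm_eq_abs]
      linarith [hble z hz]
    calc _ ≤ 136 * (B * M) * q ^ 26 * 4 := mul_le_mul e1 (norm_inv_le_four (hale z hz)).2.1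
          (by positivity) ((norm_nonneg _).trans e1)
      _ = _ := by ring
  have hωper : ∀ z, ω (z + 2 * π) = ω z := by
    intro z
    have e0 : z + 2 * π + α = (z + α) + 2 * π := by ring
    simp only [hω, hb, ha]
    rw [ds_periodic (ds_periodic hper), ds_periodic hper, e0, deriv_periodic hgper,
      deriv_periodic (deriv_periodic hgper)]
  obtain ⟨w, hwd, hwper, hwreal, hweq, hwle⟩ := exists_cohom (R := 5 * ρ)
    (M := 544 * (B * M) * q ^ 26) (f := ω) hq hq1 hγ hε hα hωd (fun z _ => hωper z)
    (fun x => by simp [hω, Complex.div_im, hareal, hbreal]) hκ0 hωle (by rw [← hρ]; linarith)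
  rw [← hρ, show 5 * ρ - ρ = 4 * ρ by ring] at hwd hweq hwle
  have hq26 : (0 : ℝ) ≤ q ^ 26 := by positivity
  have hq18 : (0 : ℝ) ≤ q ^ 18 := by positivity
  have hWB : 1000 * (B * M) ≤ W := by rw [hW]; nlinarith
  refine ⟨g, w, ω, κ, c, ⟨hgd, hgper, hgreal, hgeq, fun z hz => (hg' z hz).trans ?_,
    fun z hz => (hg'' z hz).trans ?_⟩, ⟨hwd, hwper, hwreal, hweq, fun z hz => ?_⟩,
    ⟨hωd, fun z hz => (hωle z hz).trans ?_⟩, hκ.trans ?_, fun z hz => ⟨(hble z hz).trans ?_,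
    hale z hz, ?_⟩⟩
  · gcongr; linarith
  · gcongr; linarith
  · refine le_of_mul_le_mul_right ?_ (by positivity : 0 < q ^ 17)
    calc _ ≤ _ := hwle z hz
      _ ≤ B * (544 * (B * M) * q ^ 26) := by gcongr
      _ = 544 * (B ^ 2 * M) * q ^ 26 := by ring
      _ ≤ W * q ^ 26 := by gcongr; rw [hW]; nlinarith
      _ = _ := by ring
  · gcongr; linarith
  · rw [← mul_assoc]; gcongr; linarith
  · gcongr; linarith
  · have := hane z hz
    have e : ω z = -((b z - κ) / a z) := rfl
    change b z - κ + a z * ω z = 0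
    rw [e]; field_simp; ring

end DualBilliard

namespace DualBilliard

lemma mem_strip_of_norm_sub_le {R R' c : ℝ} {z w : ℂ} (hz : z ∈ strip R) (h : ‖w - z‖ ≤ c)
    (hR : R + c ≤ R') : w ∈ strip R' := by
  have h1 : |(w - z).im| ≤ c := (Complex.abs_im_le_norm _).trans h
  have h2 := mem_strip.1 hz
  rw [mem_strip, show w.im = (w - z).im + z.im by simp]
  exact lt_of_le_of_lt (abs_add_le _ _) (by linarith)

lemma shift_mem_strip {R R' r ε α : ℝ} {z s : ℂ} (hz : z ∈ strip R) (hs : ‖s‖ < r) (hε : 0 < ε)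
    (hε1 : ε ≤ 1 / 4) (hR : R + r / 4 ≤ R') : z + α + ε * s ∈ strip R' := by
  refine mem_strip_of_norm_sub_le (add_real_mem_strip hz α) (c := r / 4) ?_ hR
  have : z + α + ε * s - (z + α) = ε * s := by ring
  rw [this, norm_mul, Complex.norm_real, Real.norm_of_nonneg hε.le]
  nlinarith [norm_nonneg s]

/-- The new Hamiltonian-like function after one step of the iteration. -/
noncomputable def stepH (ε α κ c : ℝ) (g w : ℂ → ℂ) (𝓗 : ℂ × ℂ → ℂ) (z : ℂ × ℂ) : ℂ :=
  𝓗 (z.1 + w z.1, z.2 + (w (z.1 + α + ε * z.2) - w z.1) / ε) -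
    (g (z.1 + w z.1 + α + ε * (z.2 + (w (z.1 + α + ε * z.2) - w z.1) / ε)) - g (z.1 + w z.1)) / ε -
    κ * (z.2 + (w (z.1 + α + ε * z.2) - w z.1) / ε) - c

lemma shift_slice_hasDerivAt {R : ℝ} {g : ℂ → ℂ} (hg : DifferentiableOn ℂ g (strip R)) {ε α : ℝ}
    {x t : ℂ} (h : x + α + ε * t ∈ strip R) :
    HasDerivAt (fun t : ℂ => g (x + α + ε * t)) (deriv g (x + α + ε * t) * ε) t := by
  have h1 : HasDerivAt (fun t : ℂ => x + α + ε * t) ε t := by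
    simpa using ((hasDerivAt_id t).const_mul (ε : ℂ)).const_add (x + α)
  exact (differentiableAt_strip hg h).hasDerivAt.comp t h1

lemma stepH_analyticAt {R ε α κ c : ℝ} {g w : ℂ → ℂ} {𝓗 : ℂ × ℂ → ℂ} (hε : (ε : ℂ) ≠ 0)
    (hg : DifferentiableOn ℂ g (strip R)) (hw : DifferentiableOn ℂ w (strip R)) {y s : ℂ}
    (h1 : y ∈ strip R) (h2 : y + α + ε * s ∈ strip R) (h3 : y + w y ∈ strip R)
    (h4 : y + w y + α + ε * (s + (w (y + α + ε * s) - w y) / ε) ∈ strip R)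
    (h5 : AnalyticAt ℂ 𝓗 (y + w y, s + (w (y + α + ε * s) - w y) / ε)) :
    AnalyticAt ℂ (stepH ε α κ c g w 𝓗) (y, s) := by
  have a1 : AnalyticAt ℂ (fun z : ℂ × ℂ => w z.1) (y, s) :=
    analyticAt_comp_strip hw analyticAt_fst h1
  have a2 : AnalyticAt ℂ (fun z : ℂ × ℂ => w (z.1 + α + ε * z.2)) (y, s) :=
    analyticAt_comp_strip hw
      ((analyticAt_fst.add analyticAt_const).add (analyticAt_const.mul analyticAt_snd)) h2
  have a3 : AnalyticAt ℂ (fun z : ℂ × ℂ => z.2 + (w (z.1 + α + ε * z.2) - w z.1) / ε) (y, s) :=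
    analyticAt_snd.add ((a2.sub a1).div analyticAt_const hε)
  have a4 : AnalyticAt ℂ (fun z : ℂ × ℂ => z.1 + w z.1) (y, s) := analyticAt_fst.add a1
  have a5 : AnalyticAt ℂ (fun z : ℂ × ℂ => 𝓗 (z.1 + w z.1,
      z.2 + (w (z.1 + α + ε * z.2) - w z.1) / ε)) (y, s) := h5.comp₂ a4 a3
  have a6 : AnalyticAt ℂ (fun z : ℂ × ℂ => g (z.1 + w z.1)) (y, s) :=
    analyticAt_comp_strip hg a4 h3
  have a7 : AnalyticAt ℂ (fun z : ℂ × ℂ => g (z.1 + w z.1 + α +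
      ε * (z.2 + (w (z.1 + α + ε * z.2) - w z.1) / ε))) (y, s) :=
    analyticAt_comp_strip hg ((a4.add analyticAt_const).add (analyticAt_const.mul a3)) h4
  exact ((a5.sub ((a7.sub a6).div analyticAt_const hε)).sub (analyticAt_const.mul a3)).sub
    analyticAt_const

set_option maxHeartbeats 1000000 in
/-- One step of the iteration. -/
theorem kam_step {γ M : ℝ} (hγ : 0 < γ) (hM : 1 ≤ M) : ∃ K : ℝ, 1 ≤ K ∧
    ∀ {q ε α δ : ℝ}, 0 < q → K * q ≤ 1 → 0 < ε → ε ≤ 1 / 4 → Dioph γ ε α → δ ≤ 1 / 2 →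
    ∀ {𝓗 : ℂ × ℂ → ℂ}, AnalyticOnNhd ℂ 𝓗 (dom (q ^ 8)) →
    (∀ y s, 𝓗 (y + 2 * π, s) = 𝓗 (y, s)) → (∀ y s : ℝ, (𝓗 (y, s)).im = 0) →
    (∀ y ∈ strip (q ^ 8), ‖𝓗 (y, 0)‖ ≤ M * q ^ 51) →
    (∀ y ∈ strip (q ^ 8), ‖ds 𝓗 (y, 0)‖ ≤ M * q ^ 26) →
    (∀ z ∈ dom (q ^ 8), ‖ds (ds 𝓗) z - 1‖ ≤ δ) →
    ∃ (g w : ℂ → ℂ) (κ c : ℝ),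
      (DifferentiableOn ℂ g (strip (q ^ 8 / 2)) ∧ (∀ z, g (z + 2 * π) = g z) ∧
        (∀ x : ℝ, (g x).im = 0)) ∧
      (DifferentiableOn ℂ w (strip (q ^ 8 / 2)) ∧ (∀ z, w (z + 2 * π) = w z) ∧
        (∀ x : ℝ, (w x).im = 0)) ∧
      (∀ z ∈ strip (q ^ 8 / 2), ‖w z‖ ≤ K * q ^ 9) ∧
      (∀ z ∈ strip (q ^ 8 / 4), ‖deriv w z‖ ≤ K * q) ∧
      (∀ z ∈ strip (q ^ 8 / 2), ‖w (z + α) - w z‖ ≤ ε * (K * q ^ 26)) ∧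
      AnalyticOnNhd ℂ (stepH ε α κ c g w 𝓗) (dom (q ^ 8 / 4)) ∧
      (∀ y ∈ strip (q ^ 8 / 4), ‖stepH ε α κ c g w 𝓗 (y, 0)‖ ≤ K * q ^ 52) ∧
      (∀ y ∈ strip (q ^ 8 / 4), ‖ds (stepH ε α κ c g w 𝓗) (y, 0)‖ ≤ K * q ^ 27) ∧
      (∀ z ∈ dom (q ^ 8 / 4), ‖ds (ds (stepH ε α κ c g w 𝓗)) z - 1‖ ≤ δ + K * q) := by
  set B := 32768 / γ + 1 with hB
  have hB1 : 1 ≤ B := by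
    have : 0 < 32768 / γ := by positivity
    linarith
  set W := 1000 * B ^ 2 * M with hW
  have hW1 : 1 ≤ W := by rw [hW]; nlinarith [one_le_pow₀ hB1 (n := 2)]
  have hWW : W ≤ W ^ 2 := by nlinarith
  clear_value B W
  refine ⟨1000 * W ^ 2, by nlinarith, ?_⟩
  intro q ε α δ hq hKq hε hε1 hα hδ 𝓗 han hper hreal h0 h1 h2
  have hWq : 1000 * W * q ≤ 1 := by nlinarith
  obtain ⟨g, w, ω, κ, c, ⟨hgd, hgper, hgreal, hgeq, hg', hg''⟩, ⟨hwd, hwper, hwreal, hweq, hwle⟩,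
    ⟨hωd, hωle⟩, hκ, hba⟩ := kam_solve hγ hM (by rw [hB]; linarith) hB1 hW hq hWq hε hε1 hα han
      hper hreal h0 h1 (fun z hz => (h2 z hz).trans hδ)
  have hε0 : (ε : ℂ) ≠ 0 := by exact_mod_cast hε.ne'
  set ρ := q ^ 8 / 8 with hρ
  have hσ : q ^ 8 = 8 * ρ := by rw [hρ]; ring
  have hσ2 : q ^ 8 / 2 = 4 * ρ := by rw [hρ]; ring
  have hσ4 : q ^ 8 / 4 = 2 * ρ := by rw [hρ]; ring
  have hρ0 : 0 < ρ := by positivity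
  clear_value ρ
  have hq1 : q ≤ 1 := by nlinarith
  have hqp : ∀ n : ℕ, q ^ n ≤ 1 := fun n => pow_le_one₀ hq.le hq1
  have hW0 : 0 < W := by linarith
  have hWq0 : 0 < W * q := by positivity
  have hWq9 : W * q ^ 9 ≤ ρ / 100 := by
    calc W * q ^ 9 = W * q * (8 * ρ) := by rw [← hσ]; ring
      _ ≤ _ := by nlinarith
  have hWq26 : W * q ^ 26 ≤ ρ / 100 := by
    calc W * q ^ 26 = W * q ^ 9 * q ^ 17 := by ring
      _ ≤ W * q ^ 9 * 1 := by have := hqp 17; gcongr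
      _ ≤ _ := by linarith
  have hWq18 : W * q ^ 18 ≤ W * q := by
    calc W * q ^ 18 = W * q * q ^ 17 := by ring
      _ ≤ W * q * 1 := by have := hqp 17; gcongr
      _ = _ := mul_one _
  have hw' : ∀ z ∈ strip (3 * ρ), ‖deriv w z‖ ≤ 8 * (W * q) := by
    intro z hz
    refine (norm_deriv_le_strip' hρ0 (by linarith) hwd hwle hz).trans (le_of_eq ?_)
    rw [hρ]; field_simp
  have hw'd := deriv_differentiableOn_strip hwd
  have hw'' : ∀ z ∈ strip (5 / 2 * ρ), ‖deriv (deriv w) z‖ ≤ 16 * (W * q) / ρ := by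
    intro z hz
    refine (norm_deriv_le_strip' (R := 3 * ρ) (half_pos hρ0) (by linarith)
      (hw'd.mono (strip_mono (by linarith))) hw' hz).trans (le_of_eq ?_)
    field_simp; ring
  have hω' : ∀ z ∈ strip (4 * ρ), ‖deriv ω z‖ ≤ 8 * (W * q ^ 18) := by
    intro z hz
    refine (norm_deriv_le_strip' hρ0 (by linarith) hωd hωle hz).trans (le_of_eq ?_)
    rw [hρ]; field_simp
  have hg'd := deriv_differentiableOn_strip hgd
  have hg''d := deriv_differentiableOn_strip hg'd
  -- slices of the normalised function
  set Ht : ℂ → ℂ → ℂ := fun x t => 𝓗 (x, t) - (g (x + α + ε * t) - g x) / ε - c with hHt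
  set Hs : ℂ → ℂ → ℂ := fun x t => ds 𝓗 (x, t) - deriv g (x + α + ε * t) with hHs
  set Hss : ℂ → ℂ → ℂ := fun x t => ds (ds 𝓗) (x, t) - ε * deriv (deriv g) (x + α + ε * t) with hHss
  have hxt : ∀ {x t : ℂ}, x ∈ strip (3 * ρ) → ‖t‖ < 4 * ρ → (x, t) ∈ dom (q ^ 8) := by
    intro x t hx ht
    rw [hσ]
    exact ⟨strip_mono (by linarith : 3 * ρ ≤ 8 * ρ) hx, by simp only; linarith⟩
  have hsh : ∀ {x t : ℂ}, x ∈ strip (3 * ρ) → ‖t‖ < 4 * ρ → x + α + ε * t ∈ strip (4 * ρ) :=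
    fun hx ht => shift_mem_strip hx ht hε hε1 (by linarith)
  have hHt' : ∀ {x t : ℂ}, x ∈ strip (3 * ρ) → ‖t‖ < 4 * ρ → HasDerivAt (Ht x) (Hs x t) t := by
    intro x t hx ht
    have e1 := hasDerivAt_ds (han _ (hxt hx ht))
    have e2 := shift_slice_hasDerivAt (ε := ε) (α := α) hgd
      (strip_mono (by linarith) (hsh hx ht))
    have e3 := (e1.fun_sub ((e2.sub_const (g x)).div_const (ε : ℂ))).sub_const (c : ℂ)
    convert! e3 using 1
    simp only [hHs]; field_simp
  have hHs' : ∀ {x t : ℂ}, x ∈ strip (3 * ρ) → ‖t‖ < 4 * ρ → HasDerivAt (Hs x) (Hss x t) t := by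
    intro x t hx ht
    have e1 := hasDerivAt_ds (analyticAt_ds (han _ (hxt hx ht)))
    have e2 := shift_slice_hasDerivAt (ε := ε) (α := α) hg'd
      (strip_mono (by linarith) (hsh hx ht))
    have e3 := e1.fun_sub e2
    convert! e3 using 1
    simp only [hHss]; ring
  have hHssd : ∀ {x t : ℂ}, x ∈ strip (3 * ρ) → ‖t‖ < 4 * ρ → DifferentiableAt ℂ (Hss x) t := by
    intro x t hx ht
    have e1 := hasDerivAt_ds (analyticAt_ds (analyticAt_ds (han _ (hxt hx ht))))
    have e2 := shift_slice_hasDerivAt (ε := ε) (α := α) hg''d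
      (strip_mono (by linarith) (hsh hx ht))
    exact (e1.fun_sub (e2.const_mul (ε : ℂ))).differentiableAt
  have hHss1 : ∀ {x t : ℂ}, x ∈ strip (3 * ρ) → ‖t‖ < 4 * ρ → ‖Hss x t - 1‖ ≤ δ + W * q := by
    intro x t hx ht
    have e1 := h2 _ (hxt hx ht)
    have e2 := hg'' _ (strip_mono (by linarith) (hsh hx ht))
    rw [show Hss x t - 1 = (ds (ds 𝓗) (x, t) - 1) - ε * deriv (deriv g) (x + α + ε * t) by
      simp only [hHss]; ring]
    refine (norm_sub_le _ _).trans ?_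
    rw [norm_mul, Complex.norm_real, Real.norm_of_nonneg hε.le]
    nlinarith [norm_nonneg (deriv (deriv g) (x + α + ε * t))]
  have hHss2 : ∀ {x t : ℂ}, x ∈ strip (3 * ρ) → ‖t‖ < 4 * ρ → ‖Hss x t‖ ≤ 2 := by
    intro x t hx ht
    exact (norm_inv_le_four ((hHss1 hx ht).trans (by linarith))).2.2
  have hHs0 : ∀ x, Hs x 0 = ds 𝓗 (x, 0) - deriv g (x + α) := by intro x; simp [hHs]
  have hHss0 : ∀ x, Hss x 0 = ds (ds 𝓗) (x, 0) - ε * deriv (deriv g) (x + α) := by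
    intro x; simp [hHss]
  clear_value Ht Hs Hss
  have hb : ∀ {x : ℂ}, x ∈ strip (3 * ρ) → ‖Hs x 0‖ ≤ W * q ^ 26 := by
    intro x hx
    rw [hHs0]; exact (hba x (strip_mono (by linarith) hx)).1
  have hHsle : ∀ {x t : ℂ}, x ∈ strip (3 * ρ) → ‖t‖ < 4 * ρ → ‖Hs x t‖ ≤ W * q ^ 26 + 2 * ‖t‖ := by
    intro x t hx ht
    have := norm_sub_le_ball (R := 4 * ρ) (f := Hs x) (f' := Hss x) (C := 2)
      (fun s hs => hHs' hx (by simpa using hs)) (fun s hs => hHss2 hx (by simpa using hs))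
      (z := 0) (w := t) (by simpa using hρ0) (by simpa using ht)
    rw [sub_zero] at this
    have h3 : Hs x t = (Hs x t - Hs x 0) + Hs x 0 := by ring
    rw [h3]
    exact (norm_add_le _ _).trans (by linarith [hb hx])
  have hHt0 : ∀ {x : ℂ}, x ∈ strip (3 * ρ) → Ht x 0 = 0 := by
    intro x hx
    have := hgeq x (strip_mono (by linarith) hx)
    simp only [hHt, mul_zero, add_zero, this]
    field_simp; ring
  have htay0 : ∀ {x t : ℂ}, x ∈ strip (3 * ρ) → ‖t‖ < 2 * ρ →
      ‖Ht x t - Hs x 0 * t‖ ≤ 5 * ‖t‖ * ‖t‖ := by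
    intro x t hx ht
    have := taylor_ball (r := 2 * ρ) (C := 10 * ρ) (f := Ht x) (f' := Hs x) (by linarith)
      (fun s hs => hHt' hx (by rw [mem_ball_zero_iff] at hs; linarith))
      (fun s hs => (hHs' hx (by
        rw [mem_ball_zero_iff] at hs; linarith)).differentiableAt.differentiableWithinAt)
      (fun s hs => by
        rw [mem_ball_zero_iff] at hs
        have := hHsle hx (t := s) (by linarith)
        linarith) ht
    rw [hHt0 hx, sub_zero] at this
    rwa [show 10 * ρ / (2 * ρ) = 5 by field_simp; norm_num] at this
  have htay1 : ∀ {x t : ℂ}, x ∈ strip (3 * ρ) → ‖t‖ < 2 * ρ →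
      ‖Hs x t - Hs x 0 - Hss x 0 * t‖ ≤ 1 / ρ * ‖t‖ * ‖t‖ := by
    intro x t hx ht
    have := taylor_ball (r := 2 * ρ) (C := 2) (f := Hs x) (f' := Hss x) (by linarith)
      (fun s hs => hHs' hx (by rw [mem_ball_zero_iff] at hs; linarith))
      (fun s hs => (hHssd hx (by
        rw [mem_ball_zero_iff] at hs; linarith)).differentiableWithinAt)
      (fun s hs => hHss2 hx (by rw [mem_ball_zero_iff] at hs; linarith)) ht
    rwa [show 2 / (2 * ρ) = 1 / ρ by field_simp] at this
  -- the substitution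
  set S : ℂ → ℂ → ℂ := fun y s => s + (w (y + α + ε * s) - w y) / ε with hS
  set φ : ℂ → ℂ := fun y => y + w y with hφ
  have hφmem : ∀ {y : ℂ} {a b : ℝ}, a ≤ 4 * ρ → a + ρ / 100 ≤ b → y ∈ strip a → φ y ∈ strip b := by
    intro y a b ha hab hy
    refine mem_strip_of_norm_sub_le hy (c := ρ / 100) ?_ hab
    simp only [hφ, add_sub_cancel_left]
    exact (hwle y (strip_mono ha hy)).trans hWq9
  have hy' : ∀ {y s : ℂ}, y ∈ strip (2 * ρ) → ‖s‖ < 2 * ρ → y + α + ε * s ∈ strip (5 / 2 * ρ) :=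
    fun hy hs => shift_mem_strip hy hs hε hε1 (by linarith)
  have hS0 : ∀ {y : ℂ}, y ∈ strip (2 * ρ) → S y 0 = ω y := by
    intro y hy
    simp only [hS, mul_zero, add_zero, hweq y (strip_mono (by linarith) hy)]
    field_simp; ring
  have hSle : ∀ {y s : ℂ}, y ∈ strip (2 * ρ) → ‖s‖ < 2 * ρ → ‖S y s‖ < 3 * ρ := by
    intro y s hy hs
    have e1 : S y s = s + ω y + (w (y + α + ε * s) - w (y + α)) / ε := by
      rw [← hS0 hy]; simp only [hS, mul_zero, add_zero]; ring
    have e2 := norm_sub_le_strip (R := 3 * ρ) (f := w) (hwd.mono (strip_mono (by linarith))) hw'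
      (z := y + α) (w := y + α + ε * s) (add_real_mem_strip (strip_mono (by linarith) hy) α)
      (strip_mono (by linarith) (hy' hy hs))
    rw [add_sub_cancel_left, norm_mul, Complex.norm_real, Real.norm_of_nonneg hε.le] at e2
    have e3 : ‖(w (y + α + ε * s) - w (y + α)) / (ε : ℂ)‖ ≤ 8 * (W * q) * ‖s‖ := by
      rw [norm_div, Complex.norm_real, Real.norm_of_nonneg hε.le, div_le_iff₀ hε]
      linarith
    have e4 := hωle y (strip_mono (by linarith) hy)
    rw [e1]
    refine (norm_add₃_le).trans_lt ?_
    nlinarith [norm_nonneg s]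
  have hSd : ∀ {y s : ℂ}, y ∈ strip (2 * ρ) → ‖s‖ < 2 * ρ →
      HasDerivAt (S y) (1 + deriv w (y + α + ε * s)) s := by
    intro y s hy hs
    have e2 := shift_slice_hasDerivAt (ε := ε) (α := α) hwd
      (strip_mono (by linarith) (hy' hy hs))
    have e3 := (hasDerivAt_id s).fun_add ((e2.sub_const (w y)).div_const (ε : ℂ))
    convert! e3 using 1
    field_simp
  set F := stepH ε α κ c g w 𝓗 with hF
  have hFeq : ∀ y s, F (y, s) = Ht (φ y) (S y s) - κ * S y s := by
    intro y s; simp only [hF, stepH, hHt, hφ, hS]; ring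
  have hFan : AnalyticOnNhd ℂ F (dom (2 * ρ)) := by
    rintro ⟨y, s⟩ ⟨hy, hs⟩
    have hy : y ∈ strip (2 * ρ) := hy
    have hs : ‖s‖ < 2 * ρ := hs
    have m1 : φ y ∈ strip (3 * ρ) := hφmem (by linarith) (by linarith) hy
    have m2 : ‖S y s‖ < 3 * ρ := hSle hy hs
    exact stepH_analyticAt hε0 (hgd.mono (strip_mono (by linarith))) hwd
      (strip_mono (by linarith) hy) (strip_mono (by linarith) (hy' hy hs))
      (strip_mono (by linarith) m1) (hsh m1 (t := S y s) (by linarith))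
      (han (φ y, S y s) (hxt m1 (by linarith)))
  clear_value S φ
  have hds : ∀ {y s : ℂ}, y ∈ strip (2 * ρ) → ‖s‖ < 2 * ρ →
      ds F (y, s) = (Hs (φ y) (S y s) - κ) * (1 + deriv w (y + α + ε * s)) := by
    intro y s hy hs
    have m1 : φ y ∈ strip (3 * ρ) := hφmem (by linarith) (by linarith) hy
    have m2 := hSle hy hs
    have e1 := hasDerivAt_ds (hFan (y, s) ⟨hy, hs⟩)
    have e2 : HasDerivAt (fun s => Ht (φ y) (S y s) - κ * S y s) _ s :=
      ((hHt' m1 (by linarith : ‖S y s‖ < 4 * ρ)).comp s (hSd hy hs)).fun_sub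
        ((hSd hy hs).const_mul (κ : ℂ))
    simp only [hFeq] at e1
    rw [e1.unique e2]; ring
  have hdss : ∀ {y s : ℂ}, y ∈ strip (2 * ρ) → ‖s‖ < 2 * ρ →
      ds (ds F) (y, s) = Hss (φ y) (S y s) * (1 + deriv w (y + α + ε * s)) ^ 2 +
        (Hs (φ y) (S y s) - κ) * (deriv (deriv w) (y + α + ε * s) * ε) := by
    intro y s hy hs
    have m1 : φ y ∈ strip (3 * ρ) := hφmem (by linarith) (by linarith) hy
    have m2 := hSle hy hs
    have e1 := hasDerivAt_ds (analyticAt_ds (hFan (y, s) ⟨hy, hs⟩))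
    have e3 := (shift_slice_hasDerivAt (ε := ε) (α := α) hw'd
      (strip_mono (by linarith) (hy' hy hs))).const_add 1
    have e2 := (((hHs' m1 (by linarith : ‖S y s‖ < 4 * ρ)).comp s (hSd hy hs)).sub_const
        (κ : ℂ)).mul e3
    have e4 : (fun s => ds F (y, s)) =ᶠ[nhds s] fun s =>
        (Hs (φ y) (S y s) - κ) * (1 + deriv w (y + α + ε * s)) := by
      have : ∀ᶠ t : ℂ in nhds s, ‖t‖ < 2 * ρ :=
        (isOpen_lt continuous_norm continuous_const).mem_nhds hs
      filter_upwards [this] with t ht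
      exact hds hy ht
    have e5 := e1.unique (e2.congr_of_eventuallyEq e4)
    rw [e5]; simp only [Function.comp]; ring
  have hcoef : ∀ {y s : ℂ}, y ∈ strip (2 * ρ) → ‖s‖ < 2 * ρ →
      ‖deriv w (y + α + ε * s)‖ ≤ 8 * (W * q) := fun hy hs =>
    hw' _ (strip_mono (by linarith) (hy' hy hs))
  have hκ' : ‖(κ : ℂ)‖ ≤ W * q ^ 26 := by rw [Complex.norm_real]; exact hκ
  have h26 : (0 : ℝ) ≤ q ^ 26 := by positivity
  rw [hσ2, hσ4]
  refine ⟨g, w, κ, c, ⟨hgd.mono (strip_mono (by linarith)), hgper, hgreal⟩, ⟨hwd, hwper, hwreal⟩,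
    fun z hz => (hwle z hz).trans ?_, fun z hz => (hw' z (strip_mono (by linarith) hz)).trans ?_,
    fun z hz => ?_, hFan, fun y hy => ?_, fun y hy => ?_, ?_⟩
  · gcongr; linarith
  · nlinarith
  · rw [hweq z hz, norm_mul, Complex.norm_real, Real.norm_of_nonneg hε.le]
    gcongr
    refine (hωle z (strip_mono (by linarith) hz)).trans ?_
    gcongr; linarith
  · have m1 : φ y ∈ strip (3 * ρ) := hφmem (by linarith) (by linarith) hy
    have hω0 := hωle y (strip_mono (by linarith) hy)
    have e1 := htay0 m1 (t := ω y) (by linarith)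
    have e2 := hb m1
    change ‖F (y, 0)‖ ≤ _
    rw [hFeq, hS0 hy, show Ht (φ y) (ω y) - κ * ω y =
      (Ht (φ y) (ω y) - Hs (φ y) 0 * ω y) + (Hs (φ y) 0 - κ) * ω y by ring]
    refine (norm_add_le _ _).trans ?_
    have e3 : ‖(Hs (φ y) 0 - κ) * ω y‖ ≤ (W * q ^ 26 + W * q ^ 26) * (W * q ^ 26) := by
      rw [norm_mul]
      refine mul_le_mul ((norm_sub_le _ _).trans (by linarith)) hω0 (norm_nonneg _) (by positivity)
    have e4 : 5 * ‖ω y‖ * ‖ω y‖ ≤ 5 * (W * q ^ 26) * (W * q ^ 26) := by gcongr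
    calc _ ≤ 7 * (W * q ^ 26) * (W * q ^ 26) := by linarith
      _ = 7 * W ^ 2 * q ^ 52 := by ring
      _ ≤ _ := by gcongr; norm_num
  · have hz0 : ‖(0 : ℂ)‖ < 2 * ρ := by simpa using hρ0
    have m1 : φ y ∈ strip (3 * ρ) := hφmem (by linarith) (by linarith) hy
    have hω0 := hωle y (strip_mono (by linarith) hy)
    have e1 := htay1 m1 (t := ω y) (by linarith)
    obtain ⟨-, e2, e3⟩ := hba (φ y) (strip_mono (by linarith) m1)
    rw [← hHs0, ← hHss0] at e3
    rw [← hHss0] at e2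
    have e4 := (norm_inv_le_four e2).2.2
    have e5 := norm_sub_le_strip (hωd.mono (strip_mono (by linarith))) hω'
      (strip_mono (by linarith : 3 * ρ ≤ 4 * ρ) m1) (strip_mono (by linarith : 2 * ρ ≤ 4 * ρ) hy)
    have e6 : ‖y - φ y‖ ≤ W * q ^ 9 := by
      rw [show y - φ y = -w y by simp [hφ], norm_neg]
      exact hwle y (strip_mono (by linarith) hy)
    have e7 : Hs (φ y) (ω y) - κ = (Hs (φ y) (ω y) - Hs (φ y) 0 - Hss (φ y) 0 * ω y) +
        Hss (φ y) 0 * (ω y - ω (φ y)) := by linear_combination e3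
    have e8 : ‖Hs (φ y) (ω y) - κ‖ ≤ 24 * W ^ 2 * q ^ 27 := by
      rw [e7]
      refine (norm_add_le _ _).trans ?_
      have f1 : ‖Hss (φ y) 0 * (ω y - ω (φ y))‖ ≤ 2 * (8 * (W * q ^ 18) * (W * q ^ 9)) := by
        rw [norm_mul]
        refine mul_le_mul e4 (e5.trans (by gcongr)) (norm_nonneg _) (by norm_num)
      have f2 : 1 / ρ * ‖ω y‖ * ‖ω y‖ ≤ 1 / ρ * (W * q ^ 26) * (W * q ^ 26) := by gcongr
      have f3 : 1 / ρ * (W * q ^ 26) * (W * q ^ 26) = 8 * W ^ 2 * q ^ 27 * q ^ 17 := by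
        rw [hρ]; field_simp
      have f4 : 8 * W ^ 2 * q ^ 27 * q ^ 17 ≤ 8 * W ^ 2 * q ^ 27 * 1 := by
        have := hqp 17; gcongr
      calc _ ≤ 8 * W ^ 2 * q ^ 27 * 1 + 2 * (8 * (W * q ^ 18) * (W * q ^ 9)) := by linarith
        _ = _ := by ring
    rw [hds hy hz0, hS0 hy, norm_mul]
    have e9 : ‖1 + deriv w (y + α + ε * 0)‖ ≤ 2 := by
      refine (norm_add_le _ _).trans ?_
      rw [norm_one]
      linarith [hcoef hy hz0]
    calc _ ≤ 24 * W ^ 2 * q ^ 27 * 2 := mul_le_mul e8 e9 (norm_nonneg _) (by positivity)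
      _ = 48 * W ^ 2 * q ^ 27 := by ring
      _ ≤ _ := by gcongr; norm_num
  · rintro ⟨y, s⟩ ⟨hy, hs⟩
    have hy : y ∈ strip (2 * ρ) := hy
    have hs : ‖s‖ < 2 * ρ := hs
    have m1 : φ y ∈ strip (3 * ρ) := hφmem (by linarith) (by linarith) hy
    have m2 : ‖S y s‖ < 4 * ρ := by linarith [hSle hy hs]
    rw [hdss hy hs]
    set d := deriv w (y + α + ε * s) with hd
    have e1 : ‖d‖ ≤ 8 * (W * q) := hcoef hy hs
    have e2 := hw'' _ (hy' hy hs)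
    have e3 := hHss1 m1 m2
    have e4 := hHss2 m1 m2
    have e5 := hHsle m1 m2
    have e6 : ‖Hs (φ y) (S y s) - κ‖ ≤ 9 * ρ :=
      (norm_sub_le _ _).trans (by linarith)
    have e7 : ‖(Hs (φ y) (S y s) - κ) * (deriv (deriv w) (y + α + ε * s) * ε)‖ ≤
        9 * ρ * (16 * (W * q) / ρ * (1 / 4)) := by
      rw [norm_mul, norm_mul, Complex.norm_real, Real.norm_of_nonneg hε.le]
      gcongr
    have e8 : ‖Hss (φ y) (S y s) * (2 * d + d ^ 2)‖ ≤ 2 * (17 * (W * q)) := by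
      rw [norm_mul]
      refine mul_le_mul e4 ((norm_add_le _ _).trans ?_) (norm_nonneg _) (by norm_num)
      rw [norm_mul, norm_pow, Complex.norm_ofNat]
      nlinarith [norm_nonneg d]
    rw [show 9 * ρ * (16 * (W * q) / ρ * (1 / 4)) = 36 * (W * q) by field_simp; norm_num] at e7
    rw [show Hss (φ y) (S y s) * (1 + d) ^ 2 +
        (Hs (φ y) (S y s) - κ) * (deriv (deriv w) (y + α + ε * s) * ε) - 1 =
      (Hss (φ y) (S y s) - 1) + Hss (φ y) (S y s) * (2 * d + d ^ 2) +
        (Hs (φ y) (S y s) - κ) * (deriv (deriv w) (y + α + ε * s) * ε) by ring]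
    refine norm_add₃_le.trans ?_
    nlinarith

end DualBilliard

namespace DualBilliard

/-- The normalised increment of `u` along the shift `y ↦ y + α + ε s`. -/
noncomputable def incr (ε α : ℝ) (u : ℂ → ℂ) (z : ℂ × ℂ) : ℂ :=
  (u (z.1 + α + ε * z.2) - u z.1 - α) / ε

/-- The discrete Lagrangian `H` read in the coordinate `u` and normalised by the coboundary `G`. -/
noncomputable def pull (ε α c : ℝ) (u G : ℂ → ℂ) (H : ℂ × ℂ → ℂ) (z : ℂ × ℂ) : ℂ :=
  H (u z.1, incr ε α u z) - (G (z.1 + α + ε * z.2) - G z.1) / ε - c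

/-- Complex neighbourhoods of `ℝ × (-1/2, 1/2)` on which the Lagrangians are defined. -/
def edom (ε σ : ℝ) : Set (ℂ × ℂ) :=
  {z | |z.1.im| < 4 * σ ∧ |(z.1 + ε * z.2).im| < 4 * σ ∧ ‖z.2‖ < 1 / 2}

/-- Near-identity changes of coordinate which almost conjugate the shift to a translation. -/
structure KamMap (ε α σ δ : ℝ) (u : ℂ → ℂ) : Prop where
  diff : DifferentiableOn ℂ u (strip (3 * σ))
  per : ∀ z, u (z + 2 * π) = u z + 2 * π
  real : ∀ x : ℝ, (u x).im = 0
  der : ∀ z ∈ strip (3 * σ), ‖deriv u z - 1‖ ≤ δ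
  shift : ∀ z ∈ strip (3 * σ), ‖u (z + α) - u z - α‖ ≤ ε * δ

lemma norm_le_of_norm_sub_one_le {a : ℂ} {δ : ℝ} (h : ‖a - 1‖ ≤ δ) : ‖a‖ ≤ 1 + δ := by
  have := norm_sub_norm_le a 1
  rw [norm_one] at this
  linarith

lemma dom_shift_mem {ε α σ : ℝ} (hε : 0 < ε) (hε1 : ε ≤ 1 / 4) {z : ℂ × ℂ} (hz : z ∈ dom (2 * σ)) :
    z.1 + α + ε * z.2 ∈ strip (5 / 2 * σ) :=
  shift_mem_strip hz.1 hz.2 hε hε1 (by linarith)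

namespace KamMap

variable {ε α σ δ : ℝ} {u : ℂ → ℂ}

lemma norm_sub_le (h : KamMap ε α σ δ u) {z w : ℂ} (hz : z ∈ strip (3 * σ))
    (hw : w ∈ strip (3 * σ)) : ‖u w - u z‖ ≤ (1 + δ) * ‖w - z‖ :=
  norm_sub_le_strip h.diff (fun x hx => norm_le_of_norm_sub_one_le (h.der x hx)) hz hw

lemma abs_im_le (h : KamMap ε α σ δ u) (hσ : 0 < σ) {z : ℂ} (hz : z ∈ strip (3 * σ)) :
    |(u z).im| ≤ (1 + δ) * |z.im| := by
  have h1 := h.norm_sub_le (ofReal_mem_strip (by linarith : 0 < 3 * σ) z.re) hz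
  have h2 : z - (z.re : ℂ) = z.im * Complex.I := by
    apply Complex.ext <;> simp
  rw [h2, norm_mul, Complex.norm_I, mul_one, Complex.norm_real, Real.norm_eq_abs] at h1
  refine le_trans ?_ h1
  have h3 := Complex.abs_im_le_norm (u z - u z.re)
  rwa [Complex.sub_im, h.real, sub_zero] at h3

lemma norm_incr_le (h : KamMap ε α σ δ u) (hσ : 0 < σ) (hε : 0 < ε) (hε1 : ε ≤ 1 / 4)
    {z : ℂ × ℂ} (hz : z ∈ dom (2 * σ)) : ‖incr ε α u z‖ ≤ (1 + δ) * ‖z.2‖ + δ := by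
  have h1 := h.norm_sub_le (z := z.1 + α)
    (strip_mono (by linarith : 2 * σ ≤ 3 * σ) (add_real_mem_strip hz.1 α))
    (strip_mono (by linarith) (dom_shift_mem (α := α) hε hε1 hz))
  rw [add_sub_cancel_left, norm_mul, Complex.norm_real, Real.norm_of_nonneg hε.le] at h1
  have h2 := h.shift z.1 (strip_mono (by linarith : 2 * σ ≤ 3 * σ) hz.1)
  rw [incr, norm_div, Complex.norm_real, Real.norm_of_nonneg hε.le, div_le_iff₀ hε]
  have h3 : u (z.1 + α + ε * z.2) - u z.1 - α = (u (z.1 + α + ε * z.2) - u (z.1 + α)) +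
    (u (z.1 + α) - u z.1 - α) := by ring
  rw [h3]
  exact (norm_add_le _ _).trans (by linarith)

lemma mem_edom (h : KamMap ε α σ δ u) (hσ : 0 < σ) (hσ1 : σ ≤ 1 / 16) (hδ : δ ≤ 1 / 4)
    (hε : 0 < ε) (hε1 : ε ≤ 1 / 4) {z : ℂ × ℂ} (hz : z ∈ dom (2 * σ)) :
    (u z.1, incr ε α u z) ∈ edom ε σ := by
  have hs := dom_shift_mem (α := α) hε hε1 hz
  have h1 := h.abs_im_le hσ (strip_mono (by linarith : 2 * σ ≤ 3 * σ) hz.1)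
  have h2 := h.abs_im_le hσ (strip_mono (by linarith) hs)
  have h3 := h.norm_incr_le hσ hε hε1 hz
  have h4 : |z.1.im| < 2 * σ := hz.1
  have h5 : ‖z.2‖ < 2 * σ := hz.2
  have h6 : |(z.1 + α + ε * z.2).im| < 5 / 2 * σ := hs
  have hε0 : (ε : ℂ) ≠ 0 := by exact_mod_cast hε.ne'
  refine ⟨?_, ?_, ?_⟩
  · simp only
    nlinarith [abs_nonneg z.1.im]
  · have : u z.1 + ε * incr ε α u z = u (z.1 + α + ε * z.2) - α := by
      rw [incr]; field_simp; ring
    simp only [this, Complex.sub_im, Complex.ofReal_im, sub_zero]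
    nlinarith [abs_nonneg (z.1 + α + ε * z.2).im]
  · simp only
    nlinarith [norm_nonneg z.2]

lemma analyticOnNhd_comp (h : KamMap ε α σ δ u) (hσ : 0 < σ) (hσ1 : σ ≤ 1 / 16) (hδ : δ ≤ 1 / 4)
    (hε : 0 < ε) (hε1 : ε ≤ 1 / 4) {E : ℂ × ℂ → ℂ} (hE : AnalyticOnNhd ℂ E (edom ε σ)) :
    AnalyticOnNhd ℂ (fun z => E (u z.1, incr ε α u z)) (dom (2 * σ)) := by
  intro z hz
  have hε0 : (ε : ℂ) ≠ 0 := by exact_mod_cast hε.ne'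
  have h1 : AnalyticAt ℂ (fun z : ℂ × ℂ => u z.1) z :=
    analyticAt_comp_strip h.diff analyticAt_fst (strip_mono (by linarith) hz.1)
  have h2 : AnalyticAt ℂ (fun z : ℂ × ℂ => u (z.1 + α + ε * z.2)) z :=
    analyticAt_comp_strip h.diff
      ((analyticAt_fst.add analyticAt_const).add (analyticAt_const.mul analyticAt_snd))
      (strip_mono (by linarith) (dom_shift_mem hε hε1 hz))
  have h3 : AnalyticAt ℂ (incr ε α u) z :=
    ((h2.sub h1).sub analyticAt_const).div analyticAt_const hε0
  exact (hE _ (h.mem_edom hσ hσ1 hδ hε hε1 hz)).comp₂ h1 h3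

lemma analyticOnNhd_pull (h : KamMap ε α σ δ u) (hσ : 0 < σ) (hσ1 : σ ≤ 1 / 16) (hδ : δ ≤ 1 / 4)
    (hε : 0 < ε) (hε1 : ε ≤ 1 / 4) {H : ℂ × ℂ → ℂ} (hH : AnalyticOnNhd ℂ H (edom ε σ))
    {G : ℂ → ℂ} (hG : DifferentiableOn ℂ G (strip (3 * σ))) (c : ℝ) :
    AnalyticOnNhd ℂ (pull ε α c u G H) (dom (2 * σ)) := by
  intro z hz
  have hε0 : (ε : ℂ) ≠ 0 := by exact_mod_cast hε.ne'
  have h1 : AnalyticAt ℂ (fun z : ℂ × ℂ => G z.1) z :=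
    analyticAt_comp_strip hG analyticAt_fst (strip_mono (by linarith) hz.1)
  have h2 : AnalyticAt ℂ (fun z : ℂ × ℂ => G (z.1 + α + ε * z.2)) z :=
    analyticAt_comp_strip hG
      ((analyticAt_fst.add analyticAt_const).add (analyticAt_const.mul analyticAt_snd))
      (strip_mono (by linarith) (dom_shift_mem hε hε1 hz))
  exact ((h.analyticOnNhd_comp hσ hσ1 hδ hε hε1 hH z hz).sub
    ((h2.sub h1).div analyticAt_const hε0)).sub analyticAt_const

end KamMap

lemma pull_per {ε α c : ℝ} {u G : ℂ → ℂ} {H : ℂ × ℂ → ℂ} (hu : ∀ z, u (z + 2 * π) = u z + 2 * π)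
    {b : ℂ} (hG : ∀ z, G (z + 2 * π) = G z + b) (hH : ∀ x s, H (x + 2 * π, s) = H (x, s)) (y s : ℂ) :
    pull ε α c u G H (y + 2 * π, s) = pull ε α c u G H (y, s) := by
  have e : y + 2 * π + α + ε * s = (y + α + ε * s) + 2 * π := by ring
  simp only [pull, incr, e, hu, hG, hH]
  congr 2
  · congr 2; ring
  · congr 1; ring

lemma ofReal_re_of_im {z : ℂ} (h : z.im = 0) : ((z.re : ℝ) : ℂ) = z := by
  apply Complex.ext <;> simp [h]

lemma incr_real {ε α : ℝ} {u : ℂ → ℂ} (hu : ∀ x : ℝ, (u x).im = 0) (y s : ℝ) :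
    (incr ε α u (y, s)).im = 0 := by
  have h1 := hu (y + α + ε * s)
  push_cast at h1
  rw [incr, Complex.div_ofReal_im]
  simp [hu, h1]

lemma pull_real {ε α c : ℝ} {u G : ℂ → ℂ} {H : ℂ × ℂ → ℂ} (hu : ∀ x : ℝ, (u x).im = 0)
    (hG : ∀ x : ℝ, (G x).im = 0) (hH : ∀ x s : ℝ, (H (x, s)).im = 0) (y s : ℝ) :
    (pull ε α c u G H (y, s)).im = 0 := by
  have h1 := hG (y + α + ε * s)
  push_cast at h1
  have h2 := hH (u y).re (incr ε α u (y, s)).re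
  rw [ofReal_re_of_im (hu y), ofReal_re_of_im (incr_real hu y s)] at h2
  rw [pull, Complex.sub_im, Complex.sub_im, Complex.div_ofReal_im]
  simp [hG, h1, h2]

lemma pull_step {ε α c c' κ : ℝ} (hε : ε ≠ 0) {u G g w : ℂ → ℂ} {H H' : ℂ × ℂ → ℂ} (z : ℂ × ℂ) :
    pull ε α (c + c' - κ * α / ε) (fun y => u (y + w y))
      (fun y => G (y + w y) + g (y + w y) + κ * (y + w y)) H' z =
    stepH ε α κ c' g w (pull ε α c u G H) z +
      (H' (u (z.1 + w z.1), incr ε α (fun y => u (y + w y)) z) -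
        H (u (z.1 + w z.1), incr ε α (fun y => u (y + w y)) z)) := by
  have hε0 : (ε : ℂ) ≠ 0 := by exact_mod_cast hε
  have e : z.1 + w z.1 + α + ε * (z.2 + (w (z.1 + α + ε * z.2) - w z.1) / ε) =
      z.1 + α + ε * z.2 + w (z.1 + α + ε * z.2) := by field_simp; ring
  simp only [pull, stepH, incr, e]
  push_cast
  field_simp
  ring

/-- Cauchy estimate for the derivative in the second variable. -/
lemma norm_ds_le {R r C : ℝ} (hr : 0 < r) {E : ℂ × ℂ → ℂ} (hE : AnalyticOnNhd ℂ E (dom R))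
    (hC : ∀ z ∈ dom R, ‖E z‖ ≤ C) {z : ℂ × ℂ} (hz : z ∈ dom (R - r)) : ‖ds E z‖ ≤ C / r := by
  obtain ⟨y, s⟩ := z
  have h1 : |y.im| < R - r := hz.1
  have h2 : ‖s‖ < R - r := hz.2
  have hm : ∀ t ∈ Metric.closedBall s r, (y, t) ∈ dom R := by
    intro t ht
    rw [mem_closedBall_iff_norm] at ht
    refine ⟨by simp only; linarith, ?_⟩
    have := norm_add_le (t - s) s
    rw [sub_add_cancel] at this
    simp only
    linarith
  rw [← (hasDerivAt_ds (hE (y, s) (hm s (Metric.mem_closedBall_self hr.le)))).deriv]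
  refine Complex.norm_deriv_le_of_forall_mem_sphere_norm_le hr ?_ fun t ht =>
    hC _ (hm t (Metric.sphere_subset_closedBall ht))
  refine DifferentiableOn.diffContOnCl ?_
  intro t ht
  exact (hasDerivAt_ds (hE (y, t) (hm t
    (Metric.closure_ball_subset_closedBall ht)))).differentiableAt.differentiableWithinAt

lemma ds_analyticOnNhd {E : ℂ × ℂ → ℂ} {U : Set (ℂ × ℂ)} (hE : AnalyticOnNhd ℂ E U) :
    AnalyticOnNhd ℂ (ds E) U := fun z hz => analyticAt_ds (hE z hz)

/-- Cauchy estimates for the first two derivatives in the second variable. -/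
lemma norm_ds_ds_le {σ C : ℝ} (hσ : 0 < σ) {E : ℂ × ℂ → ℂ} (hE : AnalyticOnNhd ℂ E (dom (2 * σ)))
    (hC : ∀ z ∈ dom (2 * σ), ‖E z‖ ≤ C) {z : ℂ × ℂ} (hz : z ∈ dom σ) :
    ‖ds E z‖ ≤ 2 * C / σ ∧ ‖ds (ds E) z‖ ≤ 4 * C / σ ^ 2 := by
  have hm : ∀ {a b : ℝ}, a ≤ b → dom a ⊆ dom b := fun hab z hz =>
    ⟨lt_of_lt_of_le hz.1 hab, lt_of_lt_of_le hz.2 hab⟩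
  have h1 : ∀ z ∈ dom (3 / 2 * σ), ‖ds E z‖ ≤ 2 * C / σ := by
    intro z hz
    refine (norm_ds_le (half_pos hσ) hE hC (hm (by linarith) hz)).trans (le_of_eq ?_)
    field_simp
  refine ⟨h1 z (hm (by linarith) hz), ?_⟩
  refine (norm_ds_le (half_pos hσ) ((ds_analyticOnNhd hE).mono (hm (by linarith))) h1
    (hm (by linarith) hz)).trans (le_of_eq ?_)
  field_simp; ring

end DualBilliard

namespace DualBilliard

lemma edom_mono {ε σ σ' : ℝ} (h : σ ≤ σ') : edom ε σ ⊆ edom ε σ' := fun _ hz =>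
  ⟨hz.1.trans_le (by linarith), hz.2.1.trans_le (by linarith), hz.2.2⟩

lemma dom_mono {a b : ℝ} (hab : a ≤ b) : dom a ⊆ dom b := fun _ hz =>
  ⟨lt_of_lt_of_le hz.1 hab, lt_of_lt_of_le hz.2 hab⟩

lemma KamMap.step {ε α σ δ δ' η : ℝ} {u w : ℂ → ℂ} (h : KamMap ε α σ δ u) (hσ : 0 < σ)
    (hδ : δ ≤ 1 / 4) (hε : 0 < ε)
    (hw : DifferentiableOn ℂ w (strip (σ / 4))) (hper : ∀ z, w (z + 2 * π) = w z)
    (hreal : ∀ x : ℝ, (w x).im = 0) (hle : ∀ z ∈ strip (σ / 4), ‖w z‖ ≤ σ)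
    (hder : ∀ z ∈ strip (σ / 4), ‖deriv w z‖ ≤ η)
    (hshift : ∀ z ∈ strip (σ / 4), ‖w (z + α) - w z‖ ≤ ε * η) (hδ' : δ + 5 / 4 * η ≤ δ') :
    KamMap ε α (σ / 256) δ' (fun y => u (y + w y)) := by
  have hsub : strip (3 * (σ / 256)) ⊆ strip (σ / 4) := strip_mono (by linarith)
  have hm : ∀ z ∈ strip (σ / 4), z + w z ∈ strip (3 * σ) := fun z hz =>
    mem_strip_of_norm_sub_le hz (c := σ) (by rw [add_sub_cancel_left]; exact hle z hz) (by linarith)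
  have hη : 0 ≤ η := (norm_nonneg _).trans (hder 0 (by simpa [mem_strip] using hσ))
  refine ⟨?_, fun z => ?_, fun x => ?_, fun z hz => ?_, fun z hz => ?_⟩
  · exact h.diff.comp (differentiableOn_id.add (hw.mono hsub)) (fun z hz => hm z (hsub hz))
  · rw [hper, ← h.per]; congr 1; ring
  · have := h.real (x + (w x).re)
    rwa [Complex.ofReal_add, ofReal_re_of_im (hreal x)] at this
  · have d1 := (differentiableAt_strip hw (hsub hz)).hasDerivAt
    have d2 := ((differentiableAt_strip h.diff (hm z (hsub hz))).hasDerivAt).comp z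
      ((hasDerivAt_id z).fun_add d1)
    have d3 : deriv (fun y => u (y + w y)) z = deriv u (z + w z) * (1 + deriv w z) := d2.deriv
    have e1 := h.der _ (hm z (hsub hz))
    have e2 := norm_le_of_norm_sub_one_le e1
    have e3 := hder z (hsub hz)
    rw [d3, show deriv u (z + w z) * (1 + deriv w z) - 1 = (deriv u (z + w z) - 1) +
      deriv u (z + w z) * deriv w z by ring]
    refine (norm_add_le _ _).trans ?_
    rw [norm_mul]
    have : ‖deriv u (z + w z)‖ * ‖deriv w z‖ ≤ 5 / 4 * η := by
      refine mul_le_mul (by linarith) e3 (norm_nonneg _) (by norm_num)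
    linarith
  · have hz' := hsub hz
    have m1 := hm z hz'
    have m2 := hm (z + α) (add_real_mem_strip hz' α)
    have e1 := h.norm_sub_le (add_real_mem_strip m1 α) m2
    have e2 := h.shift _ m1
    have e3 := hshift z hz'
    rw [show z + α + w (z + α) - (z + w z + α) = w (z + α) - w z by ring] at e1
    have e4 : (1 + δ) * ‖w (z + α) - w z‖ ≤ 5 / 4 * (ε * η) := by
      refine mul_le_mul (by linarith) e3 (norm_nonneg _) (by norm_num)
    rw [show u (z + α + w (z + α)) - u (z + w z) - α = (u (z + α + w (z + α)) - u (z + w z + α)) +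
      (u (z + w z + α) - u (z + w z) - α) by ring]
    refine (norm_add_le _ _).trans ?_
    nlinarith

/-- The inductive hypothesis of the iteration at scale `q`. -/
structure KamState (M ε α q δ : ℝ) (H : ℂ × ℂ → ℂ) (u G : ℂ → ℂ) (c : ℝ) : Prop where
  map : KamMap ε α (q ^ 8) δ u
  Gdiff : DifferentiableOn ℂ G (strip (3 * q ^ 8))
  Gper : ∃ b : ℂ, ∀ z, G (z + 2 * π) = G z + b
  Greal : ∀ x : ℝ, (G x).im = 0
  val : ∀ y ∈ strip (q ^ 8), ‖pull ε α c u G H (y, 0)‖ ≤ M * q ^ 51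
  slope : ∀ y ∈ strip (q ^ 8), ‖ds (pull ε α c u G H) (y, 0)‖ ≤ M * q ^ 26
  twist : ∀ z ∈ dom (q ^ 8), ‖ds (ds (pull ε α c u G H)) z - 1‖ ≤ 1 / 8 + δ

/-- Domain, symmetry and reality conditions for the analytic approximations. -/
structure GoodH (ε σ : ℝ) (H : ℂ × ℂ → ℂ) : Prop where
  an : AnalyticOnNhd ℂ H (edom ε σ)
  per : ∀ x s, H (x + 2 * π, s) = H (x, s)
  real : ∀ x s : ℝ, (H (x, s)).im = 0

lemma ds_add {F E : ℂ × ℂ → ℂ} {U : Set (ℂ × ℂ)} (hU : IsOpen U) (hF : AnalyticOnNhd ℂ F U)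
    (hE : AnalyticOnNhd ℂ E U) {z : ℂ × ℂ} (hz : z ∈ U) :
    ds (fun z => F z + E z) z = ds F z + ds E z ∧
    ds (ds (fun z => F z + E z)) z = ds (ds F) z + ds (ds E) z := by
  have key : ∀ {F E : ℂ × ℂ → ℂ}, AnalyticOnNhd ℂ F U → AnalyticOnNhd ℂ E U → ∀ z ∈ U,
      ds (fun z => F z + E z) z = ds F z + ds E z := by
    intro F E hF hE z hz
    simp only [ds]
    rw [fderiv_fun_add (hF z hz).differentiableAt (hE z hz).differentiableAt]
    rfl
  refine ⟨key hF hE z hz, ?_⟩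
  rw [← key (ds_analyticOnNhd hF) (ds_analyticOnNhd hE) z hz]
  have : ds (fun z => F z + E z) =ᶠ[nhds z] fun z => ds F z + ds E z := by
    filter_upwards [hU.mem_nhds hz] with x hx using key hF hE x hx
  simp only [ds] at this ⊢
  rw [this.fderiv_eq]

theorem kamState_step {γ KH : ℝ} (hγ : 0 < γ) (hKH : 0 ≤ KH) :
    ∃ L : ℝ, 1 ≤ L ∧ ∀ {q ε α δ δ' c : ℝ} {H H' : ℂ × ℂ → ℂ} {u G : ℂ → ℂ},
      0 < q → L * q ≤ 1 → 0 < ε → ε ≤ 1 / 4 → Dioph γ ε α → δ ≤ 1 / 4 → δ' ≤ 1 / 4 →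
      δ + L * q ≤ δ' → GoodH ε (q ^ 8) H → GoodH ε ((q / 2) ^ 8) H' →
      (∀ z ∈ edom ε ((q / 2) ^ 8), ‖H' z - H z‖ ≤ KH * q ^ 51) →
      KamState (2 ^ 52 * KH + 2) ε α q δ H u G c →
      ∃ (u' G' : ℂ → ℂ) (c' : ℝ), KamState (2 ^ 52 * KH + 2) ε α (q / 2) δ' H' u' G' c' ∧
        ∀ x : ℝ, ‖u' x - u x‖ ≤ L * q ^ 9 := by
  set M := 2 ^ 52 * KH + 2 with hM
  obtain ⟨K, hK1, hstep⟩ := kam_step hγ (M := M) (by rw [hM]; linarith [mul_nonneg (by norm_num : (0:ℝ) ≤ 2 ^ 52) hKH])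
  set L := 2 ^ 51 * K + 2 ^ 36 * KH with hL
  have hLK : 2 ^ 51 * K ≤ L := by rw [hL]; nlinarith
  have hLH : 2 ^ 36 * KH ≤ L := by rw [hL]; nlinarith
  refine ⟨L, by nlinarith, ?_⟩
  intro q ε α δ δ' c H H' u G hq hLq hε hε1 hα hδ hδ' hδδ hH hH' hHH hS
  clear_value M L
  set σ := q ^ 8 with hσ
  have hσ0 : 0 < σ := by positivity
  have hLq1 : 2 ^ 51 * K * q ≤ 1 := by nlinarith
  have hLq2 : 2 ^ 36 * KH * q ≤ 1 := by nlinarith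
  have hKq : K * q ≤ 1 / 2 ^ 51 := by
    rw [le_div_iff₀ (by norm_num)]; linarith
  have hq16 : q ≤ 1 / 16 := by nlinarith
  have hq1 : q ≤ 1 := by linarith
  have hqp : ∀ n : ℕ, q ^ n ≤ 1 := fun n => pow_le_one₀ hq.le hq1
  have hσ1 : σ ≤ 1 / 16 := by
    calc σ = q * q ^ 7 := by rw [hσ]; ring
      _ ≤ q * 1 := by have := hqp 7; gcongr
      _ ≤ _ := by linarith
  have hσ' : (q / 2) ^ 8 = σ / 256 := by rw [hσ, div_pow]; norm_num
  rw [hσ'] at hH' hHH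
  obtain ⟨b, hb⟩ := hS.Gper
  obtain ⟨g, w, κ, c₁, ⟨hgd, hgper, hgreal⟩, ⟨hwd, hwper, hwreal⟩, hwle, hw', hwsh, hFan, hF0, hF1,
    hF2⟩ := hstep hq (by linarith) hε hε1 hα
      (by linarith : 1 / 8 + δ ≤ 1 / 2)
      ((hS.map.analyticOnNhd_pull hσ0 hσ1 hδ hε hε1 hH.an hS.Gdiff c).mono (dom_mono (by linarith)))
      (pull_per hS.map.per hb hH.per) (pull_real hS.map.real hS.Greal hH.real) hS.val hS.slope
      hS.twist
  have hKσ : K * q ^ 9 ≤ σ := by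
    calc K * q ^ 9 = K * q * σ := by rw [hσ]; ring
      _ ≤ 1 * σ := by gcongr; linarith
      _ = σ := one_mul σ
  have hq26 : K * q ^ 26 ≤ K * q := by
    calc K * q ^ 26 = K * q * q ^ 25 := by ring
      _ ≤ K * q * 1 := by have := hqp 25; gcongr
      _ = K * q := mul_one _
  have hKL : 2 ^ 51 * K * q ≤ L * q := by gcongr
  have hHL : 2 ^ 36 * KH * q ≤ L * q := by gcongr
  have hKHq : 0 ≤ KH * q := by positivity
  have hKq0 : 0 < K * q := by positivity
  have hmap := hS.map.step hσ0 hδ hε (hwd.mono (strip_mono (by linarith))) hwper hwreal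
    (fun z hz => (hwle z (strip_mono (by linarith) hz)).trans hKσ) hw'
    (fun z hz => (hwsh z (strip_mono (by linarith) hz)).trans (by gcongr))
    (by linarith : δ + 5 / 4 * (K * q) ≤ δ')
  set u' : ℂ → ℂ := fun y => u (y + w y) with hu'
  set G' : ℂ → ℂ := fun y => G (y + w y) + g (y + w y) + κ * (y + w y) with hG'
  set E : ℂ × ℂ → ℂ := fun z => H' (u' z.1, incr ε α u' z) - H (u' z.1, incr ε α u' z) with hE
  have hpull : pull ε α (c + c₁ - κ * α / ε) u' G' H' =
      fun z => stepH ε α κ c₁ g w (pull ε α c u G H) z + E z :=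
    funext fun z => pull_step hε.ne' z
  have hσ'0 : 0 < σ / 256 := by linarith
  have hEan : AnalyticOnNhd ℂ E (dom (2 * (σ / 256))) :=
    hmap.analyticOnNhd_comp hσ'0 (by linarith) hδ' hε hε1
      (E := fun z => H' z - H z) (hH'.an.sub (hH.an.mono (edom_mono (by linarith))))
  have hEle : ∀ z ∈ dom (2 * (σ / 256)), ‖E z‖ ≤ KH * q ^ 51 := fun z hz =>
    hHH _ (hmap.mem_edom hσ'0 (by linarith) hδ' hε hε1 hz)
  have hE' := fun z hz => norm_ds_ds_le hσ'0 hEan hEle (z := z) hz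
  have hdom : dom (σ / 256) ⊆ dom (q ^ 8 / 4) := dom_mono (by linarith)
  have hstr : strip (σ / 256) ⊆ strip (q ^ 8 / 4) := strip_mono (by linarith)
  have hadd := fun z hz => ds_add (isOpen_dom (σ / 256)) (hFan.mono hdom)
    (hEan.mono (dom_mono (by linarith))) (z := z) hz
  have hKH0 : 0 ≤ KH * q ^ 17 := by positivity
  have hq17 : KH * q ^ 17 ≤ KH * q := by
    calc KH * q ^ 17 = KH * q * q ^ 16 := by ring
      _ ≤ KH * q * 1 := by have := hqp 16; gcongr
      _ = KH * q := mul_one _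
  have hq35 : KH * q ^ 35 ≤ KH * q := by
    calc KH * q ^ 35 = KH * q * q ^ 34 := by ring
      _ ≤ KH * q * 1 := by have := hqp 34; gcongr
      _ = KH * q := mul_one _
  have hm : ∀ z ∈ strip (σ / 4), z + w z ∈ strip (3 / 2 * σ) := fun z hz =>
    mem_strip_of_norm_sub_le hz (c := σ)
      (by rw [add_sub_cancel_left]
          exact (hwle z (strip_mono (by linarith) hz)).trans hKσ) (by linarith)
  have hm' : ∀ z ∈ strip (3 * (σ / 256)), z + w z ∈ strip (σ / 2) := fun z hz =>
    mem_strip_of_norm_sub_le hz (c := σ / 4)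
      (by rw [add_sub_cancel_left]
          refine (hwle z (strip_mono (by linarith) hz)).trans ?_
          calc K * q ^ 9 = K * q * σ := by rw [hσ]; ring
            _ ≤ 1 / 4 * σ := by gcongr; linarith
            _ = σ / 4 := by ring) (by linarith)
  refine ⟨u', G', c + c₁ - κ * α / ε, ⟨by rw [hσ']; exact hmap, ?_, ?_, ?_, ?_, ?_, ?_⟩, ?_⟩
  · rw [hσ']
    have d1 : DifferentiableOn ℂ (fun y => y + w y) (strip (3 * (σ / 256))) :=
      differentiableOn_id.add (hwd.mono (strip_mono (by linarith)))
    exact ((hS.Gdiff.comp d1 fun z hz => strip_mono (by linarith) (hm' z hz)).add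
      (hgd.comp d1 hm')).add (d1.const_mul _)
  · refine ⟨b + κ * (2 * π), fun z => ?_⟩
    have e : z + 2 * π + w z = (z + w z) + 2 * π := by ring
    simp only [hG', hwper, e, hb, hgper]
    ring
  · intro x
    have e1 := hS.Greal (x + (w x).re)
    have e2 := hgreal (x + (w x).re)
    rw [Complex.ofReal_add, ofReal_re_of_im (hwreal x)] at e1 e2
    simp [hG', e1, e2, hwreal]
  · intro y hy
    rw [hσ'] at hy
    have hz := zero_mem_dom hσ'0 hy
    simp only [hpull]
    refine (norm_add_le _ _).trans ?_
    have e1 := hF0 y (hstr hy)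
    have e2 := hEle (y, 0) (dom_mono (by linarith) hz)
    have e3 : K * q ^ 52 + KH * q ^ 51 ≤ M * (q / 2) ^ 51 := by
      rw [hM, div_pow]
      have : K * q ^ 52 ≤ 1 / 2 ^ 51 * q ^ 51 := by
        calc K * q ^ 52 = K * q * q ^ 51 := by ring
          _ ≤ _ := by gcongr
      have h51 : 0 ≤ q ^ 51 := by positivity
      have : 0 ≤ KH * q ^ 51 := by positivity
      linarith
    linarith
  · intro y hy
    rw [hσ'] at hy
    have hz := zero_mem_dom hσ'0 hy
    rw [hpull, (hadd _ hz).1]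
    refine (norm_add_le _ _).trans ?_
    have e1 := hF1 y (hstr hy)
    have e2 := (hE' _ hz).1
    have e3 : 2 * (KH * q ^ 51) / (σ / 256) = 512 * (KH * q ^ 17) * q ^ 26 := by
      rw [hσ]; field_simp; ring
    have e4 : K * q ^ 27 = K * q * q ^ 26 := by ring
    have e5 : (K * q + 512 * (KH * q ^ 17)) * q ^ 26 ≤ M / 2 ^ 26 * q ^ 26 := by
      refine mul_le_mul_of_nonneg_right ?_ (by positivity)
      rw [hM]
      linarith
    rw [div_pow]
    linarith
  · intro z hz
    rw [hσ'] at hz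
    rw [hpull, (hadd _ hz).2, add_sub_right_comm]
    refine (norm_add_le _ _).trans ?_
    have e1 := hF2 z (hdom hz)
    have e2 := (hE' _ hz).2
    have e3 : 4 * (KH * q ^ 51) / (σ / 256) ^ 2 = 262144 * (KH * q ^ 35) := by
      rw [hσ]; field_simp; ring
    linarith
  · intro x
    have hx : (x : ℂ) ∈ strip (σ / 4) := ofReal_mem_strip (by linarith) x
    have e1 := hS.map.norm_sub_le (ofReal_mem_strip (by linarith) x)
      (strip_mono (by linarith) (hm _ hx))
    rw [add_sub_cancel_left] at e1
    have e2 := hwle _ (strip_mono (by linarith : σ / 4 ≤ q ^ 8 / 2) hx)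
    refine e1.trans ?_
    calc (1 + δ) * ‖w x‖ ≤ 5 / 4 * (K * q ^ 9) :=
          mul_le_mul (by linarith) e2 (norm_nonneg _) (by norm_num)
      _ ≤ L * q ^ 9 := by
        rw [← mul_assoc]
        gcongr
        linarith

end DualBilliard

namespace DualBilliard

lemma exists_seq_of_step {T : Type*} {P : ℕ → T → Prop} {R : ℕ → T → T → Prop} (h0 : ∃ t, P 0 t)
    (hs : ∀ n t, P n t → ∃ t', P (n + 1) t' ∧ R n t t') :
    ∃ s : ℕ → T, (∀ n, P n (s n)) ∧ ∀ n, R n (s n) (s (n + 1)) := by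
  obtain ⟨t0, ht0⟩ := h0
  choose! F hF using hs
  let s : ℕ → T := fun n => Nat.rec t0 (fun n t => F n t) n
  have hP : ∀ n, P n (s n) := by
    intro n
    induction n with
    | zero => exact ht0
    | succ n ih => exact (hF n (s n) ih).1
  exact ⟨s, hP, fun n => (hF n (s n) (hP n)).2⟩

lemma hasDerivAt_half_inv {s : ℂ} (hs : 1 - s ≠ 0) :
    HasDerivAt (fun s : ℂ => 1 / (2 * (1 - s)) - 1 / 2 - s / 2) (1 / (2 * (1 - s) ^ 2) - 1 / 2) s ∧
    HasDerivAt (fun s : ℂ => 1 / (2 * (1 - s) ^ 2) - 1 / 2) (1 / (1 - s) ^ 3) s := by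
  have h1 : HasDerivAt (fun s : ℂ => 1 - s) (-1) s := by
    simpa using (hasDerivAt_const s (1 : ℂ)).fun_sub (hasDerivAt_id s)
  have h2 : (2 : ℂ) * (1 - s) ≠ 0 := mul_ne_zero two_ne_zero hs
  have h3 : (2 : ℂ) * (1 - s) ^ 2 ≠ 0 := mul_ne_zero two_ne_zero (pow_ne_zero 2 hs)
  constructor
  · have := (((hasDerivAt_const s (1 : ℂ)).fun_div (h1.const_mul 2) h2).sub_const (1 / 2)).fun_sub
      ((hasDerivAt_id s).div_const 2)
    convert! this using 1
    field_simp; ring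
  · have := ((hasDerivAt_const s (1 : ℂ)).fun_div ((h1.fun_pow 2).const_mul 2) h3).sub_const (1 / 2)
    convert! this using 1
    field_simp; ring

lemma norm_inv_cube_sub_one_le {s : ℂ} (hs : ‖s‖ ≤ 1 / 128) : ‖1 / (1 - s) ^ 3 - 1‖ ≤ 1 / 16 := by
  have h1 : 127 / 128 ≤ ‖1 - s‖ := by
    have := norm_sub_norm_le (1 : ℂ) s
    rw [norm_one] at this; linarith
  have h2 : 1 - s ≠ 0 := by rw [← norm_pos_iff]; linarith
  have h3 : 1 / (1 - s) ^ 3 - 1 = s * (3 - 3 * s + s ^ 2) / (1 - s) ^ 3 := by field_simp; ring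
  have h4 : ‖3 - 3 * s + s ^ 2‖ ≤ 4 := by
    refine (norm_add_le _ _).trans ?_
    have h5 := norm_sub_le (3 : ℂ) (3 * s)
    rw [norm_mul, Complex.norm_ofNat] at h5
    rw [norm_pow]
    nlinarith [norm_nonneg s]
  have h6 : (9 / 10 : ℝ) ≤ ‖1 - s‖ ^ 3 :=
    calc (9 / 10 : ℝ) ≤ (127 / 128) ^ 3 := by norm_num
      _ ≤ _ := by gcongr
  rw [h3, norm_div, norm_mul, norm_pow, div_le_iff₀ (by linarith)]
  have : ‖s‖ * ‖3 - 3 * s + s ^ 2‖ ≤ 1 / 128 * 4 :=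
    mul_le_mul hs h4 (norm_nonneg _) (by norm_num)
  linarith

lemma kamState_init {KH q ε α : ℝ} (hKH : 0 ≤ KH) (hq : 0 < q) (hq1 : 128 * q ≤ 1)
    (hKq : 128 * KH * q ≤ 1) (hε : 0 < ε) (hε1 : ε ≤ 1 / 4) {H : ℂ × ℂ → ℂ}
    (hH : GoodH ε (q ^ 8) H)
    (hH0 : ∀ z ∈ edom ε (q ^ 8), ‖H z - 1 / (2 * (1 - z.2))‖ ≤ KH * q ^ 51) :
    KamState (2 ^ 52 * KH + 2) ε α q 0 H id (fun y => y / 2) (1 / 2 - α / (2 * ε)) := by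
  have hε0 : (ε : ℂ) ≠ 0 := by exact_mod_cast hε.ne'
  set σ := q ^ 8 with hσ
  have hσ0 : 0 < σ := by positivity
  have hqp : ∀ n : ℕ, q ^ n ≤ 1 := fun n => pow_le_one₀ hq.le (by linarith)
  have hσ1 : σ ≤ 1 / 128 := by
    calc σ = q * q ^ 7 := by rw [hσ]; ring
      _ ≤ q * 1 := by have := hqp 7; gcongr
      _ ≤ _ := by linarith
  have hmap : KamMap ε α σ 0 id := by
    refine ⟨differentiableOn_id, fun z => rfl, fun x => by simp, fun z _ => ?_, fun z _ => ?_⟩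
    · simp
    · simp [add_sub_cancel_left]
  set E : ℂ × ℂ → ℂ := fun z => H z - 1 / (2 * (1 - z.2)) with hE
  set Q : ℂ × ℂ → ℂ := fun z => 1 / (2 * (1 - z.2)) - 1 / 2 - z.2 / 2 with hQ
  have hpull : pull ε α (1 / 2 - α / (2 * ε)) id (fun y => y / 2) H = fun z => Q z + E z := by
    funext z
    have e : incr ε α id z = z.2 := by simp only [incr, id]; field_simp; ring
    simp only [pull, e, hQ, hE, id]
    push_cast
    field_simp
    ring
  have hsub : dom (2 * σ) ⊆ edom ε σ := by
    intro z hz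
    have := hmap.mem_edom hσ0 (by linarith) (by norm_num) hε hε1 hz
    have e : incr ε α id z = z.2 := by simp only [incr, id]; field_simp; ring
    rwa [e] at this
  have hne : ∀ z ∈ dom (2 * σ), 1 - z.2 ≠ 0 := by
    intro z hz h
    have h1 : z.2 = 1 := (sub_eq_zero.1 h).symm
    have h2 : ‖z.2‖ < 2 * σ := hz.2
    rw [h1, norm_one] at h2
    linarith
  have hIan : AnalyticOnNhd ℂ (fun z : ℂ × ℂ => 1 / (2 * (1 - z.2))) (dom (2 * σ)) := fun z hz =>
    analyticAt_const.div (analyticAt_const.mul (analyticAt_const.sub analyticAt_snd))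
      (mul_ne_zero two_ne_zero (hne z hz))
  have hEan : AnalyticOnNhd ℂ E (dom (2 * σ)) := (hH.an.mono hsub).sub hIan
  have hQan : AnalyticOnNhd ℂ Q (dom (2 * σ)) := fun z hz =>
    ((hIan z hz).sub analyticAt_const).sub (analyticAt_snd.div analyticAt_const two_ne_zero)
  have hE' := fun z hz => norm_ds_ds_le hσ0 hEan (fun z hz => hH0 z (hsub hz)) (z := z) hz
  have hQ1 : ∀ z ∈ dom (2 * σ), ds Q z = 1 / (2 * (1 - z.2) ^ 2) - 1 / 2 := fun z hz =>
    (hasDerivAt_ds (hQan z hz)).unique (hasDerivAt_half_inv (hne z hz)).1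
  have hQ2 : ∀ z ∈ dom (2 * σ), ds (ds Q) z = 1 / (1 - z.2) ^ 3 := by
    intro z hz
    have e : ds Q =ᶠ[nhds z] fun z => 1 / (2 * (1 - z.2) ^ 2) - 1 / 2 := by
      filter_upwards [(isOpen_dom _).mem_nhds hz] with x hx using hQ1 x hx
    have h1 := hasDerivAt_ds (analyticAt_ds (hQan z hz))
    have h2 : (fun s' => ds Q (z.1, s')) =ᶠ[nhds z.2] fun s => 1 / (2 * (1 - s) ^ 2) - 1 / 2 := by
      have hc : Filter.Tendsto (fun s' : ℂ => (z.1, s')) (nhds z.2) (nhds z) :=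
        (Continuous.prodMk continuous_const continuous_id).tendsto z.2
      exact hc.eventually e
    exact h1.unique ((hasDerivAt_half_inv (hne z hz)).2.congr_of_eventuallyEq h2)
  have hadd := fun z hz => ds_add (isOpen_dom (2 * σ)) hQan hEan (z := z) hz
  have hd2 : dom σ ⊆ dom (2 * σ) := dom_mono (by linarith)
  have hKH' : 0 ≤ KH * q ^ 26 := by positivity
  have h26 : 0 ≤ q ^ 26 := by positivity
  refine ⟨hmap, (differentiable_id.div_const 2).differentiableOn, ⟨π, fun z => ?_⟩, fun x => ?_,
    fun y hy => ?_, fun y hy => ?_, fun z hz => ?_⟩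
  · ring
  · rw [show (x : ℂ) / 2 = ((x / 2 : ℝ) : ℂ) by push_cast; rfl, Complex.ofReal_im]
  · have hz := hd2 (zero_mem_dom hσ0 hy)
    have e1 := hH0 _ (hsub hz)
    have e2 : Q (y, 0) = 0 := by simp only [hQ]; norm_num
    simp only [hpull, e2, zero_add]
    refine e1.trans ?_
    gcongr
    linarith
  · have hz := zero_mem_dom hσ0 hy
    have e1 := (hE' _ hz).1
    rw [hpull, (hadd _ (hd2 hz)).1, hQ1 _ (hd2 hz)]
    have e2 : 2 * (KH * q ^ 51) / σ = 2 * (KH * q ^ 26) * q ^ 17 := by rw [hσ]; field_simp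
    have e3 : 2 * (KH * q ^ 26) * q ^ 17 ≤ 2 * (KH * q ^ 26) * 1 := by
      have := hqp 17; gcongr
    rw [show (1 : ℂ) / (2 * (1 - (y, (0 : ℂ)).2) ^ 2) - 1 / 2 = 0 by norm_num, zero_add]
    linarith
  · have e1 := (hE' _ hz).2
    rw [hpull, (hadd _ (hd2 hz)).2, hQ2 _ (hd2 hz), add_sub_right_comm]
    have e2 : 4 * (KH * q ^ 51) / σ ^ 2 = 4 * KH * q * q ^ 34 := by rw [hσ]; field_simp
    have e3 : 4 * KH * q * q ^ 34 ≤ 4 * KH * q * 1 := by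
      have := hqp 34; gcongr
    have e4 : ‖z.2‖ < σ := hz.2
    have e5 := norm_inv_cube_sub_one_le (s := z.2) (by linarith)
    refine (norm_add_le _ _).trans ?_
    linarith

lemma kam_sequence {γ KH : ℝ} (hγ : 0 < γ) (hKH : 0 ≤ KH) :
    ∃ L : ℝ, 1 ≤ L ∧ ∀ {q ε α : ℝ} {H : ℕ → ℂ × ℂ → ℂ},
      0 < q → L * q ≤ 1 → 0 < ε → ε ≤ 1 / 4 → Dioph γ ε α →
      (∀ n, GoodH ε ((q / 2 ^ n) ^ 8) (H n)) →
      (∀ n, ∀ z ∈ edom ε ((q / 2 ^ (n + 1)) ^ 8), ‖H (n + 1) z - H n z‖ ≤ KH * (q / 2 ^ n) ^ 51) →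
      (∀ z ∈ edom ε (q ^ 8), ‖H 0 z - 1 / (2 * (1 - z.2))‖ ≤ KH * q ^ 51) →
      ∃ (u G : ℕ → ℂ → ℂ) (c δ : ℕ → ℝ), (∀ n, 0 ≤ δ n ∧ δ n ≤ 1 / 4) ∧
        (∀ n, KamState (2 ^ 52 * KH + 2) ε α (q / 2 ^ n) (δ n) (H n) (u n) (G n) (c n)) ∧
        ∀ n (x : ℝ), ‖u (n + 1) x - u n x‖ ≤ q / 2 ^ n := by
  obtain ⟨L, hL1, hstep⟩ := kamState_step hγ hKH
  refine ⟨8 * L + 128 * KH + 128, by linarith, ?_⟩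
  intro q ε α H hq hLq hε hε1 hα hH hHH hH0
  have hKHq : 0 ≤ KH * q := by positivity
  have hLq' : 0 < L * q := by positivity
  set δ : ℕ → ℝ := fun n => (1 - (1 / 2) ^ n) / 4 with hδ
  have hp : ∀ n : ℕ, 0 < (1 / 2 : ℝ) ^ n ∧ (1 / 2 : ℝ) ^ n ≤ 1 := fun n =>
    ⟨by positivity, pow_le_one₀ (by norm_num) (by norm_num)⟩
  have hδ01 : ∀ n, 0 ≤ δ n ∧ δ n ≤ 1 / 4 := fun n =>
    ⟨by simp only [hδ]; linarith [(hp n).2], by simp only [hδ]; linarith [(hp n).1]⟩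
  have hdiv : ∀ n : ℕ, q / 2 ^ n = q * (1 / 2) ^ n := fun n => by
    rw [one_div, inv_pow, div_eq_mul_inv]
  obtain ⟨s, hs1, hs2⟩ := exists_seq_of_step (T := (ℂ → ℂ) × (ℂ → ℂ) × ℝ)
    (P := fun n t => KamState (2 ^ 52 * KH + 2) ε α (q / 2 ^ n) (δ n) (H n) t.1 t.2.1 t.2.2)
    (R := fun n t t' => ∀ x : ℝ, ‖t'.1 x - t.1 x‖ ≤ q / 2 ^ n)
    ⟨(id, fun y => y / 2, 1 / 2 - α / (2 * ε)), by
      have := kamState_init (α := α) hKH hq (by linarith) (by linarith) hε hε1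
        (by simpa using hH 0) hH0
      simpa [hδ] using this⟩ (by
      rintro n ⟨u, G, c⟩ h
      have hqn : 0 < q / 2 ^ n := by positivity
      have hqn1 : q / 2 ^ n ≤ q := by rw [hdiv]; nlinarith [(hp n).2]
      have h8 : 8 * (L * (q / 2 ^ n)) ≤ (1 / 2) ^ n := by
        rw [hdiv]
        nlinarith [(hp n).1]
      have e : q / 2 ^ (n + 1) = q / 2 ^ n / 2 := by rw [pow_succ]; field_simp
      have h1 := hH (n + 1)
      have h2 := hHH n
      rw [e] at h1 h2
      obtain ⟨u', G', c', h3, h4⟩ := hstep (δ' := δ (n + 1)) hqn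
        (by linarith [(hp n).2]) hε hε1 hα (hδ01 n).2 (hδ01 (n + 1)).2
        (by simp only [hδ, pow_succ]; linarith) (hH n) h1 h2 h
      refine ⟨(u', G', c'), by rw [e]; exact h3, fun x => (h4 x).trans ?_⟩
      have hq1 : q / 2 ^ n ≤ 1 := by nlinarith
      calc L * (q / 2 ^ n) ^ 9 = L * (q / 2 ^ n) * (q / 2 ^ n) ^ 7 * (q / 2 ^ n) := by ring
        _ ≤ 1 * 1 * (q / 2 ^ n) := by
          have := pow_le_one₀ hqn.le hq1 (n := 7)
          gcongr
          linarith [(hp n).2]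
        _ = _ := by ring)
  exact ⟨fun n => (s n).1, fun n => (s n).2.1, fun n => (s n).2.2, δ, hδ01, hs1, hs2⟩

end DualBilliard

namespace DualBilliard

lemma fderiv_eq_dx_ds (F : ℂ × ℂ → ℂ) (z : ℂ × ℂ) (a b : ℂ) :
    fderiv ℂ F z (a, b) = a * dx F z + b * ds F z := by
  have : ((a, b) : ℂ × ℂ) = a • ((1, 0) : ℂ × ℂ) + b • ((0, 1) : ℂ × ℂ) := by
    simp
  rw [this, map_add, map_smul, map_smul]
  rfl

lemma hasDerivAt_comp_affine {f : ℂ → ℂ} {f' a e : ℂ} (hf : HasDerivAt f f' a) :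
    HasDerivAt (fun s : ℂ => f (a + e * s)) (f' * e) 0 := by
  have hl : HasDerivAt (fun s : ℂ => a + e * s) e 0 := by
    simpa using ((hasDerivAt_id (0 : ℂ)).const_mul e).const_add a
  exact HasDerivAt.comp (h₂ := f) (0 : ℂ) (by simpa using hf) hl

/-- Small defect of the discrete Euler-Lagrange equation along the approximate solution. -/
lemma KamState.residual {M ε α q δ c : ℝ} {H : ℂ × ℂ → ℂ} {u G : ℂ → ℂ}
    (h : KamState M ε α q δ H u G c) (hM : 0 ≤ M) (hq : 0 < q) (hq1 : q ≤ 1 / 2)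
    (hε : 0 < ε) (hε1 : ε ≤ 1 / 4) (hδ : δ ≤ 1 / 4)
    (hH : AnalyticOnNhd ℂ H (edom ε (q ^ 8))) (y : ℝ) :
    ‖ε * dx H (u y, incr ε α u (y, 0)) - ds H (u y, incr ε α u (y, 0)) +
      ds H (u (y - α), incr ε α u (y - α, 0))‖ ≤ 8 * M * q := by
  have hε0 : (ε : ℂ) ≠ 0 := by exact_mod_cast hε.ne'
  have hσ : 0 < q ^ 8 := by positivity
  have hσ1 : q ^ 8 ≤ 1 / 16 := by
    calc q ^ 8 ≤ (1 / 2) ^ 8 := by gcongr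
      _ ≤ 1 / 16 := by norm_num
  obtain ⟨σ, hσd⟩ : ∃ σ, σ = q ^ 8 := ⟨_, rfl⟩
  obtain ⟨hmap, hGdiff, -, -, hval, hslope, -⟩ := h
  rw [← hσd] at hσ hσ1 hH hmap hGdiff hval hslope
  have hdom : ∀ x : ℝ, ((x : ℂ), (0 : ℂ)) ∈ dom (2 * σ) := fun x =>
    zero_mem_dom (by linarith) (ofReal_mem_strip (by linarith) x)
  have hmem := fun x : ℝ => hmap.mem_edom (α := α) hσ hσ1 hδ hε hε1 (hdom x)
  have hud : ∀ x : ℝ, HasDerivAt u (deriv u x) x := fun x =>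
    (differentiableAt_strip hmap.diff (ofReal_mem_strip (by linarith) x)).hasDerivAt
  have hGd : ∀ x : ℝ, HasDerivAt G (deriv G x) x := fun x =>
    (differentiableAt_strip hGdiff (ofReal_mem_strip (by linarith) x)).hasDerivAt
  have han := hmap.analyticOnNhd_pull hσ hσ1 hδ hε hε1 hH hGdiff c
  have hy : ∀ x : ℝ, HasDerivAt (fun z : ℂ => pull ε α c u G H (z, 0))
      (deriv u x * dx H (u x, incr ε α u (x, 0)) + (deriv u (x + α) - deriv u x) / ε *
        ds H (u x, incr ε α u (x, 0)) - (deriv G (x + α) - deriv G x) / ε) x := by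
    intro x
    have hu1 : HasDerivAt (fun z : ℂ => u (z + α + ε * 0)) (deriv u (x + α)) x := by
      have h1 := hud (x + α)
      push_cast at h1
      simpa using h1.comp_add_const (x : ℂ) (α : ℂ)
    have hG1 : HasDerivAt (fun z : ℂ => G (z + α + ε * 0)) (deriv G (x + α)) x := by
      have h1 := hGd (x + α)
      push_cast at h1
      simpa using h1.comp_add_const (x : ℂ) (α : ℂ)
    have hi : HasDerivAt (fun z : ℂ => incr ε α u (z, 0)) ((deriv u (x + α) - deriv u x) / ε) x :=
      ((hu1.fun_sub (hud x)).sub_const _).div_const _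
    have h2 := (hH _ (hmem x)).differentiableAt.hasFDerivAt.comp_hasDerivAt (x : ℂ)
      ((hud x).prodMk hi)
    rw [fderiv_eq_dx_ds] at h2
    exact (h2.fun_sub ((hG1.fun_sub (hGd x)).div_const _)).sub_const _
  have hs : ∀ x : ℝ, ds (pull ε α c u G H) (x, 0) =
      deriv u (x + α) * ds H (u x, incr ε α u (x, 0)) - deriv G (x + α) := by
    intro x
    have hu1 := hud (x + α)
    have hG1 := hGd (x + α)
    push_cast at hu1 hG1
    replace hu1 := hasDerivAt_comp_affine (e := ε) hu1
    replace hG1 := hasDerivAt_comp_affine (e := ε) hG1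
    have hi : HasDerivAt (fun s : ℂ => incr ε α u (x, s)) (deriv u (x + α) * ε / ε) 0 :=
      ((hu1.sub_const (u x)).sub_const (α : ℂ)).div_const (ε : ℂ)
    have h2 := (hH _ (hmem x)).differentiableAt.hasFDerivAt.comp_hasDerivAt (0 : ℂ)
      ((hasDerivAt_const (0 : ℂ) (u x)).prodMk hi)
    rw [fderiv_eq_dx_ds] at h2
    have h3 := (h2.fun_sub ((hG1.sub_const (G x)).div_const (ε : ℂ))).sub_const (c : ℂ)
    have h4 := (hasDerivAt_ds (han _ (hdom x))).unique h3
    rw [h4]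
    field_simp
    ring
  have hsy := hs y
  have hsy' := hs (y - α)
  push_cast at hsy'
  rw [sub_add_cancel] at hsy'
  have hslice : DifferentiableOn ℂ (fun z : ℂ => pull ε α c u G H (z, 0)) (strip σ) := fun z hz =>
    (hasDerivAt_dx (han (z, 0) (zero_mem_dom (by linarith)
      (strip_mono (by linarith) hz)))).differentiableAt.differentiableWithinAt
  have b1 : ‖deriv (fun z : ℂ => pull ε α c u G H (z, 0)) y‖ ≤ M * q ^ 51 / (σ / 2) :=
    norm_deriv_le_strip' (R' := σ / 2) (by linarith) (by linarith) hslice hval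
      (ofReal_mem_strip (by linarith) y)
  have b2 := hslope y (ofReal_mem_strip hσ y)
  have b3 := hslope (y - α) (by exact_mod_cast ofReal_mem_strip hσ (y - α))
  have b4 := hmap.der y (ofReal_mem_strip (by linarith) y)
  have b5 : 3 / 4 ≤ ‖deriv u y‖ := by
    have := norm_sub_norm_le (1 : ℂ) (deriv u y)
    rw [norm_one, norm_sub_rev] at this
    linarith
  rw [(hy y).deriv] at b1
  set R := ε * dx H (u y, incr ε α u (y, 0)) - ds H (u y, incr ε α u (y, 0)) +
      ds H (u (y - α), incr ε α u (y - α, 0)) with hR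
  have key : deriv u y * R = ε * (deriv u y * dx H (u y, incr ε α u (y, 0)) +
      (deriv u (y + α) - deriv u y) / ε * ds H (u y, incr ε α u (y, 0)) -
      (deriv G (y + α) - deriv G y) / ε) - ds (pull ε α c u G H) (y, 0) +
      ds (pull ε α c u G H) (y - α, 0) := by
    rw [hsy, hsy', hR]
    field_simp
    ring
  have e1 : M * q ^ 51 / (σ / 2) = 2 * M * q * q ^ 42 := by rw [hσd]; field_simp
  have hp : ∀ n : ℕ, q ^ n ≤ 1 := fun n => pow_le_one₀ hq.le (by linarith)
  have e2 : 2 * M * q * q ^ 42 ≤ 2 * M * q * 1 := by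
    have := hp 42; gcongr
  have e3 : M * q ^ 26 ≤ M * q := by
    have : q ^ 26 = q * q ^ 25 := by ring
    rw [this]
    have := hp 25
    gcongr
    nlinarith
  have b6 : ‖deriv u y * R‖ ≤ 4 * M * q := by
    rw [key]
    refine (norm_add_le _ _).trans ?_
    have := norm_sub_le (ε * (deriv u y * dx H (u y, incr ε α u (y, 0)) +
      (deriv u (y + α) - deriv u y) / ε * ds H (u y, incr ε α u (y, 0)) -
      (deriv G (y + α) - deriv G y) / ε)) (ds (pull ε α c u G H) (y, 0))
    rw [norm_mul, Complex.norm_real, Real.norm_of_nonneg hε.le] at this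
    have h6 := mul_le_mul hε1 b1 (norm_nonneg _) (by norm_num)
    have : 0 ≤ M * q := by positivity
    linarith
  rw [norm_mul] at b6
  have : 0 ≤ M * q := by positivity
  nlinarith [norm_nonneg R]

end DualBilliard

namespace DualBilliard

open Filter Topology

lemma exists_tendstoUniformlyOn_geometric {X E : Type*} [MetricSpace E] [CompleteSpace E]
    {f : ℕ → X → E} {S : Set X} {C : ℝ} (h : ∀ n, ∀ x ∈ S, dist (f n x) (f (n + 1) x) ≤ C / 2 / 2 ^ n) :
    ∃ g : X → E, TendstoUniformlyOn f g atTop S := by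
  have h1 : ∀ x, ∃ a, x ∈ S → Tendsto (fun n => f n x) atTop (𝓝 a) := by
    intro x
    by_cases hx : x ∈ S
    · obtain ⟨a, ha⟩ := cauchySeq_tendsto_of_complete
        (cauchySeq_of_le_geometric_two (C := C) (fun n => h n x hx))
      exact ⟨a, fun _ => ha⟩
    · exact ⟨f 0 x, fun hx' => absurd hx' hx⟩
  choose g hg using h1
  refine ⟨g, ?_⟩
  rw [Metric.tendstoUniformlyOn_iff]
  intro e he
  have h2 : Tendsto (fun n : ℕ => C / 2 ^ n) atTop (𝓝 0) := by
    have := (tendsto_pow_atTop_nhds_zero_of_lt_one (r := (1 / 2 : ℝ)) (by norm_num)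
      (by norm_num)).const_mul C
    rw [mul_zero] at this
    refine this.congr (fun n => ?_)
    rw [one_div, inv_pow, div_eq_mul_inv]
  filter_upwards [h2.eventually_lt_const he] with n hn x hx
  have := dist_le_of_le_geometric_two_of_tendsto (C := C) (fun n => h n x hx) (hg x hx) n
  rw [dist_comm]
  exact this.trans_lt hn

lemma analyticAt_dx {F : ℂ × ℂ → ℂ} {z : ℂ × ℂ} (hF : AnalyticAt ℂ F z) : AnalyticAt ℂ (dx F) z :=
  ((ContinuousLinearMap.apply ℂ ℂ ((1, 0) : ℂ × ℂ)).analyticAt _).comp hF.fderiv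

lemma real_mem_edom {ε σ : ℝ} (hσ : 0 < σ) {x s : ℝ} (hs : |s| < 1 / 2) :
    ((x : ℂ), (s : ℂ)) ∈ edom ε σ := by
  refine ⟨by simpa using hσ, ?_, by simpa using hs⟩
  simp only [Complex.add_im, Complex.ofReal_im, Complex.mul_im, Complex.ofReal_re]
  simpa using hσ

/-- Cauchy estimates for both partial derivatives at real points. -/
lemma norm_dx_ds_le_real {ε σ B : ℝ} (hσ : 0 < σ) (hσ1 : σ ≤ 1 / 16) (hε : 0 < ε) (hε1 : ε ≤ 1 / 4)
    {D : ℂ × ℂ → ℂ} (hD : AnalyticOnNhd ℂ D (edom ε σ)) (hB : ∀ z ∈ edom ε σ, ‖D z‖ ≤ B)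
    {x s : ℝ} (hs : |s| < 3 / 8) : ‖dx D (x, s)‖ ≤ B / σ ∧ ‖ds D (x, s)‖ ≤ B / σ := by
  have hmem := real_mem_edom (ε := ε) (x := x) hσ (lt_trans hs (by norm_num))
  have hx : ∀ z ∈ strip (4 * σ), (z, (s : ℂ)) ∈ edom ε σ := by
    intro z hz
    refine ⟨hz, ?_, by simpa using lt_trans hs (by norm_num)⟩
    simp only [Complex.add_im, Complex.ofReal_im, Complex.mul_im, Complex.ofReal_re]
    simpa [mem_strip] using hz
  constructor
  · rw [← (hasDerivAt_dx (hD _ hmem)).deriv]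
    exact norm_deriv_le_strip' (R := 4 * σ) (R' := 3 * σ) hσ (by linarith)
      (fun z hz => (hasDerivAt_dx (hD _ (hx z hz))).differentiableAt.differentiableWithinAt)
      (fun z hz => hB _ (hx z hz)) (ofReal_mem_strip (by linarith) x)
  · rw [← (hasDerivAt_ds (hD _ hmem)).deriv]
    have hb : ∀ w ∈ Metric.closedBall (s : ℂ) σ, ((x : ℂ), w) ∈ edom ε σ := by
      intro w hw
      rw [mem_closedBall_iff_norm] at hw
      have h1 : |w.im| ≤ σ := by
        have := (Complex.abs_im_le_norm (w - s)).trans hw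
        simpa using this
      refine ⟨by simpa using hσ, ?_, ?_⟩
      · simp only [Complex.add_im, Complex.ofReal_im, Complex.mul_im, Complex.ofReal_re]
        rw [zero_add, zero_mul, add_zero, abs_mul, abs_of_pos hε]
        nlinarith [abs_nonneg w.im]
      · have h2 := norm_sub_norm_le w s
        rw [Complex.norm_real, Real.norm_eq_abs] at h2
        simp only
        linarith
    refine Complex.norm_deriv_le_of_forall_mem_sphere_norm_le hσ ?_
      (fun z hz => hB _ (hb z (Metric.sphere_subset_closedBall hz)))
    refine DifferentiableOn.diffContOnCl (fun z hz => ?_)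
    rw [closure_ball _ hσ.ne'] at hz
    exact (hasDerivAt_ds (hD _ (hb z hz))).differentiableAt.differentiableWithinAt

lemma dx_ds_sub {F E : ℂ × ℂ → ℂ} {z : ℂ × ℂ} (hF : AnalyticAt ℂ F z) (hE : AnalyticAt ℂ E z) :
    dx (fun z => F z - E z) z = dx F z - dx E z ∧ ds (fun z => F z - E z) z = ds F z - ds E z := by
  simp only [dx, ds]
  rw [fderiv_fun_sub hF.differentiableAt hE.differentiableAt]
  exact ⟨rfl, rfl⟩

/-- Real slab used for passing to the limit. -/
def slab : Set (ℝ × ℝ) := {z | |z.2| < 3 / 8}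

lemma exists_partial_limits {q ε KH : ℝ} (hKH : 0 ≤ KH) (hq : 0 < q) (hq1 : q ≤ 1 / 2) (hε : 0 < ε)
    (hε1 : ε ≤ 1 / 4) {H : ℕ → ℂ × ℂ → ℂ}
    (hH : ∀ n, AnalyticOnNhd ℂ (H n) (edom ε ((q / 2 ^ n) ^ 8)))
    (hHH : ∀ n, ∀ z ∈ edom ε ((q / 2 ^ (n + 1)) ^ 8),
      ‖H (n + 1) z - H n z‖ ≤ KH * (q / 2 ^ n) ^ 51) {Hl : ℝ → ℝ → ℝ}
    (hHl : ∀ x s : ℝ, |s| < 1 / 2 → Tendsto (fun n => H n (x, s)) atTop (𝓝 (Hl x s : ℂ))) :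
    ∃ A B : ℝ × ℝ → ℂ,
      TendstoUniformlyOn (fun n (z : ℝ × ℝ) => dx (H n) (z.1, z.2)) A atTop slab ∧
      TendstoUniformlyOn (fun n (z : ℝ × ℝ) => ds (H n) (z.1, z.2)) B atTop slab ∧
      ContinuousOn A slab ∧ ContinuousOn B slab ∧
      ∀ x s : ℝ, |s| < 3 / 8 → HasDerivAt (fun t => Hl t s) (A (x, s)).re x ∧
        HasDerivAt (fun t => Hl x t) (B (x, s)).re s := by
  have hqn : ∀ n : ℕ, 0 < q / 2 ^ n ∧ q / 2 ^ n ≤ 1 / 2 := fun n =>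
    ⟨by positivity, (div_le_self hq.le (one_le_pow₀ (by norm_num))).trans hq1⟩
  have hσ : ∀ n : ℕ, 0 < (q / 2 ^ n) ^ 8 ∧ (q / 2 ^ n) ^ 8 ≤ 1 / 16 := fun n => by
    refine ⟨by have := (hqn n).1; positivity, ?_⟩
    calc (q / 2 ^ n) ^ 8 ≤ (1 / 2) ^ 8 := by
          have := (hqn n).1.le; have := (hqn n).2; gcongr
      _ ≤ 1 / 16 := by norm_num
  have hsub : ∀ n, edom ε ((q / 2 ^ (n + 1)) ^ 8) ⊆ edom ε ((q / 2 ^ n) ^ 8) := fun n => by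
    apply edom_mono
    have : q / 2 ^ (n + 1) ≤ q / 2 ^ n := by
      apply div_le_div_of_nonneg_left hq.le (by positivity)
      exact pow_le_pow_right₀ (by norm_num) (Nat.le_succ n)
    have := (hqn (n + 1)).1.le
    gcongr
  have hstep : ∀ n, ∀ z ∈ slab, ‖dx (H (n + 1)) (z.1, z.2) - dx (H n) (z.1, z.2)‖ ≤
      512 * KH / 2 / 2 ^ n ∧ ‖ds (H (n + 1)) (z.1, z.2) - ds (H n) (z.1, z.2)‖ ≤
      512 * KH / 2 / 2 ^ n := by
    rintro n ⟨x, s⟩ hz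
    have hz' : |s| < 3 / 8 := hz
    have hm := real_mem_edom (ε := ε) (x := x) (hσ (n + 1)).1 (lt_trans hz' (by norm_num))
    have h1 := norm_dx_ds_le_real (hσ (n + 1)).1 (hσ (n + 1)).2 hε hε1
      (D := fun z => H (n + 1) z - H n z)
      (fun z hz => (hH (n + 1) z hz).sub (hH n z (hsub n hz))) (hHH n) (x := x) hz'
    obtain ⟨e1, e2⟩ := dx_ds_sub (hH (n + 1) _ hm) (hH n _ (hsub n hm))
    rw [e1, e2] at h1
    have e3 : KH * (q / 2 ^ n) ^ 51 / (q / 2 ^ (n + 1)) ^ 8 ≤ 512 * KH / 2 / 2 ^ n := by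
      have e4 : KH * (q / 2 ^ n) ^ 51 / (q / 2 ^ (n + 1)) ^ 8 =
          256 * KH * (q / 2 ^ n) * (q / 2 ^ n) ^ 42 := by
        rw [pow_succ (2 : ℝ) n]
        field_simp
        norm_num
      have e5 : (q / 2 ^ n) ^ 42 ≤ 1 := pow_le_one₀ (hqn n).1.le ((hqn n).2.trans (by norm_num))
      have e6 : q / 2 ^ n ≤ 1 / 2 ^ n := by gcongr; linarith
      rw [e4]
      calc 256 * KH * (q / 2 ^ n) * (q / 2 ^ n) ^ 42 ≤ 256 * KH * (1 / 2 ^ n) * 1 := by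
            have := (hqn n).1; gcongr
        _ = 512 * KH / 2 / 2 ^ n := by ring
    exact ⟨h1.1.trans e3, h1.2.trans e3⟩
  obtain ⟨A, hA⟩ := exists_tendstoUniformlyOn_geometric
    (f := fun n (z : ℝ × ℝ) => dx (H n) (z.1, z.2)) (S := slab) (C := 512 * KH)
    (fun n z hz => by rw [dist_comm, dist_eq_norm]; exact (hstep n z hz).1)
  obtain ⟨B, hB⟩ := exists_tendstoUniformlyOn_geometric
    (f := fun n (z : ℝ × ℝ) => ds (H n) (z.1, z.2)) (S := slab) (C := 512 * KH)
    (fun n z hz => by rw [dist_comm, dist_eq_norm]; exact (hstep n z hz).2)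
  have hc : Continuous (fun z : ℝ × ℝ => ((z.1 : ℂ), (z.2 : ℂ))) := by fun_prop
  have han : ∀ n, ∀ z ∈ slab, AnalyticAt ℂ (H n) ((z.1 : ℂ), (z.2 : ℂ)) := fun n z hz =>
    hH n _ (real_mem_edom (hσ n).1 (lt_trans hz (by norm_num)))
  have hI : IsOpen {t : ℝ | |t| < 3 / 8} := isOpen_lt continuous_abs continuous_const
  refine ⟨A, B, hA, hB, hA.continuousOn ?_, hB.continuousOn ?_, fun x s hs => ⟨?_, ?_⟩⟩
  · exact Frequently.of_forall fun n z hz => (ContinuousAt.comp (f := fun z : ℝ × ℝ =>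
      ((z.1 : ℂ), (z.2 : ℂ))) (analyticAt_dx (han n z hz)).continuousAt
      hc.continuousAt).continuousWithinAt
  · exact Frequently.of_forall fun n z hz => (ContinuousAt.comp (f := fun z : ℝ × ℝ =>
      ((z.1 : ℂ), (z.2 : ℂ))) (analyticAt_ds (han n z hz)).continuousAt
      hc.continuousAt).continuousWithinAt
  · have h1 := hasDerivAt_of_tendstoUniformlyOn (f := fun n (t : ℝ) => H n (t, s))
      (g := fun t => (Hl t s : ℂ)) isOpen_univ
      ((hA.comp (fun t : ℝ => (t, s))).mono (s' := Set.univ) (fun t _ => hs))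
      (Eventually.of_forall fun n t _ => (hasDerivAt_dx (han n (t, s) hs)).comp_ofReal)
      (fun t _ => hHl t s (lt_trans hs (by norm_num))) (Set.mem_univ x)
    exact Complex.reCLM.hasFDerivAt.comp_hasDerivAt x h1
  · have h1 := hasDerivAt_of_tendstoUniformlyOn (f := fun n (t : ℝ) => H n (x, t))
      (g := fun t => (Hl x t : ℂ)) hI
      ((hB.comp (fun t : ℝ => (x, t))).mono (s' := {t : ℝ | |t| < 3 / 8}) (fun t ht => ht))
      (Eventually.of_forall fun n t ht => (hasDerivAt_ds (han n (x, t) ht)).comp_ofReal)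
      (fun t ht => hHl x t (lt_trans ht (by norm_num))) hs
    exact Complex.reCLM.hasFDerivAt.comp_hasDerivAt s h1

end DualBilliard

namespace DualBilliard

open Filter Topology

/-- A curve solving the discrete Euler-Lagrange equation of `Hl` with rotation `α`. -/
structure ELCurve (ε α : ℝ) (Hl : ℝ → ℝ → ℝ) (u : ℝ → ℝ) : Prop where
  lip : ∀ x y, |u y - u x - (y - x)| ≤ |y - x| / 4
  per : ∀ x, u (x + 2 * π) = u x + 2 * π
  shift : ∀ x, |u (x + α) - u x - α| ≤ ε / 4
  el : ∀ x, ∃ a b b' : ℝ,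
    HasDerivAt (fun t => Hl t ((u (x + α) - u x - α) / ε)) a (u x) ∧
    HasDerivAt (fun t => Hl (u x) t) b ((u (x + α) - u x - α) / ε) ∧
    HasDerivAt (fun t => Hl (u (x - α)) t) b' ((u x - u (x - α) - α) / ε) ∧
    ε * a - b + b' = 0

theorem kam_limit {γ KH : ℝ} (hγ : 0 < γ) (hKH : 0 ≤ KH) :
    ∃ L : ℝ, 1 ≤ L ∧ ∀ {q ε α : ℝ} {H : ℕ → ℂ × ℂ → ℂ} {Hl : ℝ → ℝ → ℝ},
      0 < q → L * q ≤ 1 → 0 < ε → ε ≤ 1 / 4 → Dioph γ ε α →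
      (∀ n, GoodH ε ((q / 2 ^ n) ^ 8) (H n)) →
      (∀ n, ∀ z ∈ edom ε ((q / 2 ^ (n + 1)) ^ 8), ‖H (n + 1) z - H n z‖ ≤ KH * (q / 2 ^ n) ^ 51) →
      (∀ z ∈ edom ε (q ^ 8), ‖H 0 z - 1 / (2 * (1 - z.2))‖ ≤ KH * q ^ 51) →
      (∀ x s : ℝ, |s| < 1 / 2 → Tendsto (fun n => H n (x, s)) atTop (𝓝 (Hl x s : ℂ))) →
      ∃ u : ℝ → ℝ, ELCurve ε α Hl u := by
  obtain ⟨L, hL1, hL⟩ := kam_sequence hγ hKH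
  refine ⟨L + 2, by linarith, ?_⟩
  intro q ε α H Hl hq hLq hε hε1 hα hH hHH hH0 hHl
  have hq1 : q ≤ 1 / 2 := by nlinarith
  obtain ⟨U, G, c, δ, hδ, hst, hU⟩ := hL hq (by nlinarith) hε hε1 hα hH hHH hH0
  obtain ⟨A, B, hA, hB, hAc, hBc, hAB⟩ :=
    exists_partial_limits hKH hq hq1 hε hε1 (fun n => (hH n).an) hHH hHl
  obtain ⟨g, hg⟩ := exists_tendstoUniformlyOn_geometric (f := fun n (x : ℝ) => U n x)
    (S := Set.univ) (C := 2 * q) (fun n x _ => by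
      rw [dist_comm, dist_eq_norm]
      exact (hU n x).trans (le_of_eq (by ring)))
  have hlim : ∀ x : ℝ, Tendsto (fun n => U n x) atTop (𝓝 (g x)) := fun x =>
    hg.tendsto_at (Set.mem_univ x)
  have hreal : ∀ x, (g x).im = 0 := fun x =>
    tendsto_nhds_unique ((Complex.continuous_im.tendsto _).comp (hlim x))
      (tendsto_const_nhds.congr (fun n => ((hst n).map.real x).symm))
  set u : ℝ → ℝ := fun x => (g x).re with hu
  have hgu : ∀ x, g x = (u x : ℂ) := fun x => (ofReal_re_of_im (hreal x)).symm
  have hlimR : ∀ x : ℝ, Tendsto (fun n => (U n x).re) atTop (𝓝 (u x)) := fun x =>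
    (Complex.continuous_re.tendsto _).comp (hlim x)
  have hUr : ∀ n (x : ℝ), (((U n x).re : ℝ) : ℂ) = U n x := fun n x =>
    ofReal_re_of_im ((hst n).map.real x)
  have hσ : ∀ n : ℕ, 0 < (q / 2 ^ n) ^ 8 := fun n => by positivity
  have hshift : ∀ x n, |(U n ((x + α : ℝ) : ℂ)).re - (U n x).re - α| ≤ ε / 4 := by
    intro x n
    have h1 := (hst n).map.shift x (ofReal_mem_strip (by linarith [hσ n]) x)
    have h2 := (Complex.abs_re_le_norm _).trans h1
    simp only [Complex.sub_re, Complex.ofReal_re] at h2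
    push_cast
    nlinarith [(hδ n).2]
  have hshift' : ∀ x, |u (x + α) - u x - α| ≤ ε / 4 := fun x =>
    le_of_tendsto ((((hlimR (x + α)).sub (hlimR x)).sub_const α).abs)
      (Eventually.of_forall (hshift x))
  refine ⟨u, ⟨fun x y => ?_, fun x => ?_, hshift', fun x => ?_⟩⟩
  · refine le_of_tendsto ((((hlimR y).sub (hlimR x)).sub_const (y - x)).abs)
      (Eventually.of_forall fun n => ?_)
    have h3 : 0 < 3 * (q / 2 ^ n) ^ 8 := by linarith [hσ n]
    have h1 := norm_sub_le_strip (f := fun z => U n z - z) (C := δ n)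
      ((hst n).map.diff.sub differentiableOn_id) (fun z hz => by
        have := (differentiableAt_strip (hst n).map.diff hz).hasDerivAt.fun_sub (hasDerivAt_id z)
        have := HasDerivAt.deriv (f := fun z => U n z - z) this
        rw [this]
        exact (hst n).map.der z hz) (ofReal_mem_strip h3 x) (ofReal_mem_strip h3 y)
    have h2 : U n y - y - (U n x - x) = (((U n y).re - (U n x).re - (y - x) : ℝ) : ℂ) := by
      push_cast; rw [hUr, hUr]; ring
    rw [h2, ← Complex.ofReal_sub, Complex.norm_real, Complex.norm_real, Real.norm_eq_abs,
      Real.norm_eq_abs] at h1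
    nlinarith [(hδ n).2, abs_nonneg (y - x)]
  · have h1 := hlimR (x + 2 * π)
    refine tendsto_nhds_unique h1 (((hlimR x).add_const (2 * π)).congr fun n => ?_)
    have := (hst n).map.per x
    push_cast
    rw [this]
    simp
  · have hS : ∀ x, (u x, (u (x + α) - u x - α) / ε) ∈ slab := fun x => by
      change |(_ : ℝ)| < 3 / 8
      rw [abs_div, abs_of_pos hε, div_lt_iff₀ hε]
      linarith [hshift' x]
    set P : ℕ → ℝ → ℝ × ℝ := fun n x =>
      ((U n x).re, ((U n ((x + α : ℝ) : ℂ)).re - (U n x).re - α) / ε) with hP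
    have hPS : ∀ n x, P n x ∈ slab := fun n x => by
      change |(_ : ℝ)| < 3 / 8
      rw [abs_div, abs_of_pos hε, div_lt_iff₀ hε]
      linarith [hshift x n]
    have hPl : ∀ x, Tendsto (fun n => P n x) atTop
        (𝓝[slab] (u x, (u (x + α) - u x - α) / ε)) := fun x =>
      tendsto_nhdsWithin_iff.2 ⟨(hlimR x).prodMk_nhds
        ((((hlimR (x + α)).sub (hlimR x)).sub_const α).div_const ε),
        Eventually.of_forall fun n => hPS n x⟩
    have hPc : ∀ n (x : ℝ), (((P n x).1 : ℂ), ((P n x).2 : ℂ)) = (U n x, incr ε α (U n) (x, 0)) := by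
      intro n x
      simp only [hP, incr]
      push_cast
      rw [hUr]
      have := hUr n (x + α)
      push_cast at this
      rw [this, mul_zero, add_zero]
    have tA := fun x => hA.tendsto_comp (hAc _ (hS x)) (hPl x)
    have tB := fun x => hB.tendsto_comp (hBc _ (hS x)) (hPl x)
    simp only [hPc] at tA tB
    have tB' := tB (x - α)
    push_cast at tB'
    have hs : ∀ x, |(u (x + α) - u x - α) / ε| < 3 / 8 := hS
    have hs' := hs (x - α)
    have hres := squeeze_zero_norm (fun n => (hst n).residual (by positivity) (by positivity)
      ((div_le_self hq.le (one_le_pow₀ (by norm_num))).trans hq1) hε hε1 (hδ n).2 (hH n).an x)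
      (a := fun n => 8 * (2 ^ 52 * KH + 2) * (q / 2 ^ n)) (by
        have := (tendsto_pow_atTop_nhds_zero_of_lt_one (r := (1 / 2 : ℝ)) (by norm_num)
          (by norm_num)).const_mul (8 * (2 ^ 52 * KH + 2) * q)
        rw [mul_zero] at this
        refine this.congr (fun n => ?_)
        rw [one_div, inv_pow]
        ring)
    have hlim0 := tendsto_nhds_unique hres ((((tA x).const_mul (ε : ℂ)).sub (tB x)).add tB')
    have h0 := congrArg Complex.re hlim0
    simp only [Complex.add_re, Complex.sub_re, Complex.mul_re, Complex.ofReal_re,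
      Complex.ofReal_im, zero_mul, sub_zero, Complex.zero_re] at h0
    rw [sub_add_cancel] at h0 hs'
    exact ⟨_, _, _, (hAB _ _ (hs x)).1, (hAB _ _ (hs x)).2, (hAB _ _ hs').2, h0.symm⟩

end DualBilliard

namespace DualBilliard

open Filter Topology

lemma fc_deriv {F F' : ℝ → ℂ} (hF : ∀ x, HasDerivAt F (F' x) x) (hF' : Continuous F')
    (hper : Function.Periodic F (2 * π)) {k : ℤ} (hk : k ≠ 0) :
    fc F' k = Complex.I * k * fc F k := by
  have h := fourierCoeffOn_of_hasDerivAt Real.two_pi_pos (f := F) (f' := F') hk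
    (fun x _ => hF x) (hF'.intervalIntegrable _ _)
  have h0 : F (2 * π) = F 0 := by simpa using hper 0
  rw [← fc_eq, ← fc_eq, h0, sub_self, mul_zero, zero_sub] at h
  have hk' : (k : ℂ) ≠ 0 := by exact_mod_cast hk
  have hπ : (π : ℂ) ≠ 0 := by exact_mod_cast Real.pi_ne_zero
  rw [h]
  push_cast
  field_simp [Complex.I_ne_zero]
  ring

lemma exists_fc_decay (n : ℕ) : ∀ F : ℝ → ℂ, ContDiff ℝ n F → Function.Periodic F (2 * π) →
    ∃ G : ℝ → ℂ, Continuous G ∧ ∀ k : ℤ, k ≠ 0 → ‖fc G k‖ = |(k : ℝ)| ^ n * ‖fc F k‖ := by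
  induction n with
  | zero => exact fun F hF _ => ⟨F, hF.continuous, fun k _ => by simp⟩
  | succ n ih =>
    intro F hF hper
    have hd : ContDiff ℝ n (deriv F) := by
      push_cast at hF
      exact (contDiff_succ_iff_deriv.1 hF).2.2
    have hdiff : Differentiable ℝ F := hF.differentiable (by simp)
    obtain ⟨G, hG, hGk⟩ := ih (deriv F) hd (fun x => by
      have := deriv_comp_add_const F (2 * π) x
      rw [← this]
      congr 1
      exact funext hper)
    refine ⟨G, hG, fun k hk => ?_⟩
    rw [hGk k hk, fc_deriv (fun x => (hdiff x).hasDerivAt) hd.continuous hper hk, norm_mul, norm_mul,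
      Complex.norm_I, one_mul, Complex.norm_intCast]
    ring

lemma summable_fc_rpow {F : ℝ → ℂ} (hF : ContDiff ℝ 7 F) (hper : Function.Periodic F (2 * π)) :
    Summable fun k : ℤ => ‖fc F k‖ * |(k : ℝ)| ^ (51 / 8 : ℝ) := by
  obtain ⟨G, hG, hGk⟩ := exists_fc_decay 7 F hF hper
  have hL2 : MemLp G 2 (volume.restrict (Set.Ioc 0 (2 * π))) := by
    obtain ⟨C, hC⟩ := isCompact_Icc.exists_bound_of_continuousOn (s := Set.Icc 0 (2 * π))
      hG.continuousOn
    refine MemLp.of_bound hG.aestronglyMeasurable C ?_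
    exact (ae_restrict_iff' measurableSet_Ioc).2
      (Eventually.of_forall fun x hx => hC x (Set.Ioc_subset_Icc_self hx))
  have h1 := (hasSum_sq_fourierCoeffOn Real.two_pi_pos hL2).summable
  simp only [← fc_eq] at h1
  have h2 := Real.summable_abs_int_rpow (b := 5 / 4) (by norm_num)
  refine Summable.of_nonneg_of_le (fun k => by positivity) (fun k => ?_) (h1.add h2)
  rcases eq_or_ne k 0 with rfl | hk
  · simp only [Int.cast_zero, abs_zero]
    rw [Real.zero_rpow (by norm_num), mul_zero]
    positivity
  · rw [hGk k hk]
    have hk0 : 0 < |(k : ℝ)| := abs_pos.2 (by exact_mod_cast hk)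
    have e1 : |(k : ℝ)| ^ (51 / 8 : ℝ) = |(k : ℝ)| ^ 7 * |(k : ℝ)| ^ (-(5 / 8) : ℝ) := by
      rw [← Real.rpow_natCast, ← Real.rpow_add hk0]; norm_num
    have e2 : |(k : ℝ)| ^ (-(5 / 4) : ℝ) = |(k : ℝ)| ^ (-(5 / 8) : ℝ) * |(k : ℝ)| ^ (-(5 / 8) : ℝ) := by
      rw [← Real.rpow_add hk0]; norm_num
    rw [e1, e2]
    nlinarith [sq_nonneg (|(k : ℝ)| ^ 7 * ‖fc F k‖ - |(k : ℝ)| ^ (-(5 / 8) : ℝ)),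
      sq_nonneg (|(k : ℝ)| ^ 7 * ‖fc F k‖), sq_nonneg (|(k : ℝ)| ^ (-(5 / 8) : ℝ))]

/-- Trigonometric polynomial with coefficients `c` truncated at order `N`. -/
noncomputable def trig (c : ℤ → ℂ) (N : ℕ) (z : ℂ) : ℂ :=
  ∑ k ∈ Finset.Icc (-(N : ℤ)) N, c k * Complex.exp (k * z * Complex.I)

lemma hasDerivAt_trig (c : ℤ → ℂ) (N : ℕ) (z : ℂ) :
    HasDerivAt (trig c N) (trig (fun k => Complex.I * k * c k) N z) z := by
  unfold trig
  refine HasDerivAt.fun_sum fun k _ => ?_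
  have h1 : HasDerivAt (fun z : ℂ => (k : ℂ) * z * Complex.I) (k * Complex.I) z := by
    simpa using ((hasDerivAt_id z).const_mul (k : ℂ)).mul_const Complex.I
  convert! (h1.cexp.const_mul (c k)) using 1
  ring

lemma trig_periodic (c : ℤ → ℂ) (N : ℕ) (z : ℂ) : trig c N (z + 2 * π) = trig c N z := by
  unfold trig
  refine Finset.sum_congr rfl fun k _ => ?_
  have : (k : ℂ) * (z + 2 * π) * Complex.I = k * z * Complex.I + k * (2 * π * Complex.I) := by ring
  rw [this, Complex.exp_add, Complex.exp_int_mul_two_pi_mul_I, mul_one]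

lemma trig_real {c : ℤ → ℂ} (hc : ∀ k, c (-k) = (starRingEnd ℂ) (c k)) (N : ℕ) (x : ℝ) :
    (trig c N x).im = 0 := by
  rw [← Complex.conj_eq_iff_im]
  unfold trig
  rw [map_sum]
  refine Finset.sum_nbij' (fun k => -k) (fun k => -k) ?_ ?_ (by simp) (by simp) ?_
  · intro k hk; simp only [Finset.mem_Icc] at hk ⊢; omega
  · intro k hk; simp only [Finset.mem_Icc] at hk ⊢; omega
  · intro k _
    rw [hc, map_mul, ← Complex.exp_conj]
    simp

lemma norm_exp_mul_le {N : ℕ} (hN : 0 < N) {k : ℤ} (hk : |(k : ℝ)| ≤ N) {z : ℂ}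
    (hz : |z.im| ≤ 4 / N) : ‖Complex.exp (k * z * Complex.I)‖ ≤ Real.exp 4 := by
  rw [Complex.norm_exp]
  apply Real.exp_le_exp.2
  have hN' : (0 : ℝ) < N := by exact_mod_cast hN
  have e : ((k : ℂ) * z * Complex.I).re = -(k * z.im) := by simp
  rw [e]
  calc -(k * z.im) ≤ |(k : ℝ) * z.im| := neg_le_abs _
    _ = |(k : ℝ)| * |z.im| := abs_mul _ _
    _ ≤ N * (4 / N) := by gcongr
    _ = 4 := by field_simp

lemma norm_exp_sub_exp_re_le {N : ℕ} (hN : 0 < N) {k : ℤ} (hk : |(k : ℝ)| ≤ N) {z : ℂ}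
    (hz : |z.im| ≤ 4 / N) :
    ‖Complex.exp (k * z * Complex.I) - Complex.exp (k * z.re * Complex.I)‖ ≤
      |(k : ℝ)| * (4 / N * Real.exp 4) := by
  have hN' : (0 : ℝ) < N := by exact_mod_cast hN
  have e : (k : ℂ) * z * Complex.I = k * z.re * Complex.I + ((-(k * z.im) : ℝ) : ℂ) := by
    apply Complex.ext <;> simp
  have e2 : Complex.exp (k * z.re * Complex.I) = Complex.exp (((k * z.re : ℝ) : ℂ) * Complex.I) := by
    push_cast; rfl
  rw [e, Complex.exp_add]
  have h1 := Complex.norm_exp_sub_sum_le_norm_mul_exp ((-(k * z.im) : ℝ) : ℂ) 1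
  rw [Finset.sum_range_one, pow_zero, Nat.factorial_zero, Nat.cast_one, div_one, pow_one,
    Complex.norm_real, Real.norm_eq_abs, abs_neg, abs_mul] at h1
  have h2 : |(k : ℝ)| * |z.im| ≤ 4 := by
    calc |(k : ℝ)| * |z.im| ≤ N * (4 / N) := by gcongr
      _ = 4 := by field_simp
  rw [← mul_sub_one, norm_mul, e2, Complex.norm_exp_ofReal_mul_I, one_mul]
  refine h1.trans ?_
  rw [mul_assoc]
  gcongr

/-- Quantitative trigonometric approximation, uniform on shrinking strips. -/
lemma exists_trig_approx {f : ℝ → ℝ} (hf : ContDiff ℝ 7 f) (hper : Function.Periodic f (2 * π)) :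
    ∃ (c : ℤ → ℂ) (S : ℝ), 0 ≤ S ∧ c 0 = fc (fun x => (f x : ℂ)) 0 ∧
      (∀ k, c (-k) = (starRingEnd ℂ) (c k)) ∧
      (∀ {N M : ℕ}, 0 < N → N ≤ M → ∀ z : ℂ, |z.im| ≤ 4 / M →
        ‖trig c M z - trig c N z‖ ≤ S * ((N : ℝ) ^ (51 / 8 : ℝ))⁻¹) ∧
      ∀ {N : ℕ}, 0 < N → ∀ z : ℂ, |z.im| ≤ 4 / N → ‖trig c N z - f z.re‖ ≤ S / N := by
  set F : ℝ → ℂ := fun x => (f x : ℂ) with hFd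
  have hF : ContDiff ℝ 7 F := Complex.ofRealCLM.contDiff.comp hf
  have hFper : Function.Periodic F (2 * π) := fun x => by simp only [hFd, hper x]
  have hsum := summable_fc_rpow hF hFper
  set A : ℤ → ℝ := fun k => ‖fc F k‖ * |(k : ℝ)| ^ (51 / 8 : ℝ) with hA
  have hA0 : ∀ k, 0 ≤ A k := fun k => by positivity
  set S0 := ∑' k, A k with hS0
  have hS0' : 0 ≤ S0 := tsum_nonneg hA0
  have hone : ∀ k : ℤ, k ≠ 0 → (1 : ℝ) ≤ |(k : ℝ)| := fun k hk => by
    rw [← Int.cast_abs]; exact_mod_cast Int.one_le_abs hk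
  have hsumc : Summable (fc F) := by
    refine Summable.of_norm_bounded_eventually (g := A) hsum ?_
    rw [eventually_cofinite]
    refine (Set.finite_singleton (0 : ℤ)).subset fun k hk => ?_
    by_contra h0
    exact hk (le_mul_of_one_le_right (norm_nonneg _) (Real.one_le_rpow (hone k h0) (by norm_num)))
  have hlim : ∀ x : ℝ, Tendsto (fun N : ℕ => trig (fc F) N x) atTop (𝓝 (F x)) := fun x =>
    (hasSum_fc hF.continuous hFper hsumc x).comp Finset.tendsto_Icc_neg
  have hdiff : ∀ {N M : ℕ}, 0 < N → N ≤ M → ∀ z : ℂ, |z.im| ≤ 4 / M →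
      ‖trig (fc F) M z - trig (fc F) N z‖ ≤ Real.exp 4 * S0 * ((N : ℝ) ^ (51 / 8 : ℝ))⁻¹ := by
    intro N M hN hNM z hz
    have hN' : (0 : ℝ) < N := by exact_mod_cast hN
    have hsub : Finset.Icc (-(N : ℤ)) N ⊆ Finset.Icc (-(M : ℤ)) M :=
      Finset.Icc_subset_Icc (by omega) (by omega)
    unfold trig
    rw [← Finset.sum_sdiff hsub, add_sub_cancel_right]
    refine (norm_sum_le _ _).trans ?_
    calc _ ≤ ∑ k ∈ Finset.Icc (-(M : ℤ)) M \ Finset.Icc (-(N : ℤ)) N,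
          Real.exp 4 * ((N : ℝ) ^ (51 / 8 : ℝ))⁻¹ * A k := by
          refine Finset.sum_le_sum fun k hk => ?_
          simp only [Finset.mem_sdiff, Finset.mem_Icc] at hk
          have hkM : |(k : ℝ)| ≤ M := by
            rw [← Int.cast_abs]; exact_mod_cast abs_le.2 hk.1
          have hkN : (N : ℝ) ≤ |(k : ℝ)| := by
            rw [← Int.cast_abs]
            have : (N : ℤ) ≤ |k| := by
              by_contra hlt
              exact hk.2 (abs_le.1 (not_le.1 hlt).le)
            exact_mod_cast this
          have h1 := norm_exp_mul_le (hN.trans_le hNM) hkM hz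
          have h2 : (N : ℝ) ^ (51 / 8 : ℝ) ≤ |(k : ℝ)| ^ (51 / 8 : ℝ) :=
            Real.rpow_le_rpow hN'.le hkN (by norm_num)
          have h3 : 0 < (N : ℝ) ^ (51 / 8 : ℝ) := Real.rpow_pos_of_pos hN' _
          rw [norm_mul]
          have h4 : 1 ≤ ((N : ℝ) ^ (51 / 8 : ℝ))⁻¹ * |(k : ℝ)| ^ (51 / 8 : ℝ) := by
            rw [inv_mul_eq_div, one_le_div h3]; exact h2
          calc ‖fc F k‖ * ‖Complex.exp (k * z * Complex.I)‖ ≤ ‖fc F k‖ * Real.exp 4 * 1 := by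
                rw [mul_one]; gcongr
            _ ≤ ‖fc F k‖ * Real.exp 4 * (((N : ℝ) ^ (51 / 8 : ℝ))⁻¹ * |(k : ℝ)| ^ (51 / 8 : ℝ)) := by
                gcongr
            _ = _ := by simp only [hA]; ring
      _ = Real.exp 4 * ((N : ℝ) ^ (51 / 8 : ℝ))⁻¹ *
          ∑ k ∈ Finset.Icc (-(M : ℤ)) M \ Finset.Icc (-(N : ℤ)) N, A k := by rw [Finset.mul_sum]
      _ ≤ Real.exp 4 * ((N : ℝ) ^ (51 / 8 : ℝ))⁻¹ * S0 := by
          gcongr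
          exact hsum.sum_le_tsum _ (fun k _ => hA0 k)
      _ = _ := by ring
  refine ⟨fc F, 5 * Real.exp 4 * S0, by positivity, rfl, fc_conj (fun x => by simp [hFd]), ?_, ?_⟩
  · intro N M hN hNM z hz
    refine (hdiff hN hNM z hz).trans ?_
    gcongr
    linarith [Real.exp_pos 4]
  · intro N hN z hz
    have hN' : (0 : ℝ) < N := by exact_mod_cast hN
    have h1 : ‖F z.re - trig (fc F) N z.re‖ ≤ Real.exp 4 * S0 * ((N : ℝ) ^ (51 / 8 : ℝ))⁻¹ :=
      le_of_tendsto ((hlim z.re).sub_const _).norm (eventually_atTop.2 ⟨N, fun M hM =>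
        hdiff hN hM z.re (by simp; positivity)⟩)
    have h2 : ((N : ℝ) ^ (51 / 8 : ℝ))⁻¹ ≤ 1 / N := by
      rw [one_div]
      apply inv_anti₀ hN'
      have h1N : (1 : ℝ) ≤ N := by exact_mod_cast hN
      calc (N : ℝ) = (N : ℝ) ^ (1 : ℝ) := (Real.rpow_one _).symm
        _ ≤ _ := Real.rpow_le_rpow_of_exponent_le h1N (by norm_num)
    have h3 : ‖trig (fc F) N z - trig (fc F) N z.re‖ ≤ 4 / N * Real.exp 4 * S0 := by
      unfold trig
      rw [← Finset.sum_sub_distrib]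
      refine (norm_sum_le _ _).trans ?_
      calc _ ≤ ∑ k ∈ Finset.Icc (-(N : ℤ)) N, 4 / N * Real.exp 4 * A k := by
            refine Finset.sum_le_sum fun k hk => ?_
            simp only [Finset.mem_Icc] at hk
            have hkN : |(k : ℝ)| ≤ N := by
              rw [← Int.cast_abs]; exact_mod_cast abs_le.2 hk
            rw [← mul_sub, norm_mul]
            have h4 := norm_exp_sub_exp_re_le hN hkN hz
            have h5 : |(k : ℝ)| ≤ |(k : ℝ)| ^ (51 / 8 : ℝ) := by
              rcases eq_or_ne k 0 with rfl | h0
              · simp [Real.zero_rpow]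
              · calc |(k : ℝ)| = |(k : ℝ)| ^ (1 : ℝ) := (Real.rpow_one _).symm
                  _ ≤ _ := Real.rpow_le_rpow_of_exponent_le (hone k h0) (by norm_num)
            calc _ ≤ ‖fc F k‖ * (|(k : ℝ)| ^ (51 / 8 : ℝ) * (4 / N * Real.exp 4)) := by
                  gcongr
                  exact h4.trans (by gcongr)
              _ = _ := by simp only [hA]; ring
        _ = 4 / N * Real.exp 4 * ∑ k ∈ Finset.Icc (-(N : ℤ)) N, A k := by rw [Finset.mul_sum]
        _ ≤ _ := by
            gcongr
            exact hsum.sum_le_tsum _ (fun k _ => hA0 k)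
    have h4 : trig (fc F) N z - (f z.re : ℂ) = (trig (fc F) N z - trig (fc F) N z.re) -
        (F z.re - trig (fc F) N z.re) := by simp only [hFd]; ring
    rw [h4]
    refine (norm_sub_le _ _).trans ((add_le_add h3 h1).trans ?_)
    calc 4 / N * Real.exp 4 * S0 + Real.exp 4 * S0 * ((N : ℝ) ^ (51 / 8 : ℝ))⁻¹
        ≤ 4 / N * Real.exp 4 * S0 + Real.exp 4 * S0 * (1 / N) := by gcongr
      _ = _ := by ring

end DualBilliard

namespace DualBilliard

open Filter Topology

/-- The entire function `sin ζ / ζ`. -/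
noncomputable def csinc (ζ : ℂ) : ℂ := dslope Complex.sin 0 ζ

lemma differentiable_csinc : Differentiable ℂ csinc := by
  rw [← differentiableOn_univ]
  exact (Complex.differentiableOn_dslope (s := Set.univ) (c := 0) Filter.univ_mem).2
    Complex.differentiable_sin.differentiableOn

lemma csinc_mul (ζ : ℂ) : ζ * csinc ζ = Complex.sin ζ := by
  have := sub_smul_dslope Complex.sin 0 ζ
  simpa [csinc] using this

lemma csinc_zero : csinc 0 = 1 := by
  simp [csinc, (Complex.hasDerivAt_sin 0).deriv]

lemma csinc_ne_zero {ζ : ℂ} (h : ‖ζ‖ ≤ 1) : csinc ζ ≠ 0 := by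
  intro h0
  rcases eq_or_ne ζ 0 with rfl | hz
  · rw [csinc_zero] at h0; exact one_ne_zero h0
  · have h1 := csinc_mul ζ
    rw [h0, mul_zero] at h1
    have h2 := Complex.sin_bound h
    rw [← h1, zero_sub, norm_neg] at h2
    have h3 : ‖ζ‖ - ‖ζ ^ 3 / 6‖ ≤ ‖ζ - ζ ^ 3 / 6‖ := norm_sub_norm_le _ _
    have h4 : ‖ζ ^ 3 / 6‖ = ‖ζ‖ ^ 3 / 6 := by simp
    have h5 : 0 < ‖ζ‖ := norm_pos_iff.2 hz
    have h6 : ‖ζ‖ ^ 3 ≤ ‖ζ‖ := pow_le_of_le_one h5.le h (by norm_num)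
    have h7 : ‖ζ‖ ^ 5 ≤ ‖ζ‖ := pow_le_of_le_one h5.le h (by norm_num)
    linarith

/-- The rescaled generating function in terms of the geometric quantities entering it. -/
noncomputable def genForm (a P Q R D ζ t : ℂ) : ℂ :=
  a / (P + Q) ^ 2 * (P * R + (P ^ 2 + R ^ 2) / 2 * Complex.cos ζ) / (t * D * csinc ζ)

lemma genForm_analyticAt {E : Type*} [NormedAddCommGroup E] [NormedSpace ℂ E]
    {a P Q R D ζ t : E → ℂ} {z : E} (ha : AnalyticAt ℂ a z) (hP : AnalyticAt ℂ P z)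
    (hQ : AnalyticAt ℂ Q z) (hR : AnalyticAt ℂ R z) (hD : AnalyticAt ℂ D z) (hζ : AnalyticAt ℂ ζ z)
    (ht : AnalyticAt ℂ t z) (h1 : P z + Q z ≠ 0) (h2 : D z ≠ 0) (h3 : ‖ζ z‖ ≤ 1) (h4 : t z ≠ 0) :
    AnalyticAt ℂ (fun z => genForm (a z) (P z) (Q z) (R z) (D z) (ζ z) (t z)) z := by
  unfold genForm
  refine AnalyticAt.div ?_ ((ht.mul hD).mul ((differentiable_csinc.analyticAt _).fun_comp hζ))
    (mul_ne_zero (mul_ne_zero h4 h2) (csinc_ne_zero h3))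
  refine (ha.div ((hP.add hQ).pow 2) (pow_ne_zero 2 h1)).mul ((hP.mul hR).add ?_)
  refine ((((hP.pow 2).add (hR.pow 2))).div analyticAt_const two_ne_zero).mul ?_
  exact (Complex.differentiable_cos.analyticAt _).fun_comp hζ

/-- Compact set of admissible parameters. -/
def params (c ρ B w : ℝ) : Set (Fin 7 → ℂ) :=
  {v | ‖v 0 - c‖ ≤ ρ ∧ ‖v 1‖ ≤ B ∧ ‖v 2‖ ≤ B ∧ w ≤ (v 1 + v 2).re ∧ ‖v 3‖ ≤ B ∧ ‖v 4 - c‖ ≤ ρ ∧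
    ‖v 5‖ ≤ 1 ∧ ‖v 6 - 1‖ ≤ 1 / 2}

lemma isCompact_params (c ρ B w : ℝ) : IsCompact (params c ρ B w) := by
  refine Metric.isCompact_of_isClosed_isBounded ?_ ?_
  · simp only [params, Set.ofPred_and]
    refine IsClosed.inter ?_ (IsClosed.inter ?_ (IsClosed.inter ?_ (IsClosed.inter ?_
      (IsClosed.inter ?_ (IsClosed.inter ?_ (IsClosed.inter ?_ ?_))))))
    all_goals exact isClosed_le (by fun_prop) (by fun_prop)
  · refine isBounded_iff_forall_norm_le.2 ⟨ρ + |c| + |B| + 2, fun v hv => ?_⟩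
    obtain ⟨h0, h1, h2, -, h3, h4, h5, h6⟩ := hv
    have hρ : 0 ≤ ρ := (norm_nonneg _).trans h0
    have hB := le_abs_self B
    have hB0 := abs_nonneg B
    have hc0 := abs_nonneg c
    have hc : ∀ {x : ℂ}, ‖x - c‖ ≤ ρ → ‖x‖ ≤ ρ + |c| := fun {x} hx => by
      have := norm_sub_norm_le x (c : ℂ)
      rw [Complex.norm_real, Real.norm_eq_abs] at this
      linarith
    have h6' : ‖v 6‖ ≤ 3 / 2 := by
      have := norm_sub_norm_le (v 6) 1
      rw [norm_one] at this
      linarith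
    have h0' := hc h0
    have h4' := hc h4
    refine (pi_norm_le_iff_of_nonneg (by positivity)).2 fun i => ?_
    fin_cases i <;> simp <;> linarith

lemma ne_zero_of_norm_sub_le {x : ℂ} {c ρ : ℝ} (hc : ρ < c) (h : ‖x - c‖ ≤ ρ) : x ≠ 0 := by
  rintro rfl
  rw [zero_sub, norm_neg, Complex.norm_real, Real.norm_eq_abs] at h
  linarith [le_abs_self c]

lemma ne_zero_of_re {x : ℂ} {w : ℝ} (hw : 0 < w) (h : w ≤ x.re) : x ≠ 0 := by
  rintro rfl
  simp at h
  linarith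

noncomputable def genVec (v : Fin 7 → ℂ) : ℂ :=
  genForm (v 0) (v 1) (v 2) (v 3) (v 4) (v 5) (v 6)

lemma exists_lipschitz_genVec {c ρ B w : ℝ} (hc : ρ < c) (hw : 0 < w) :
    ∃ K : ℝ, 0 ≤ K ∧ ∀ v ∈ params c ρ B w, ∀ v' ∈ params c ρ B w,
      ‖genVec v - genVec v'‖ ≤ K * ‖v - v'‖ := by
  have h1 : LocallyLipschitzOn (params c ρ B w) genVec := by
    intro v hv
    obtain ⟨h0, h1, h2, h12, h3, h4, h5, h6⟩ := hv
    have hpr : ∀ i : Fin 7, AnalyticAt ℂ (fun v : Fin 7 → ℂ => v i) v := fun i =>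
      (ContinuousLinearMap.proj (R := ℂ) (φ := fun _ : Fin 7 => ℂ) i).analyticAt v
    have han : AnalyticAt ℂ genVec v := genForm_analyticAt (hpr 0) (hpr 1) (hpr 2) (hpr 3) (hpr 4)
      (hpr 5) (hpr 6) (ne_zero_of_re hw h12) (ne_zero_of_norm_sub_le hc h4) h5
      (ne_zero_of_norm_sub_le (c := 1) (ρ := 1 / 2) (by norm_num) (by simpa using h6))
    obtain ⟨K, t, ht, hK⟩ := (han.contDiffAt (n := 1)).exists_lipschitzOnWith
    exact ⟨K, t, mem_nhdsWithin_of_mem_nhds ht, hK⟩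
  obtain ⟨K, hK⟩ := h1.exists_lipschitzOnWith_of_compact (isCompact_params c ρ B w)
  refine ⟨K, K.2, fun v hv v' hv' => ?_⟩
  have := hK.dist_le_mul v hv v' hv'
  rwa [dist_eq_norm, dist_eq_norm] at this

/-- Admissible analytic data on the strip of width `4 σ`. -/
structure Adm (c ρ B w σ : ℝ) (P Q Θ : ℂ → ℂ) : Prop where
  diffP : Differentiable ℂ P
  diffQ : Differentiable ℂ Q
  diffΘ : Differentiable ℂ Θ
  perP : ∀ z, P (z + 2 * π) = P z
  perQ : ∀ z, Q (z + 2 * π) = Q z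
  perΘ : ∀ z, Θ (z + 2 * π) = Θ z + 2 * π
  realP : ∀ x : ℝ, (P x).im = 0
  realQ : ∀ x : ℝ, (Q x).im = 0
  realΘ : ∀ x : ℝ, (Θ x).im = 0
  bP : ∀ z ∈ strip (4 * σ), ‖P z‖ ≤ B
  bQ : ∀ z ∈ strip (4 * σ), ‖Q z‖ ≤ B
  bw : ∀ z ∈ strip (4 * σ), w ≤ (P z + Q z).re
  bΘ : ∀ z ∈ strip (4 * σ), ‖deriv Θ z - c‖ ≤ ρ

/-- Geometric quantities attached to a point and a normalised increment. -/
noncomputable def geomVec (ε : ℝ) (P Q Θ : ℂ → ℂ) (z : ℂ × ℂ) : Fin 7 → ℂ :=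
  ![deriv Θ z.1, P z.1, Q z.1, Q (z.1 - ε * (1 - z.2)),
    (Θ z.1 - Θ (z.1 - ε * (1 - z.2))) / (ε * (1 - z.2)), Θ z.1 - Θ (z.1 - ε * (1 - z.2)), 1 - z.2]

lemma edom_facts {ε σ : ℝ} (hε : 0 < ε) {z : ℂ × ℂ} (hz : z ∈ edom ε σ) :
    z.1 ∈ strip (4 * σ) ∧ z.1 - ε * (1 - z.2) ∈ strip (4 * σ) ∧ (ε : ℂ) * (1 - z.2) ≠ 0 ∧
      ‖(ε : ℂ) * (1 - z.2)‖ ≤ 3 / 2 * ε ∧ ‖1 - z.2 - 1‖ ≤ 1 / 2 := by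
  obtain ⟨h1, h2, h3⟩ := hz
  have hne : (1 : ℂ) - z.2 ≠ 0 := by
    intro h0
    have : z.2 = 1 := (sub_eq_zero.1 h0).symm
    rw [this, norm_one] at h3
    norm_num at h3
  refine ⟨h1, ?_, mul_ne_zero (by exact_mod_cast hε.ne') hne, ?_, ?_⟩
  · have e : z.1 - ε * (1 - z.2) = z.1 + ε * z.2 - ε := by ring
    rw [e, mem_strip, Complex.sub_im, Complex.ofReal_im, sub_zero]
    exact h2
  · rw [norm_mul, Complex.norm_real, Real.norm_of_nonneg hε.le, mul_comm]
    have := norm_sub_le (1 : ℂ) z.2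
    rw [norm_one] at this
    gcongr
    linarith
  · have e : (1 : ℂ) - z.2 - 1 = -z.2 := by ring
    rw [e, norm_neg]
    exact h3.le

namespace Adm

variable {c ρ B w σ : ℝ} {P Q Θ : ℂ → ℂ}

lemma quot_sub_le {Θ : ℂ → ℂ} {b : ℂ} {η R : ℝ} (hΘ : Differentiable ℂ Θ)
    (h : ∀ z ∈ strip R, ‖deriv Θ z - b‖ ≤ η) {x e : ℂ} (hx : x ∈ strip R) (hy : x - e ∈ strip R)
    (he : e ≠ 0) : ‖(Θ x - Θ (x - e)) / e - b‖ ≤ η := by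
  have h1 := norm_sub_le_strip (f := fun z => Θ z - b * z) (C := η)
    (hΘ.sub (differentiable_id.const_mul b)).differentiableOn (fun z hz => by
      have := (hΘ z).hasDerivAt.fun_sub ((hasDerivAt_id z).const_mul b)
      have := HasDerivAt.deriv (f := fun z => Θ z - b * z) this
      rw [this, mul_one]
      exact h z hz) hy hx
  have e1 : (Θ x - Θ (x - e)) / e - b = (Θ x - b * x - (Θ (x - e) - b * (x - e))) / e := by
    field_simp; ring
  rw [e1, norm_div, div_le_iff₀ (norm_pos_iff.2 he)]
  simpa using h1

lemma norm_diff_le (h : Adm c ρ B w σ P Q Θ) {x e : ℂ} (hx : x ∈ strip (4 * σ))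
    (hy : x - e ∈ strip (4 * σ)) : ‖Θ x - Θ (x - e)‖ ≤ (|c| + ρ) * ‖e‖ := by
  have h1 := norm_sub_le_strip (f := Θ) (C := |c| + ρ) h.diffΘ.differentiableOn (fun z hz => by
    have := norm_sub_norm_le (deriv Θ z) (c : ℂ)
    rw [Complex.norm_real, Real.norm_eq_abs] at this
    linarith [h.bΘ z hz]) hy hx
  simpa using h1

lemma mem_params (h : Adm c ρ B w σ P Q Θ) {ε : ℝ} (hε : 0 < ε)
    (hε1 : (|c| + ρ) * (3 / 2 * ε) ≤ 1) {z : ℂ × ℂ} (hz : z ∈ edom ε σ) :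
    geomVec ε P Q Θ z ∈ params c ρ B w := by
  obtain ⟨h1, h2, h3, h4, h5⟩ := edom_facts hε hz
  have hρ : 0 ≤ ρ := (norm_nonneg _).trans (h.bΘ _ h1)
  refine ⟨h.bΘ _ h1, h.bP _ h1, h.bQ _ h1, h.bw _ h1, h.bQ _ h2,
    quot_sub_le h.diffΘ h.bΘ h1 h2 h3, ?_, h5⟩
  exact (h.norm_diff_le h1 h2).trans (le_trans (by gcongr) hε1)

lemma goodH (h : Adm c ρ B w σ P Q Θ) (hc : ρ < c) (hw : 0 < w) {ε : ℝ} (hε : 0 < ε)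
    (hε1 : (|c| + ρ) * (3 / 2 * ε) ≤ 1) : GoodH ε σ (fun z => genVec (geomVec ε P Q Θ z)) := by
  refine ⟨fun z hz => ?_, fun x s => ?_, fun x s => ?_⟩
  · have hm := h.mem_params hε hε1 hz
    obtain ⟨h1, h2, h3, h4, h5⟩ := edom_facts hε hz
    have a1 : AnalyticAt ℂ (fun z : ℂ × ℂ => (ε : ℂ) * (1 - z.2)) z :=
      analyticAt_const.mul (analyticAt_const.sub analyticAt_snd)
    have a2 : AnalyticAt ℂ (fun z : ℂ × ℂ => z.1 - ε * (1 - z.2)) z := analyticAt_fst.sub a1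
    have aΘ : AnalyticAt ℂ (fun z : ℂ × ℂ => Θ z.1 - Θ (z.1 - ε * (1 - z.2))) z :=
      ((h.diffΘ.analyticAt _).fun_comp analyticAt_fst).sub ((h.diffΘ.analyticAt _).fun_comp a2)
    obtain ⟨-, -, -, m12, -, m4, m5, m6⟩ := hm
    refine genForm_analyticAt ((h.diffΘ.analyticAt _).deriv.fun_comp analyticAt_fst)
      ((h.diffP.analyticAt _).fun_comp analyticAt_fst)
      ((h.diffQ.analyticAt _).fun_comp analyticAt_fst) ((h.diffQ.analyticAt _).fun_comp a2)
      (aΘ.div a1 h3) aΘ (analyticAt_const.sub analyticAt_snd) (ne_zero_of_re hw m12)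
      (ne_zero_of_norm_sub_le hc m4) m5 (right_ne_zero_of_mul h3)
  · have e : x + 2 * π - ε * (1 - s) = (x - ε * (1 - s)) + 2 * π := by ring
    have hd : deriv Θ (x + 2 * π) = deriv Θ x := by
      rw [← deriv_comp_add_const Θ (2 * π : ℂ) x]
      have : (fun x => Θ (x + 2 * π)) = fun x => Θ x + 2 * π := funext h.perΘ
      rw [this, deriv_add_const]
    simp only [geomVec, e, h.perΘ, h.perP, h.perQ, hd, add_sub_add_right_eq_sub]
  · have e : (x : ℂ) - ε * (1 - s) = ((x - ε * (1 - s) : ℝ) : ℂ) := by push_cast; rfl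
    have hd : (deriv Θ x).im = 0 := deriv_im_eq_zero h.realΘ (h.diffΘ _)
    simp only [geomVec, genVec, genForm, Matrix.cons_val, e]
    generalize x - ε * (1 - s) = y
    have r1 := ofReal_re_of_im hd
    have r2 := ofReal_re_of_im (h.realP x)
    have r3 := ofReal_re_of_im (h.realQ x)
    have r4 := ofReal_re_of_im (h.realQ y)
    have r5 := ofReal_re_of_im (h.realΘ x)
    have r6 := ofReal_re_of_im (h.realΘ y)
    have r7 : ∀ t : ℝ, (csinc t).im = 0 := by
      intro t
      rcases eq_or_ne t 0 with rfl | ht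
      · rw [Complex.ofReal_zero, csinc_zero, Complex.one_im]
      · have := csinc_mul t
        have ht' : (t : ℂ) ≠ 0 := by exact_mod_cast ht
        have h8 : csinc t = ((Real.sin t / t : ℝ) : ℂ) := by
          push_cast
          rw [← this]
          field_simp
        rw [h8, Complex.ofReal_im]
    rw [← r1, ← r2, ← r3, ← r4, ← r5, ← r6, ← Complex.ofReal_sub]
    rw [← ofReal_re_of_im (r7 ((Θ x).re - (Θ y).re))]
    norm_cast

lemma norm_geomVec_sub_le {P' Q' Θ' : ℂ → ℂ} {η : ℝ} (h : Adm c ρ B w σ P Q Θ)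
    (h' : Adm c ρ B w σ P' Q' Θ') {ε : ℝ} (hε : 0 < ε) (hε1 : ε ≤ 1 / 4)
    (hP : ∀ z ∈ strip (4 * σ), ‖P z - P' z‖ ≤ η) (hQ : ∀ z ∈ strip (4 * σ), ‖Q z - Q' z‖ ≤ η)
    (hΘ : ∀ z ∈ strip (4 * σ), ‖deriv Θ z - deriv Θ' z‖ ≤ η) {z : ℂ × ℂ} (hz : z ∈ edom ε σ) :
    ‖geomVec ε P Q Θ z - geomVec ε P' Q' Θ' z‖ ≤ η := by
  obtain ⟨h1, h2, h3, h4, h5⟩ := edom_facts hε hz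
  have hη : 0 ≤ η := (norm_nonneg _).trans (hP _ h1)
  have key : ‖(Θ z.1 - Θ (z.1 - ε * (1 - z.2))) / (ε * (1 - z.2)) -
      (Θ' z.1 - Θ' (z.1 - ε * (1 - z.2))) / (ε * (1 - z.2))‖ ≤ η := by
    have := quot_sub_le (Θ := fun z => Θ z - Θ' z) (b := 0) (η := η)
      (h.diffΘ.sub h'.diffΘ) (fun z hz => by
        rw [deriv_fun_sub (h.diffΘ z) (h'.diffΘ z), sub_zero]; exact hΘ z hz) h1 h2 h3
    convert this using 2
    ring
  have key2 : ‖(Θ z.1 - Θ (z.1 - ε * (1 - z.2))) - (Θ' z.1 - Θ' (z.1 - ε * (1 - z.2)))‖ ≤ η := by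
    rw [← sub_div, norm_div, div_le_iff₀ (norm_pos_iff.2 h3)] at key
    refine key.trans (mul_le_of_le_one_right hη (h4.trans (by linarith)))
  refine (pi_norm_le_iff_of_nonneg hη).2 fun i => ?_
  fin_cases i <;> simp only [geomVec, Pi.sub_apply, Matrix.cons_val, Fin.reduceFinMk,
    Fin.zero_eta, Fin.mk_one]
  · exact hΘ _ h1
  · exact hP _ h1
  · exact hQ _ h1
  · exact hQ _ h2
  · exact key
  · exact key2
  · simpa using hη

/-- Comparison with the integrable leading term. -/
lemma norm_sub_half_inv_le {C K : ℝ} (h : Adm c ρ B w σ P Q Θ) (hc : ρ < c) (hw : 0 < w) {ε : ℝ}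
    (hε : 0 < ε) (hε1 : (|c| + ρ) * (3 / 2 * ε) ≤ 1)
    (hK : ∀ v ∈ params c ρ B w, ∀ v' ∈ params c ρ B w, ‖genVec v - genVec v'‖ ≤ K * ‖v - v'‖)
    (hK0 : 0 ≤ K) (hC0 : |c| + ρ ≤ C)
    (hQ : ∀ z ∈ strip (4 * σ), ‖deriv Q z‖ ≤ C)
    (hΘ : ∀ z ∈ strip (4 * σ), ‖deriv (deriv Θ) z‖ ≤ C) {z : ℂ × ℂ} (hz : z ∈ edom ε σ) :
    ‖genVec (geomVec ε P Q Θ z) - 1 / (2 * (1 - z.2))‖ ≤ K * (3 / 2 * C * ε) := by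
  have hm := h.mem_params hε hε1 hz
  obtain ⟨h1, h2, h3, h4, h5⟩ := edom_facts hε hz
  set v' : Fin 7 → ℂ := ![deriv Θ z.1, P z.1, Q z.1, Q z.1, deriv Θ z.1, 0, 1 - z.2] with hv'
  have hm' : v' ∈ params c ρ B w :=
    ⟨h.bΘ _ h1, h.bP _ h1, h.bQ _ h1, h.bw _ h1, h.bQ _ h1, h.bΘ _ h1, by simp [hv'], h5⟩
  have e : genVec v' = 1 / (2 * (1 - z.2)) := by
    have e1 := ne_zero_of_re hw (h.bw _ h1)
    have e2 := ne_zero_of_norm_sub_le hc (h.bΘ _ h1)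
    have e3 := right_ne_zero_of_mul h3
    simp only [genVec, genForm, hv', Matrix.cons_val, Complex.cos_zero, csinc_zero]
    field_simp
    ring
  have hρ : 0 ≤ ρ := (norm_nonneg _).trans (h.bΘ _ h1)
  have hC : 0 ≤ C := by linarith [abs_nonneg c]
  have hCε : 0 ≤ 3 / 2 * C * ε := by positivity
  have hd := convex_strip (4 * σ)
  rw [← e]
  refine (hK _ hm _ hm').trans (mul_le_mul_of_nonneg_left ?_ hK0)
  have b3 : ‖Q (z.1 - ε * (1 - z.2)) - Q z.1‖ ≤ 3 / 2 * C * ε := by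
    have := norm_sub_le_strip h.diffQ.differentiableOn hQ h1 h2
    refine this.trans ?_
    rw [sub_sub_cancel_left, norm_neg]
    calc C * ‖(ε : ℂ) * (1 - z.2)‖ ≤ C * (3 / 2 * ε) := by gcongr
      _ = _ := by ring
  have b5 : ‖Θ z.1 - Θ (z.1 - ε * (1 - z.2))‖ ≤ 3 / 2 * C * ε := by
    refine (h.norm_diff_le h1 h2).trans ?_
    calc _ ≤ C * (3 / 2 * ε) := by gcongr
      _ = _ := by ring
  have b4 : ‖(Θ z.1 - Θ (z.1 - ε * (1 - z.2))) / (ε * (1 - z.2)) - deriv Θ z.1‖ ≤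
      3 / 2 * C * ε := by
    set e' := (ε : ℂ) * (1 - z.2) with he'
    have hseg := (convex_strip (4 * σ)).segment_subset h2 h1
    have h6 : ∀ y ∈ segment ℝ (z.1 - e') z.1, ‖deriv Θ y - deriv Θ z.1‖ ≤ C * ‖e'‖ := by
      intro y hy
      have h7 := norm_sub_le_strip (f := deriv Θ) (h.diffΘ.differentiableOn.deriv isOpen_univ
        |>.mono (Set.subset_univ _)) hΘ h1 (hseg hy)
      refine h7.trans (mul_le_mul_of_nonneg_left ?_ hC)
      rw [segment_symm] at hy
      simpa using norm_sub_le_of_mem_segment hy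
    have h8 := (convex_segment (𝕜 := ℝ) (z.1 - e') z.1).norm_image_sub_le_of_norm_hasDerivWithin_le
      (f := fun y => Θ y - deriv Θ z.1 * y) (f' := fun y => deriv Θ y - deriv Θ z.1)
      (C := C * ‖e'‖) (fun y _ => by
        have := (h.diffΘ y).hasDerivAt.fun_sub ((hasDerivAt_id y).const_mul (deriv Θ z.1))
        rw [mul_one] at this
        exact this.hasDerivWithinAt) h6 (left_mem_segment ℝ _ _) (right_mem_segment ℝ _ _)
    have e1 : (Θ z.1 - Θ (z.1 - e')) / e' - deriv Θ z.1 =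
        (Θ z.1 - deriv Θ z.1 * z.1 - (Θ (z.1 - e') - deriv Θ z.1 * (z.1 - e'))) / e' := by
      field_simp; ring
    rw [e1, norm_div, div_le_iff₀ (norm_pos_iff.2 h3)]
    refine h8.trans ?_
    rw [sub_sub_cancel]
    have : C * ‖e'‖ ≤ 3 / 2 * C * ε := by
      calc C * ‖e'‖ ≤ C * (3 / 2 * ε) := by gcongr
        _ = _ := by ring
    gcongr
  refine (pi_norm_le_iff_of_nonneg hCε).2 fun i => ?_
  fin_cases i <;> simp only [geomVec, hv', Pi.sub_apply, Matrix.cons_val, Fin.reduceFinMk,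
    Fin.zero_eta, Fin.mk_one, sub_self, norm_zero, sub_zero]
  · exact hCε
  · exact hCε
  · exact hCε
  · exact b3
  · exact b4
  · exact b5
  · exact hCε

end Adm

end DualBilliard

namespace DualBilliard

open Filter Topology

lemma norm_trig_le (c : ℤ → ℂ) {N : ℕ} (hN : 0 < N) {z : ℂ} (hz : |z.im| ≤ 4 / N) :
    ‖trig c N z‖ ≤ ∑ k ∈ Finset.Icc (-(N : ℤ)) N, ‖c k‖ * Real.exp 4 := by
  unfold trig
  refine (norm_sum_le _ _).trans (Finset.sum_le_sum fun k hk => ?_)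
  rw [norm_mul]
  refine mul_le_mul_of_nonneg_left (norm_exp_mul_le hN ?_ hz) (norm_nonneg _)
  rw [Finset.mem_Icc] at hk
  rw [abs_le]
  exact ⟨by exact_mod_cast hk.1, by exact_mod_cast hk.2⟩

lemma hasDerivAt_id_add_trig {c : ℤ → ℂ} (hc : c 0 = 1) (N : ℕ) (z : ℂ) :
    HasDerivAt (fun z => z + trig (fun k => c k / (Complex.I * k)) N z) (trig c N z) z := by
  have h := (hasDerivAt_id z).fun_add (hasDerivAt_trig (fun k => c k / (Complex.I * k)) N z)
  convert! h using 1
  have h0 : (0 : ℤ) ∈ Finset.Icc (-(N : ℤ)) N := by simp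
  unfold trig
  rw [← Finset.add_sum_erase _ _ h0, ← Finset.add_sum_erase _ _ h0, hc]
  simp only [Int.cast_zero, mul_zero, zero_mul, Complex.exp_zero, mul_one, zero_add]
  congr 1
  refine Finset.sum_congr rfl fun k hk => ?_
  have hk0 : (k : ℂ) ≠ 0 := by exact_mod_cast (Finset.mem_erase.1 hk).1
  field_simp

lemma Adm.mono {c ρ B w σ σ' : ℝ} {P Q Θ : ℂ → ℂ} (h : Adm c ρ B w σ P Q Θ) (hσ : σ' ≤ σ) :
    Adm c ρ B w σ' P Q Θ := by
  have hs : strip (4 * σ') ⊆ strip (4 * σ) := strip_mono (by linarith)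
  exact ⟨h.diffP, h.diffQ, h.diffΘ, h.perP, h.perQ, h.perΘ, h.realP, h.realQ, h.realΘ,
    fun z hz => h.bP z (hs hz), fun z hz => h.bQ z (hs hz), fun z hz => h.bw z (hs hz),
    fun z hz => h.bΘ z (hs hz)⟩

/-- Smooth periodic data entering the generating function in the adapted coordinate. -/
structure GeomData (p r g Θ : ℝ → ℝ) : Prop where
  smoothP : ContDiff ℝ 7 p
  smoothR : ContDiff ℝ 7 r
  smoothG : ContDiff ℝ 7 g
  perP : Function.Periodic p (2 * π)
  perR : Function.Periodic r (2 * π)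
  perG : Function.Periodic g (2 * π)
  posG : ∀ x, 0 < g x
  posW : ∀ x, 0 < p x + r x
  derivΘ : ∀ x, HasDerivAt Θ (g x) x
  perΘ : ∀ x, Θ (x + 2 * π) = Θ x + 2 * π

lemma exists_bounds_of_periodic {f : ℝ → ℝ} (hf : Continuous f)
    (hper : Function.Periodic f (2 * π)) : ∃ x₁ x₂, ∀ x, f x₁ ≤ f x ∧ f x ≤ f x₂ := by
  have hne : (Set.Icc 0 (2 * π)).Nonempty := ⟨0, by simp [Real.pi_pos.le]⟩
  obtain ⟨a, -, ha⟩ := isCompact_Icc.exists_isMinOn hne hf.continuousOn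
  obtain ⟨b, -, hb⟩ := isCompact_Icc.exists_isMaxOn hne hf.continuousOn
  refine ⟨a, b, fun x => ?_⟩
  obtain ⟨y, hy, hxy⟩ := hper.exists_mem_Ico₀ Real.two_pi_pos x
  rw [hxy]
  have hy' := Set.Ico_subset_Icc_self hy
  exact ⟨ha hy', hb hy'⟩

namespace GeomData

variable {p r g Θ : ℝ → ℝ}

lemma fc_zero (h : GeomData p r g Θ) : fc (fun x => (g x : ℂ)) 0 = 1 := by
  have h1 := intervalIntegral.integral_eq_sub_of_hasDerivAt (fun x _ => h.derivΘ x)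
    (h.smoothG.continuous.intervalIntegrable 0 (2 * π))
  have h2 := h.perΘ 0
  rw [zero_add] at h2
  rw [h2, add_sub_cancel_left] at h1
  have h3 : ∫ x in (0 : ℝ)..(2 * π), (g x : ℂ) = ((2 * π : ℝ) : ℂ) := by
    rw [intervalIntegral.integral_ofReal, h1]
  have hpi : (π : ℂ) ≠ 0 := by exact_mod_cast Real.pi_ne_zero
  unfold fc
  simp only [Int.cast_zero, neg_zero, zero_mul, Complex.exp_zero, mul_one, one_mul]
  rw [h3, Complex.real_smul, ← Complex.ofReal_mul, one_div_mul_cancel Real.two_pi_pos.ne', Complex.ofReal_one]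

/-- Analytic approximations of the data on shrinking strips. -/
lemma exists_adm (h : GeomData p r g Θ) :
    ∃ (c ρ B w S : ℝ) (N₀ : ℕ) (P Q T : ℕ → ℂ → ℂ), ρ < c ∧ 0 < w ∧ 0 ≤ S ∧ 0 < N₀ ∧
      (∀ N, N₀ ≤ N → Adm c ρ B w (1 / N) (P N) (Q N) (T N)) ∧
      (∀ N M, N₀ ≤ N → N ≤ M → ∀ z ∈ strip (4 * (1 / (M : ℝ))),
        ‖P M z - P N z‖ ≤ S * ((N : ℝ) ^ (51 / 8 : ℝ))⁻¹ ∧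
        ‖Q M z - Q N z‖ ≤ S * ((N : ℝ) ^ (51 / 8 : ℝ))⁻¹ ∧
        ‖deriv (T M) z - deriv (T N) z‖ ≤ S * ((N : ℝ) ^ (51 / 8 : ℝ))⁻¹) ∧
      (∀ N, N₀ ≤ N → ∀ x : ℝ, ‖P N x - p x‖ ≤ S / N ∧ ‖Q N x - r x‖ ≤ S / N ∧
        ‖deriv (T N) x - g x‖ ≤ S / N) ∧
      ∀ N, N₀ ≤ N → ∃ C, ∀ z ∈ strip (4 * (1 / (N : ℝ))),
        ‖deriv (Q N) z‖ ≤ C ∧ ‖deriv (deriv (T N)) z‖ ≤ C := by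
  obtain ⟨cp, Sp, hSp, -, hcp, hp1, hp2⟩ := exists_trig_approx h.smoothP h.perP
  obtain ⟨cr, Sr, hSr, -, hcr, hr1, hr2⟩ := exists_trig_approx h.smoothR h.perR
  obtain ⟨cg, Sg, hSg, hg0, hcg, hg1, hg2⟩ := exists_trig_approx h.smoothG h.perG
  rw [h.fc_zero] at hg0
  obtain ⟨pa, pb, hpb⟩ := exists_bounds_of_periodic h.smoothP.continuous h.perP
  obtain ⟨ra, rb, hrb⟩ := exists_bounds_of_periodic h.smoothR.continuous h.perR
  obtain ⟨ga, gb, hgb⟩ := exists_bounds_of_periodic h.smoothG.continuous h.perG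
  obtain ⟨wa, wb, hwb⟩ := exists_bounds_of_periodic
    (h.smoothP.continuous.add h.smoothR.continuous) (h.perP.add h.perR)
  have hgpos := h.posG ga
  have hwpos : 0 < (p + r) wa := h.posW wa
  obtain ⟨S, hSd⟩ : ∃ S, S = Sp + Sr + Sg := ⟨_, rfl⟩
  have hS : 0 ≤ S := by linarith
  obtain ⟨B, hBd⟩ : ∃ B, B = |p pa| + |p pb| + |r ra| + |r rb| + 1 := ⟨_, rfl⟩
  obtain ⟨η, hη, hη1, hη2, hη3⟩ : ∃ η : ℝ, 0 < η ∧ η ≤ 1 ∧ η ≤ g ga / 2 ∧ η ≤ (p + r) wa / 4 :=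
    ⟨min 1 (min (g ga / 2) ((p + r) wa / 4)), by positivity, by simp, by simp, by simp⟩
  obtain ⟨N₀, hN₀, hN₀S⟩ : ∃ N₀ : ℕ, 0 < N₀ ∧ S / N₀ ≤ η := by
    obtain ⟨n, hn⟩ := exists_nat_gt (S / η)
    have hn0 : (0 : ℝ) < n := lt_of_le_of_lt (by positivity) hn
    refine ⟨n, by exact_mod_cast hn0, ?_⟩
    rw [div_lt_iff₀ hη] at hn
    rw [div_le_iff₀ hn0]
    linarith
  have hSN : ∀ N, N₀ ≤ N → S / N ≤ η := fun N hN => by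
    refine le_trans ?_ hN₀S
    have : (0 : ℝ) < N₀ := by exact_mod_cast hN₀
    have h2 : (N₀ : ℝ) ≤ N := by exact_mod_cast hN
    gcongr
  have hstr : ∀ {N : ℕ} {z : ℂ}, z ∈ strip (4 * (1 / (N : ℝ))) → |z.im| ≤ 4 / N := fun {N z} hz => by
    rw [mem_strip] at hz
    refine hz.le.trans (le_of_eq ?_)
    ring
  have hdT : ∀ N, deriv (fun z => z + trig (fun k => cg k / (Complex.I * k)) N z) = trig cg N :=
    fun N => funext fun z => (hasDerivAt_id_add_trig hg0 N z).deriv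
  have hcT : ∀ k : ℤ, cg (-k) / (Complex.I * (-k : ℤ)) =
      (starRingEnd ℂ) (cg k / (Complex.I * k)) := fun k => by
    rw [map_div₀, map_mul, Complex.conj_I, hcg k, map_intCast]
    push_cast
    ring
  have aux : ∀ {f : ℝ → ℝ} {c : ℤ → ℂ} {S' : ℝ}, S' ≤ S →
      (∀ {N : ℕ}, 0 < N → ∀ z : ℂ, |z.im| ≤ 4 / N → ‖trig c N z - f z.re‖ ≤ S' / N) →
      ∀ {N : ℕ}, N₀ ≤ N → ∀ z ∈ strip (4 * (1 / (N : ℝ))), ‖trig c N z - f z.re‖ ≤ η := by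
    intro f c S' hS' hf N hN z hz
    refine (hf (hN₀.trans_le hN) z (hstr hz)).trans (le_trans ?_ (hSN N hN))
    gcongr
  refine ⟨(g gb + g ga) / 2, g gb / 2, B, (p + r) wa / 2, S, N₀, trig cp, trig cr,
    fun N z => z + trig (fun k => cg k / (Complex.I * k)) N z, by linarith, by linarith, hS, hN₀,
    fun N hN => ?_, fun N M hN hNM z hz => ?_, fun N hN x => ?_, fun N hN => ?_⟩
  · have hb : ∀ {f : ℝ → ℝ} {t : ℂ} {a b : ℝ} {z : ℂ}, ‖t - f z.re‖ ≤ η →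
        (f a ≤ f z.re ∧ f z.re ≤ f b) → ‖t‖ ≤ |f a| + |f b| + 1 := by
      intro f t a b z h1 h2
      have h3 := norm_sub_norm_le t (f z.re : ℂ)
      rw [Complex.norm_real, Real.norm_eq_abs] at h3
      have h4 : |f z.re| ≤ |f a| + |f b| :=
        abs_le.2 ⟨by linarith [neg_abs_le (f a), abs_nonneg (f b)],
          by linarith [le_abs_self (f b), abs_nonneg (f a)]⟩
      linarith
    refine ⟨fun z => (hasDerivAt_trig _ _ z).differentiableAt,
      fun z => (hasDerivAt_trig _ _ z).differentiableAt,
      fun z => (hasDerivAt_id_add_trig hg0 N z).differentiableAt,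
      fun z => trig_periodic _ _ _, fun z => trig_periodic _ _ _, fun z => ?_,
      fun x => trig_real hcp _ _, fun x => trig_real hcr _ _, fun x => ?_,
      fun z hz => ?_, fun z hz => ?_, fun z hz => ?_, fun z hz => ?_⟩
    · beta_reduce
      rw [trig_periodic]; ring
    · rw [Complex.add_im, Complex.ofReal_im, trig_real (c := fun k => cg k / (Complex.I * k)) hcT,
        add_zero]
    · have := hb (aux (by linarith) hp2 hN z hz) (hpb z.re)
      linarith [abs_nonneg (r ra), abs_nonneg (r rb)]
    · have := hb (aux (by linarith) hr2 hN z hz) (hrb z.re)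
      linarith [abs_nonneg (p pa), abs_nonneg (p pb)]
    · have h1 := (Complex.abs_re_le_norm _).trans (aux (by linarith) hp2 hN z hz)
      have h2 := (Complex.abs_re_le_norm _).trans (aux (by linarith) hr2 hN z hz)
      rw [Complex.sub_re, Complex.ofReal_re] at h1 h2
      rw [Complex.add_re]
      have h3 : (p + r) wa ≤ p z.re + r z.re := (hwb z.re).1
      linarith [(abs_le.1 h1).1, (abs_le.1 h2).1]
    · rw [hdT]
      have h1 := aux (by linarith) hg2 hN z hz
      have h2 : ‖(g z.re : ℂ) - ((g gb + g ga) / 2 : ℝ)‖ ≤ (g gb - g ga) / 2 := by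
        rw [← Complex.ofReal_sub, Complex.norm_real, Real.norm_eq_abs, abs_le]
        have := hgb z.re
        constructor <;> linarith
      have h3 := norm_sub_le_norm_sub_add_norm_sub (trig cg N z) (g z.re : ℂ)
        ((g gb + g ga) / 2 : ℝ)
      linarith
  · have hN1 := hN₀.trans_le hN
    have hN0 : (0 : ℝ) ≤ ((N : ℝ) ^ (51 / 8 : ℝ))⁻¹ := by positivity
    rw [hdT, hdT]
    refine ⟨(hp1 hN1 hNM z (hstr hz)).trans ?_, (hr1 hN1 hNM z (hstr hz)).trans ?_,
      (hg1 hN1 hNM z (hstr hz)).trans ?_⟩ <;>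
    exact mul_le_mul_of_nonneg_right (by linarith) hN0
  · have hN1 := hN₀.trans_le hN
    have hz : |((x : ℂ)).im| ≤ 4 / N := by simp; positivity
    rw [hdT]
    refine ⟨(hp2 hN1 x hz).trans ?_, (hr2 hN1 x hz).trans ?_, (hg2 hN1 x hz).trans ?_⟩ <;>
    exact div_le_div_of_nonneg_right (by linarith) (Nat.cast_nonneg _)
  · have hN1 := hN₀.trans_le hN
    have hd : ∀ c : ℤ → ℂ, ∃ C, ∀ z ∈ strip (4 * (1 / (N : ℝ))), ‖deriv (trig c N) z‖ ≤ C :=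
      fun c => ⟨_, fun z hz => (congrArg norm (hasDerivAt_trig c N z).deriv).trans_le
        (norm_trig_le _ hN1 (hstr hz))⟩
    obtain ⟨C₁, hC₁⟩ := hd cr
    obtain ⟨C₂, hC₂⟩ := hd cg
    beta_reduce
    rw [hdT]
    exact ⟨max C₁ C₂, fun z hz =>
      ⟨(hC₁ z hz).trans (le_max_left _ _), (hC₂ z hz).trans (le_max_right _ _)⟩⟩

end GeomData

end DualBilliard

namespace DualBilliard

open Filter Topology

/-- The rescaled generating function at a real point. -/
noncomputable def genH (p r g Θ : ℝ → ℝ) (ε x s : ℝ) : ℝ :=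
  ε * g x / (p x + r x) ^ 2 * (p x * r (x - ε * (1 - s)) + (p x ^ 2 + r (x - ε * (1 - s)) ^ 2) / 2 *
    Real.cos (Θ x - Θ (x - ε * (1 - s)))) / Real.sin (Θ x - Θ (x - ε * (1 - s)))

lemma genForm_ofReal {a P Q R ε ζ t : ℝ} (ht : t ≠ 0) (hε : ε ≠ 0) :
    genForm a P Q R (ζ / (ε * t) : ℝ) ζ t =
      ((ε * a / (P + Q) ^ 2 * (P * R + (P ^ 2 + R ^ 2) / 2 * Real.cos ζ) / Real.sin ζ : ℝ) : ℂ) := by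
  have ht' : (t : ℂ) ≠ 0 := by exact_mod_cast ht
  have hε' : (ε : ℂ) ≠ 0 := by exact_mod_cast hε
  have e : (t : ℂ) * ((ζ / (ε * t) : ℝ) : ℂ) * csinc ζ = Complex.sin ζ / ε := by
    rw [← csinc_mul]
    push_cast
    field_simp
  unfold genForm
  rw [e]
  push_cast
  rw [div_div_eq_mul_div]
  ring

namespace GeomData

variable {p r g Θ : ℝ → ℝ}

lemma tendsto_genVec (h : GeomData p r g Θ) {c ρ B w S : ℝ} {N : ℕ → ℕ} {P Q T : ℕ → ℂ → ℂ}
    {K : ℝ} (hN : Tendsto N atTop atTop)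
    (hadm : ∀ n, Adm c ρ B w (1 / N n) (P n) (Q n) (T n)) (hN0 : ∀ n, 0 < N n)
    (happ : ∀ n, ∀ x : ℝ, ‖P n x - p x‖ ≤ S / N n ∧ ‖Q n x - r x‖ ≤ S / N n ∧
        ‖deriv (T n) x - g x‖ ≤ S / N n)
    (hK : ∀ v ∈ params c ρ B w, ∀ v' ∈ params c ρ B w, ‖genVec v - genVec v'‖ ≤ K * ‖v - v'‖)
    {ε : ℝ} (hε : 0 < ε) (hε1 : (|c| + ρ) * (3 / 2 * ε) ≤ 1) {x s : ℝ} (hs : |s| < 1 / 2) :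
    Tendsto (fun n => genVec (geomVec ε (P n) (Q n) (T n) ((x : ℂ), (s : ℂ)))) atTop
      (𝓝 (genH p r g Θ ε x s : ℂ)) := by
  have ht : 1 - s ≠ 0 := by
    have := (abs_lt.1 hs).2
    intro h0
    linarith
  obtain ⟨y, hy⟩ : ∃ y, y = x - ε * (1 - s) := ⟨_, rfl⟩
  have hSN : Tendsto (fun n => S / (N n : ℝ)) atTop (𝓝 0) :=
    (tendsto_const_nhds (x := S)).div_atTop (tendsto_natCast_atTop_atTop.comp hN)
  have key : ∀ {f : ℕ → ℂ} {a : ℂ} {C : ℝ}, (∀ n, ‖f n - a‖ ≤ S / N n * C) →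
      Tendsto f atTop (𝓝 a) := fun {f a C} hf => by
    rw [tendsto_iff_norm_sub_tendsto_zero]
    refine squeeze_zero (fun n => norm_nonneg _) hf ?_
    simpa using hSN.mul_const C
  have hΘ : Tendsto (fun n => T n x - T n y) atTop (𝓝 ((Θ x - Θ y : ℝ) : ℂ)) := by
    refine key (C := ‖x - y‖) fun n => ?_
    have h1 : ∀ t : ℝ, HasDerivWithinAt (fun t : ℝ => T n t - (Θ t : ℂ)) (deriv (T n) t - g t)
        Set.univ t := fun t =>
      (((hadm n).diffΘ t).hasDerivAt.comp_ofReal.fun_sub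
        (h.derivΘ t).ofReal_comp).hasDerivWithinAt
    have h2 := convex_univ.norm_image_sub_le_of_norm_hasDerivWithin_le (fun t _ => h1 t)
      (fun t _ => (happ n t).2.2) (Set.mem_univ y) (Set.mem_univ x)
    convert! h2 using 2
    push_cast
    ring
  obtain ⟨v, hv⟩ : ∃ v : ℕ → Fin 7 → ℂ, v = fun n =>
      geomVec ε (P n) (Q n) (T n) ((x : ℂ), (s : ℂ)) := ⟨_, rfl⟩
  obtain ⟨v', hv'⟩ : ∃ v' : Fin 7 → ℂ, v' = ![(g x : ℂ), p x, r x, r y,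
    ((Θ x - Θ y) / (ε * (1 - s)) : ℝ), (Θ x - Θ y : ℝ), (1 - s : ℝ)] := ⟨_, rfl⟩
  have hyc : (x : ℂ) - ε * (1 - s) = (y : ℂ) := by rw [hy]; push_cast; ring
  have hlim : Tendsto v atTop (𝓝 v') := by
    rw [tendsto_pi_nhds]
    intro i
    simp only [hv, hv', geomVec, hyc]
    fin_cases i <;> simp only [Fin.isValue, Fin.reduceFinMk, Matrix.cons_val, Fin.zero_eta,
      Fin.mk_one]
    · exact key (C := 1) fun n => by simpa using (happ n x).2.2
    · exact key (C := 1) fun n => by simpa using (happ n x).1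
    · exact key (C := 1) fun n => by simpa using (happ n x).2.1
    · exact key (C := 1) fun n => by simpa using (happ n y).2.1
    · have := hΘ.div_const ((ε : ℂ) * (1 - s))
      push_cast at this ⊢
      exact this
    · exact hΘ
    · push_cast
      exact tendsto_const_nhds
  have hmem : ∀ n, v n ∈ params c ρ B w := fun n => by
    rw [hv]
    exact (hadm n).mem_params hε hε1 (real_mem_edom (by have := hN0 n; positivity) hs)
  have hmem' : v' ∈ params c ρ B w :=
    (isCompact_params c ρ B w).isClosed.mem_of_tendsto hlim (Eventually.of_forall hmem)
  have e : genVec v' = (genH p r g Θ ε x s : ℂ) := by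
    have := genForm_ofReal (a := g x) (P := p x) (Q := r x) (R := r y) (ζ := Θ x - Θ y) ht hε.ne'
    rw [genVec, genH, ← hy, ← this, hv']
    rfl
  rw [← e, tendsto_iff_norm_sub_tendsto_zero]
  have h0 := (tendsto_iff_norm_sub_tendsto_zero.1 hlim).const_mul K
  rw [mul_zero] at h0
  refine squeeze_zero (fun n => norm_nonneg _) (fun n => ?_) h0
  have := hK _ (hmem n) _ hmem'
  rwa [hv] at this ⊢

theorem exists_elCurve (h : GeomData p r g Θ) {γ : ℝ} (hγ : 0 < γ) :
    ∃ ε₀ : ℝ, 0 < ε₀ ∧ ∀ ε α : ℝ, 0 < ε → ε ≤ ε₀ → Dioph γ ε α →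
      ∃ u, ELCurve ε α (genH p r g Θ ε) u := by
  obtain ⟨c, ρ, B, w, S, N₀, P, Q, T, hc, hw, hS, hN₀, hadm, hdiff, happ, hC⟩ := h.exists_adm
  obtain ⟨K, hK0, hK⟩ := exists_lipschitz_genVec (B := B) hc hw
  obtain ⟨L, hL1, hL⟩ := kam_limit (KH := K * (S + 1)) hγ (by positivity)
  obtain ⟨m, hm⟩ : ∃ m : ℕ, L + N₀ ≤ (2 : ℝ) ^ m := by
    obtain ⟨m, hm⟩ := pow_unbounded_of_one_lt (L + N₀) (one_lt_two (α := ℝ))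
    exact ⟨m, hm.le⟩
  obtain ⟨N, hN⟩ : ∃ N : ℕ → ℕ, N = fun n => (2 ^ (m + n)) ^ 8 := ⟨_, rfl⟩
  have hN2 : ∀ n, m + n ≤ N n := fun n => by
    rw [hN]
    exact (Nat.lt_two_pow_self).le.trans (Nat.le_self_pow (by norm_num) _)
  have hNmono : ∀ n, N n ≤ N (n + 1) := fun n => by
    rw [hN]
    exact Nat.pow_le_pow_left (Nat.pow_le_pow_right (by norm_num) (by omega)) 8
  have hNN₀ : ∀ n, N₀ ≤ N n := fun n => by
    have h1 : (N₀ : ℝ) ≤ (2 : ℝ) ^ m := by linarith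
    have h2 : N₀ ≤ 2 ^ m := by exact_mod_cast h1
    rw [hN]
    exact h2.trans ((Nat.pow_le_pow_right (by norm_num) (by omega)).trans
      (Nat.le_self_pow (by norm_num) _))
  have hNpos : ∀ n, 0 < N n := fun n => hN₀.trans_le (hNN₀ n)
  obtain ⟨q, hq⟩ : ∃ q : ℝ, q = 1 / 2 ^ m := ⟨_, rfl⟩
  have hq0 : 0 < q := by rw [hq]; positivity
  have hq1 : q ≤ 1 := by
    rw [hq, div_le_one (by positivity)]
    exact one_le_pow₀ one_le_two
  have hqn : ∀ n : ℕ, q / 2 ^ n = 1 / 2 ^ (m + n) := fun n => by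
    rw [hq, div_div, ← pow_add]
  have hq8 : ∀ n : ℕ, (q / 2 ^ n) ^ 8 = 1 / (N n : ℝ) := fun n => by
    rw [hqn, hN, one_div_pow]
    push_cast
    rfl
  have hq51 : ∀ n : ℕ, ((N n : ℝ) ^ (51 / 8 : ℝ))⁻¹ = (q / 2 ^ n) ^ 51 := fun n => by
    rw [hqn, hN, one_div_pow, one_div]
    push_cast
    rw [← Real.rpow_natCast, ← Real.rpow_mul (by positivity)]
    norm_num
  obtain ⟨C, hC⟩ := hC (N 0) (hNN₀ 0)
  obtain ⟨C', hC'1, hC'2, hC'0⟩ : ∃ C' : ℝ, C ≤ C' ∧ |c| + ρ ≤ C' ∧ 0 ≤ C' :=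
    ⟨max 0 (max C (|c| + ρ)), by simp, by simp, by simp⟩
  refine ⟨min (1 / 4) (q ^ 51 / (3 / 2 * C' + 1)), by positivity, fun ε α hε hε₀ hα => ?_⟩
  have hε4 : ε ≤ 1 / 4 := hε₀.trans (min_le_left _ _)
  have hε5 : 3 / 2 * C' * ε ≤ q ^ 51 := by
    have := hε₀.trans (min_le_right _ _)
    rw [le_div_iff₀ (by positivity)] at this
    nlinarith
  have hε1 : (|c| + ρ) * (3 / 2 * ε) ≤ 1 := by
    have h1 : q ^ 51 ≤ 1 := pow_le_one₀ hq0.le hq1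
    have h2 : (|c| + ρ) * (3 / 2 * ε) ≤ C' * (3 / 2 * ε) := by gcongr
    linarith
  have hLq : L * q ≤ 1 := by
    rw [hq, mul_one_div, div_le_one (by positivity)]
    have : (0 : ℝ) ≤ N₀ := Nat.cast_nonneg _
    linarith
  refine hL (q := q) (H := fun n z => genVec (geomVec ε (P (N n)) (Q (N n)) (T (N n)) z)) hq0 hLq
    hε hε4 hα (fun n => ?_) (fun n z hz => ?_) (fun z hz => ?_) (fun x s hs => ?_)
  · rw [hq8]
    exact (hadm _ (hNN₀ n)).goodH hc hw hε hε1
  · rw [hq8] at hz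
    have hA := hadm _ (hNN₀ (n + 1))
    have hA' := (hadm _ (hNN₀ n)).mono (σ' := 1 / (N (n + 1) : ℝ)) (by
      have h1 : (0 : ℝ) < N n := by exact_mod_cast hNpos n
      have h2 : (N n : ℝ) ≤ N (n + 1) := by exact_mod_cast hNmono n
      gcongr)
    have hd := hdiff _ _ (hNN₀ n) (hNmono n)
    refine (hK _ (hA.mem_params hε hε1 hz) _ (hA'.mem_params hε hε1 hz)).trans ?_
    have := hA.norm_geomVec_sub_le hA' hε hε4 (fun z hz => (hd z hz).1) (fun z hz => (hd z hz).2.1)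
      (fun z hz => (hd z hz).2.2) hz
    rw [hq51] at this
    have hq' : 0 ≤ (q / 2 ^ n) ^ 51 := by positivity
    rw [mul_assoc]
    exact mul_le_mul_of_nonneg_left (this.trans (by nlinarith)) hK0
  · have hz' : z ∈ edom ε (1 / (N 0 : ℝ)) := by
      rw [← hq8 0, pow_zero, div_one]
      exact hz
    refine ((hadm _ (hNN₀ 0)).norm_sub_half_inv_le hc hw hε hε1 hK hK0 hC'2
      (fun z hz => (hC z hz).1.trans hC'1) (fun z hz => (hC z hz).2.trans hC'1) hz').trans ?_
    rw [mul_assoc K (S + 1)]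
    refine mul_le_mul_of_nonneg_left ?_ hK0
    have hq' : 0 ≤ q ^ 51 := by positivity
    nlinarith
  · exact h.tendsto_genVec (N := N) (tendsto_atTop_mono hN2 (tendsto_atTop_mono
      (fun n => Nat.le_add_left n m) tendsto_id))
      (fun n => hadm _ (hNN₀ n)) hNpos (fun n => happ _ (hNN₀ n)) hK hε hε1 hs

end GeomData

end DualBilliard

namespace DualBilliard

lemma abs_sub_round_le_norm_exp (x : ℝ) :
    ∃ j : ℤ, 2 / π * |x - 2 * π * j| ≤ ‖Complex.exp (x * Complex.I) - 1‖ := by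
  refine ⟨round (x / (2 * π)), ?_⟩
  have hpi := Real.pi_pos
  set j := round (x / (2 * π))
  have h1 : |x - 2 * π * j| ≤ π := by
    have h := abs_sub_round (x / (2 * π))
    have e : x - 2 * π * j = 2 * π * (x / (2 * π) - j) := by field_simp
    rw [e, abs_mul, abs_of_pos Real.two_pi_pos]
    calc 2 * π * |x / (2 * π) - j| ≤ 2 * π * (1 / 2) := by gcongr
      _ = π := by ring
  have h2 := Real.mul_abs_le_abs_sin (x := (x - 2 * π * j) / 2) (by
    rw [abs_div, abs_of_pos (two_pos (α := ℝ))]; linarith)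
  have e2 : Complex.exp (x * Complex.I) = Complex.exp (Complex.I * ((x - 2 * π * j : ℝ) : ℂ)) := by
    rw [Complex.exp_eq_exp_iff_exists_int]
    exact ⟨j, by push_cast; ring⟩
  rw [e2, Complex.norm_exp_I_mul_ofReal_sub_one, norm_mul, Real.norm_eq_abs, Real.norm_eq_abs,
    abs_of_pos (two_pos (α := ℝ))]
  rw [abs_div, abs_of_pos (two_pos (α := ℝ))] at h2
  linarith

/-- Radius of the excluded neighbourhood of the resonances of order `k`. -/
noncomputable def resRadius (γ ε₁ : ℝ) (k : ℕ) : ℝ := 2 * γ * ε₁ * ((k : ℝ) ^ (17 / 8 : ℝ))⁻¹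

lemma dioph_of_forall_nat {γ ε α : ℝ}
    (h : ∀ n : ℕ, 0 < n → γ * ε ≤ ‖Complex.exp ((n * α : ℝ) * Complex.I) - 1‖ * (n : ℝ) ^ (9 / 8 : ℝ)) :
    Dioph γ ε α := by
  intro k hk
  have h1 := h k.natAbs (Int.natAbs_pos.2 hk)
  have e1 : ((k.natAbs : ℕ) : ℝ) = |(k : ℝ)| := by
    rw [Nat.cast_natAbs, Int.cast_abs]
  rw [e1] at h1
  convert h1 using 2
  have e : ∀ x : ℝ, ‖Complex.exp (x * Complex.I) - 1‖ = 2 * |Real.sin (x / 2)| := fun x => by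
    rw [mul_comm, Complex.norm_exp_I_mul_ofReal_sub_one, norm_mul, Real.norm_eq_abs,
      Real.norm_eq_abs, abs_of_pos (two_pos (α := ℝ))]
  have e2 : (k : ℂ) * α = ((k * α : ℝ) : ℂ) := by push_cast; rfl
  rw [e2, e, e]
  rcases abs_choice (k : ℝ) with h2 | h2 <;> rw [h2]
  rw [neg_mul, neg_div, Real.sin_neg, abs_neg]

lemma dioph_of_resonance {γ ε₁ ε : ℝ} (hγ : 0 < γ) (hγ1 : γ ≤ 1 / 2) (hε : 0 < ε) (hε₁ : ε ≤ ε₁)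
    (h : ∀ k m : ℕ, 0 < k → 0 < m → (m : ℝ) ≤ k * ε₁ → resRadius γ ε₁ k ≤ |ε - π * m / k|) :
    Dioph γ ε (π - ε) := by
  refine dioph_of_forall_nat fun n hn => ?_
  obtain ⟨j, hj⟩ := abs_sub_round_le_norm_exp (n * (π - ε))
  have hn1 : (1 : ℝ) ≤ n := by exact_mod_cast hn
  have hn0 : (0 : ℝ) < n := by linarith
  have hpi := Real.pi_gt_three
  have hpi4 := Real.pi_le_four
  obtain ⟨m, hm⟩ : ∃ m : ℤ, m = n - 2 * j := ⟨_, rfl⟩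
  have hmR : (m : ℝ) = n - 2 * j := by rw [hm]; push_cast; ring
  have e : n * (π - ε) - 2 * π * j = -(n * ε - π * m) := by rw [hmR]; ring
  rw [e, abs_neg] at hj
  have hp1 : 1 ≤ (n : ℝ) ^ (9 / 8 : ℝ) := Real.one_le_rpow hn1 (by norm_num)
  have key : 2 * γ * ε ≤ |n * ε - π * m| * (n : ℝ) ^ (9 / 8 : ℝ) := by
    have triv : 1 * ε ≤ |n * ε - π * m| → 2 * γ * ε ≤ |n * ε - π * m| * (n : ℝ) ^ (9 / 8 : ℝ) := by
      intro h0
      have : |n * ε - π * m| ≤ |n * ε - π * m| * (n : ℝ) ^ (9 / 8 : ℝ) :=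
        le_mul_of_one_le_right (abs_nonneg _) hp1
      nlinarith
    rcases le_or_gt m 0 with hm0 | hm0
    · apply triv
      have hm0' : (m : ℝ) ≤ 0 := by exact_mod_cast hm0
      refine le_trans ?_ (le_abs_self _)
      nlinarith
    · lift m to ℕ using hm0.le
      rw [Int.cast_natCast] at *
      have hm1 : (1 : ℝ) ≤ m := by exact_mod_cast hm0
      rcases le_or_gt (m : ℝ) (n * ε₁) with h1 | h1
      · have h2 := h n m hn (by exact_mod_cast hm0) h1
        have e3 : |n * ε - π * m| = n * |ε - π * m / n| := by
          rw [← abs_of_pos hn0, ← abs_mul, abs_of_pos hn0]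
          congr 1
          field_simp
        have e4 : (n : ℝ) * ((n : ℝ) ^ (17 / 8 : ℝ))⁻¹ * (n : ℝ) ^ (9 / 8 : ℝ) = 1 := by
          rw [← Real.rpow_neg hn0.le]
          nth_rewrite 1 [← Real.rpow_one (n : ℝ)]
          rw [← Real.rpow_add hn0, ← Real.rpow_add hn0]
          norm_num
        rw [e3]
        calc 2 * γ * ε ≤ 2 * γ * ε₁ := by gcongr
          _ = 2 * γ * ε₁ * ((n : ℝ) * ((n : ℝ) ^ (17 / 8 : ℝ))⁻¹ * (n : ℝ) ^ (9 / 8 : ℝ)) := by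
            rw [e4, mul_one]
          _ = n * resRadius γ ε₁ n * (n : ℝ) ^ (9 / 8 : ℝ) := by rw [resRadius]; ring
          _ ≤ _ := by gcongr
      · apply triv
        rw [abs_sub_comm]
        refine le_trans ?_ (le_abs_self _)
        nlinarith
  have hP : 0 ≤ (n : ℝ) ^ (9 / 8 : ℝ) := by linarith
  calc γ * ε ≤ 2 / π * (2 * γ * ε) := by
        rw [div_mul_eq_mul_div, le_div_iff₀ Real.pi_pos]
        have : 0 < γ * ε := by positivity
        nlinarith
    _ ≤ 2 / π * (|n * ε - π * m| * (n : ℝ) ^ (9 / 8 : ℝ)) := by gcongr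
    _ = 2 / π * |n * ε - π * m| * (n : ℝ) ^ (9 / 8 : ℝ) := by ring
    _ ≤ _ := by gcongr

/-- Diophantine parameters have positive measure near `0`. -/
theorem exists_dioph_set : ∃ γ : ℝ, 0 < γ ∧ ∀ ε₁ : ℝ, 0 < ε₁ → ε₁ ≤ 1 →
    ∃ D : Set ℝ, IsCompact D ∧ D ⊆ Set.Icc (ε₁ / 2) ε₁ ∧ 0 < volume D ∧
      ∀ ε ∈ D, Dioph γ ε (π - ε) := by
  have hsum : Summable fun k : ℕ => ((k : ℝ) ^ (9 / 8 : ℝ))⁻¹ :=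
    Real.summable_nat_rpow_inv.2 (by norm_num)
  obtain ⟨S, hS⟩ : ∃ S, S = ∑' k : ℕ, ((k : ℝ) ^ (9 / 8 : ℝ))⁻¹ := ⟨_, rfl⟩
  have hS0 : 0 ≤ S := by rw [hS]; exact tsum_nonneg fun k => by positivity
  refine ⟨1 / (16 * (S + 1)), by positivity, fun ε₁ hε₁ hε₁1 => ?_⟩
  obtain ⟨γ, hγ⟩ : ∃ γ, γ = 1 / (16 * (S + 1)) := ⟨_, rfl⟩
  rw [← hγ]
  have hγ0 : 0 < γ := by rw [hγ]; positivity
  have hγS : γ * S ≤ 1 / 16 := by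
    rw [hγ, div_mul_eq_mul_div, div_le_iff₀ (by positivity)]
    linarith
  have hγ1 : γ ≤ 1 / 2 := by
    rw [hγ]
    exact one_div_le_one_div_of_le two_pos (by linarith)
  obtain ⟨V, hV⟩ : ∃ V : ℕ → Set ℝ, V = fun k : ℕ => ⋃ m ∈ Finset.Icc 1 ⌊k * ε₁⌋₊,
    Metric.ball (π * m / k) (resRadius γ ε₁ k) := ⟨_, rfl⟩
  have hr : ∀ k, 0 ≤ resRadius γ ε₁ k := fun k => by unfold resRadius; positivity
  have hVo : IsOpen (⋃ k, V k) := isOpen_iUnion fun k => by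
    rw [hV]
    exact isOpen_biUnion fun m _ => Metric.isOpen_ball
  have hVk : ∀ k, volume (V k) ≤ ENNReal.ofReal (4 * γ * ε₁ ^ 2 * ((k : ℝ) ^ (9 / 8 : ℝ))⁻¹) := by
    intro k
    rw [hV]
    refine (measure_biUnion_finset_le _ _).trans ?_
    simp only [Real.volume_ball, Finset.sum_const, Nat.card_Icc, nsmul_eq_mul,
      Nat.add_sub_cancel]
    rw [← ENNReal.ofReal_natCast, ← ENNReal.ofReal_mul (Nat.cast_nonneg _)]
    apply ENNReal.ofReal_le_ofReal
    rcases Nat.eq_zero_or_pos k with rfl | hk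
    · simp
    have hk0 : (0 : ℝ) < k := by exact_mod_cast hk
    have e4 : (k : ℝ) * ((k : ℝ) ^ (17 / 8 : ℝ))⁻¹ = ((k : ℝ) ^ (9 / 8 : ℝ))⁻¹ := by
      rw [← Real.rpow_neg hk0.le, ← Real.rpow_neg hk0.le]
      nth_rewrite 1 [← Real.rpow_one (k : ℝ)]
      rw [← Real.rpow_add hk0]
      norm_num
    calc (⌊k * ε₁⌋₊ : ℝ) * (2 * resRadius γ ε₁ k) ≤ k * ε₁ * (2 * resRadius γ ε₁ k) := by
          have := hr k
          gcongr
          exact Nat.floor_le (by positivity)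
      _ = 4 * γ * ε₁ ^ 2 * ((k : ℝ) * ((k : ℝ) ^ (17 / 8 : ℝ))⁻¹) := by unfold resRadius; ring
      _ = _ := by rw [e4]
  have hVm : volume (⋃ k, V k) ≤ ENNReal.ofReal (ε₁ / 4) := by
    refine (measure_iUnion_le _).trans ((ENNReal.tsum_le_tsum hVk).trans ?_)
    rw [← ENNReal.ofReal_tsum_of_nonneg (fun k => by positivity) (hsum.mul_left _), tsum_mul_left,
      ← hS]
    apply ENNReal.ofReal_le_ofReal
    have : ε₁ ^ 2 ≤ ε₁ := by nlinarith
    have h2 : 0 ≤ γ * S := by positivity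
    nlinarith
  refine ⟨Set.Icc (ε₁ / 2) ε₁ \ ⋃ k, V k, isCompact_Icc.diff hVo, Set.sdiff_subset, ?_, ?_⟩
  · have h1 := le_measure_sdiff (μ := volume) (s₁ := Set.Icc (ε₁ / 2) ε₁) (s₂ := ⋃ k, V k)
    refine lt_of_lt_of_le ?_ h1
    rw [Real.volume_Icc, tsub_pos_iff_lt]
    refine hVm.trans_lt ?_
    rw [ENNReal.ofReal_lt_ofReal_iff (by linarith)]
    linarith
  · intro ε hε
    refine dioph_of_resonance hγ0 hγ1 (by linarith [hε.1.1]) hε.1.2 fun k m hk hm hmk => ?_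
    by_contra! hcon
    refine hε.2 (Set.mem_iUnion.2 ⟨k, ?_⟩)
    rw [hV]
    refine Set.mem_biUnion (x := m) (Finset.mem_coe.2 (Finset.mem_Icc.2 ⟨hm, ?_⟩)) ?_
    · exact Nat.le_floor hmk
    · rw [Metric.mem_ball, Real.dist_eq]
      exact hcon

end DualBilliard

namespace DualBilliard

open Filter Topology

/-- The counterclockwise unit tangent direction at normal angle `θ`. -/
noncomputable def tang (θ : ℝ) : ℝ × ℝ := (-Real.sin θ, Real.cos θ)

/-- The boundary point with normal angle `θ`. -/
noncomputable def foot (p : ℝ → ℝ) (θ : ℝ) : ℝ × ℝ :=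
  (p θ * Real.cos θ - deriv p θ * Real.sin θ, p θ * Real.sin θ + deriv p θ * Real.cos θ)

/-- A compact set with interior, with a differentiable support function. -/
structure Body (K : Set (ℝ × ℝ)) (p : ℝ → ℝ) : Prop where
  compact : IsCompact K
  interior_nonempty : (interior K).Nonempty
  supp : ∀ θ, p θ = suppFn K θ
  diff : Differentiable ℝ p

namespace Body

variable {K : Set (ℝ × ℝ)} {p : ℝ → ℝ}

lemma le_supp (h : Body K p) {a : ℝ × ℝ} (ha : a ∈ K) (θ : ℝ) :
    a.1 * Real.cos θ + a.2 * Real.sin θ ≤ p θ := by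
  rw [h.supp]
  exact le_csSup (h.compact.image (by fun_prop)).bddAbove ⟨a, ha, rfl⟩

lemma exists_eq_supp (h : Body K p) (θ : ℝ) :
    ∃ a ∈ K, a.1 * Real.cos θ + a.2 * Real.sin θ = p θ := by
  have hne : K.Nonempty := h.interior_nonempty.mono interior_subset
  rw [h.supp]
  exact (h.compact.image (f := fun z : ℝ × ℝ => z.1 * Real.cos θ + z.2 * Real.sin θ)
    (by fun_prop)).sSup_mem (hne.image _)

lemma periodic (h : Body K p) : Function.Periodic p (2 * π) := fun θ => by
  rw [h.supp, h.supp]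
  simp [suppFn]

lemma eq_foot (h : Body K p) {a : ℝ × ℝ} (ha : a ∈ K) {θ : ℝ}
    (haθ : a.1 * Real.cos θ + a.2 * Real.sin θ = p θ) : a = foot p θ := by
  have hmin : IsLocalMin (fun φ => p φ - (a.1 * Real.cos φ + a.2 * Real.sin φ)) θ :=
    Eventually.of_forall fun φ => by
      have := h.le_supp ha φ
      simp only [haθ]
      linarith
  have hd : HasDerivAt (fun φ => p φ - (a.1 * Real.cos φ + a.2 * Real.sin φ))
      (deriv p θ - (a.1 * -Real.sin θ + a.2 * Real.cos θ)) θ :=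
    (h.diff θ).hasDerivAt.fun_sub (((Real.hasDerivAt_cos θ).const_mul a.1).fun_add
      ((Real.hasDerivAt_sin θ).const_mul a.2))
  have h0 := hmin.hasDerivAt_eq_zero hd
  have e1 : deriv p θ = a.1 * -Real.sin θ + a.2 * Real.cos θ := by linarith
  unfold foot
  rw [← haθ, e1]
  ext
  · simp only
    linear_combination a.1 * (-Real.sin_sq_add_cos_sq θ)
  · simp only
    linear_combination a.2 * (-Real.sin_sq_add_cos_sq θ)

lemma foot_mem (h : Body K p) (θ : ℝ) : foot p θ ∈ K := by
  obtain ⟨a, ha, haθ⟩ := h.exists_eq_supp θ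
  rw [← h.eq_foot ha haθ]
  exact ha

lemma width_pos (h : Body K p) (θ : ℝ) : 0 < p θ + p (θ + π) := by
  obtain ⟨c, hc⟩ := h.interior_nonempty
  have hcont : ContinuousAt (fun t : ℝ => c + t • ((Real.cos θ, Real.sin θ) : ℝ × ℝ)) 0 := by
    fun_prop
  have hev : ∀ᶠ t : ℝ in 𝓝 0, c + t • ((Real.cos θ, Real.sin θ) : ℝ × ℝ) ∈ K := by
    refine hcont.eventually_mem ?_
    simpa using mem_interior_iff_mem_nhds.1 hc
  obtain ⟨t, ht, ht0⟩ := ((hev.filter_mono nhdsWithin_le_nhds).and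
    (self_mem_nhdsWithin (a := (0 : ℝ)) (s := Set.Ioi 0))).exists
  have ht0' : 0 < t := ht0
  have h1 := h.le_supp ht θ
  have h2 := h.le_supp (interior_subset hc) (θ + π)
  rw [Real.cos_add_pi, Real.sin_add_pi] at h2
  simp only [Prod.fst_add, Prod.snd_add, Prod.smul_fst, Prod.smul_snd, smul_eq_mul] at h1
  nlinarith [Real.sin_sq_add_cos_sq θ]

lemma dot_foot_normal (p : ℝ → ℝ) (θ l : ℝ) :
    (foot p θ + l • tang θ).1 * Real.cos θ + (foot p θ + l • tang θ).2 * Real.sin θ = p θ := by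
  simp only [foot, tang, Prod.fst_add, Prod.snd_add, Prod.smul_fst, Prod.smul_snd, smul_eq_mul]
  linear_combination p θ * Real.sin_sq_add_cos_sq θ

lemma notMem (h : Body K p) {θ l : ℝ} (hl : l ≠ 0) : foot p θ + l • tang θ ∉ K := by
  intro hK
  have h1 := h.eq_foot hK (dot_foot_normal p θ l)
  rw [add_eq_left, smul_eq_zero] at h1
  rcases h1 with h1 | h1
  · exact hl h1
  · have h2 := congrArg Prod.fst h1
    have h3 := congrArg Prod.snd h1
    simp only [tang, Prod.fst_zero, Prod.snd_zero, neg_eq_zero] at h2 h3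
    have := Real.sin_sq_add_cos_sq θ
    rw [h2, h3] at this
    norm_num at this

lemma mul_sin_nonneg (h : Body K p) {θ θ' l l' : ℝ}
    (he : foot p θ + l • tang θ = foot p θ' + l' • tang θ') : 0 ≤ l * Real.sin (θ' - θ) := by
  have h1 := h.le_supp (h.foot_mem θ) θ'
  have h2 := dot_foot_normal p θ' l'
  rw [← he] at h2
  simp only [tang, Prod.fst_add, Prod.snd_add, Prod.smul_fst, Prod.smul_snd, smul_eq_mul] at h2
  rw [Real.sin_sub]
  linarith

/-- A point outside `K` lies on exactly one tangent ray of each orientation. -/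
lemma tangent_unique (h : Body K p) {θ θ' l l' : ℝ} (hl : 0 < l * l')
    (he : foot p θ + l • tang θ = foot p θ' + l' • tang θ') : ∃ k : ℤ, θ' = θ + k * (2 * π) := by
  have h1 := h.mul_sin_nonneg he
  have h2 := h.mul_sin_nonneg he.symm
  rw [← neg_sub, Real.sin_neg] at h2
  have h3 : Real.sin (θ' - θ) = 0 := by
    have h4 : l * l' * Real.sin (θ' - θ) ^ 2 ≤ 0 := by nlinarith
    have h5 : Real.sin (θ' - θ) ^ 2 = 0 := le_antisymm (by nlinarith) (sq_nonneg _)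
    exact pow_eq_zero_iff two_ne_zero |>.1 h5
  obtain ⟨n, hn⟩ := Real.sin_eq_zero_iff.1 h3
  rcases Int.even_or_odd' n with ⟨k, rfl | rfl⟩
  · refine ⟨k, ?_⟩
    push_cast at hn
    linarith
  · exfalso
    have e : θ' = θ + π + k * (2 * π) := by push_cast at hn; linarith
    have hp' : p θ' = p (θ + π) := by rw [e]; exact h.periodic.int_mul k _
    have h4 := dot_foot_normal p θ' l'
    have h5 := dot_foot_normal p θ l
    rw [← he, hp', e, Real.cos_add_int_mul_two_pi, Real.sin_add_int_mul_two_pi, Real.cos_add_pi,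
      Real.sin_add_pi] at h4
    linarith [h.width_pos θ]

lemma foot_add_int (h : Body K p) (θ : ℝ) (k : ℤ) : foot p (θ + k * (2 * π)) = foot p θ := by
  have hd : Function.Periodic (deriv p) (2 * π) := fun x => by
    have : (fun y => p (y + 2 * π)) = p := funext h.periodic
    rw [← deriv_comp_add_const, this]
  have e1 : p (θ + k * (2 * π)) = p θ := h.periodic.int_mul k θ
  have e2 : deriv p (θ + k * (2 * π)) = deriv p θ := hd.int_mul k θ
  unfold foot
  rw [Real.cos_add_int_mul_two_pi, Real.sin_add_int_mul_two_pi, e1, e2]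

lemma tang_add_int (θ : ℝ) (k : ℤ) : tang (θ + k * (2 * π)) = tang θ := by
  unfold tang
  rw [Real.cos_add_int_mul_two_pi, Real.sin_add_int_mul_two_pi]

end Body

/-- `Φ` is the dual billiard map of `K`. -/
def IsDualBilliard (K : Set (ℝ × ℝ)) (p : ℝ → ℝ) (Φ : ℝ × ℝ → ℝ × ℝ) : Prop :=
  ∀ z : ℝ × ℝ, z ∉ K → ∃ θ l : ℝ, ∃ a : ℝ × ℝ, 0 < l ∧ a ∈ K ∧
    a.1 * Real.cos θ + a.2 * Real.sin θ = p θ ∧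
    z = a - l • ((-Real.sin θ, Real.cos θ) : ℝ × ℝ) ∧ Φ z = (2 : ℝ) • a - z

lemma IsDualBilliard.apply {K : Set (ℝ × ℝ)} {p : ℝ → ℝ} {Φ : ℝ × ℝ → ℝ × ℝ}
    (hΦ : IsDualBilliard K p Φ) (h : Body K p) {θ l : ℝ} (hl : 0 < l) :
    Φ (foot p θ - l • tang θ) = foot p θ + l • tang θ := by
  have e1 : foot p θ - l • tang θ = foot p θ + (-l) • tang θ := by rw [neg_smul, sub_eq_add_neg]
  obtain ⟨θ', l', a, hl', ha, haθ, hz, hΦz⟩ := hΦ (foot p θ - l • tang θ) (by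
    rw [e1]
    exact h.notMem (by linarith))
  rw [h.eq_foot ha haθ] at hz hΦz
  obtain ⟨k, rfl⟩ := h.tangent_unique (θ := θ) (θ' := θ') (l := -l) (l' := -l') (by nlinarith) (by
    rw [← e1, hz, neg_smul, sub_eq_add_neg]
    rfl)
  rw [hΦz, h.foot_add_int, two_smul]
  abel

end DualBilliard

namespace DualBilliard

open Filter Topology

lemma contDiff_add_two {p : ℝ → ℝ} {n : ℕ} (hp2 : ContDiff ℝ 2 p) (hp : ContDiff ℝ n p)
    (hρ : ContDiff ℝ n (fun θ => p θ + deriv (deriv p) θ)) : ContDiff ℝ (n + 2 : ℕ) p := by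
  have h1 : ContDiff ℝ n (deriv (deriv p)) := by
    simpa using hρ.sub hp
  have h2 : ContDiff ℝ 1 (deriv p) := (contDiff_succ_iff_deriv (n := 1).1 (by rwa [one_add_one_eq_two])).2.2
  have h3 : ContDiff ℝ (n + 1 : ℕ) (deriv p) := by
    push_cast
    exact contDiff_succ_iff_deriv.2 ⟨h2.differentiable (by norm_num), by simp, h1⟩
  have := contDiff_succ_iff_deriv (n := ((n + 1 : ℕ) : WithTop ℕ∞)) (f := p) |>.2
    ⟨hp2.differentiable (by norm_num), by simp, h3⟩
  exact_mod_cast this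

/-- The support function gains two derivatives on the radius of curvature. -/
lemma contDiff_seven_of_curvature {p : ℝ → ℝ} (hp2 : ContDiff ℝ 2 p) {r : ℕ} (hr : 4 < r)
    (hρ : ContDiff ℝ r (fun θ => p θ + deriv (deriv p) θ)) : ContDiff ℝ 7 p := by
  have hρ5 : ContDiff ℝ (5 : ℕ) (fun θ => p θ + deriv (deriv p) θ) :=
    hρ.of_le (by exact_mod_cast hr)
  have h4 : ContDiff ℝ (4 : ℕ) p := contDiff_add_two (n := 2) hp2 (by exact_mod_cast hp2)
    (hρ5.of_le (by norm_num))
  have h6 : ContDiff ℝ (6 : ℕ) p := contDiff_add_two (n := 4) hp2 h4 (hρ5.of_le (by norm_num))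
  have h7 : ContDiff ℝ (7 : ℕ) p :=
    contDiff_add_two (n := 5) hp2 (h6.of_le (by norm_num)) hρ5
  exact_mod_cast h7

lemma exists_inverse_coord {f : ℝ → ℝ} (hf : Continuous f) (hpos : ∀ θ, 0 < f θ)
    (hper : Function.Periodic f π) :
    ∃ c : ℝ, 0 < c ∧ ∃ Θ : ℝ → ℝ, (∀ x, HasDerivAt Θ (c * f (Θ x)) x) ∧
      ∀ x, Θ (x + π) = Θ x + π := by
  have hf' : Continuous fun θ => (f θ)⁻¹ := hf.inv₀ fun θ => (hpos θ).ne'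
  have hint : ∀ a b, IntervalIntegrable (fun θ => (f θ)⁻¹) volume a b :=
    fun a b => hf'.intervalIntegrable a b
  obtain ⟨J, hJd⟩ : ∃ J, J = ∫ t in (0 : ℝ)..π, (f t)⁻¹ := ⟨_, rfl⟩
  have hJ : 0 < J := by
    rw [hJd]
    exact intervalIntegral.intervalIntegral_pos_of_pos (hint _ _) (fun x => inv_pos.2 (hpos x))
      Real.pi_pos
  obtain ⟨X, hXd⟩ : ∃ X : ℝ → ℝ, X = fun θ => π / J * ∫ t in (0 : ℝ)..θ, (f t)⁻¹ := ⟨_, rfl⟩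
  have hX' : ∀ θ, HasDerivAt X (π / J * (f θ)⁻¹) θ := fun θ => by
    rw [hXd]
    exact (hf'.integral_hasStrictDerivAt 0 θ).hasDerivAt.const_mul _
  have hXπ : ∀ θ, X (θ + π) = X θ + π := fun θ => by
    have h1 : ∫ t in θ..θ + π, (f t)⁻¹ = J := by
      rw [hJd]
      have := Function.Periodic.intervalIntegral_add_eq
        (f := fun t => (f t)⁻¹) (T := π) (fun t => by simp only [hper t]) θ 0
      rw [this, zero_add]
    simp only [hXd]
    rw [← intervalIntegral.integral_add_adjacent_intervals (hint 0 θ) (hint θ (θ + π)), h1]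
    field_simp
  have hXc : Continuous X := continuous_iff_continuousAt.2 fun θ => (hX' θ).continuousAt
  have hXm : StrictMono X := strictMono_of_hasDerivAt_pos hX' fun θ => by
    have := hpos θ
    positivity
  have hXn : ∀ (n : ℕ) θ, X (θ + n * π) = X θ + n * π := by
    intro n
    induction n with
    | zero => simp
    | succ n ih =>
      intro θ
      have : θ + (n + 1 : ℕ) * π = θ + n * π + π := by push_cast; ring
      rw [this, hXπ, ih]
      push_cast
      ring
  have hsurj : Function.Surjective X := by
    intro y
    obtain ⟨n, hn⟩ := exists_nat_gt (|y - X 0| / π)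
    rw [div_lt_iff₀ Real.pi_pos] at hn
    have h1 := hXn n 0
    have h2 := hXn n (-(n * π))
    rw [zero_add] at h1
    rw [neg_add_cancel] at h2
    have := abs_lt.1 hn
    exact mem_range_of_exists_le_of_exists_ge hXc ⟨-(n * π), by linarith⟩ ⟨n * π, by linarith⟩
  let e := hXm.orderIsoOfSurjective X hsurj
  have he : ∀ x, X (e.symm x) = x := fun x => e.apply_symm_apply x
  refine ⟨J / π, by positivity, e.symm, fun x => ?_, fun x => ?_⟩
  · have := HasDerivAt.of_local_left_inverse (e.symm.continuous.continuousAt (x := x))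
      (hX' (e.symm x)) (by have := hpos (e.symm x); positivity) (Eventually.of_forall he)
    convert! this using 1
    rw [mul_inv, inv_div, inv_inv]
  · apply hXm.injective
    rw [he, hXπ, he]

/-- Coordinates in which the width form of the generating function is normalised. -/
structure Coord (p Θ : ℝ → ℝ) (c : ℝ) : Prop where
  smooth : ContDiff ℝ 7 p
  per : Function.Periodic p (2 * π)
  width : ∀ θ, 0 < p θ + p (θ + π)
  cpos : 0 < c
  derivΘ : ∀ x, HasDerivAt Θ (c * (p (Θ x) + p (Θ x + π)) ^ 2) x
  perΘ : ∀ x, Θ (x + π) = Θ x + π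

lemma Body.exists_coord {K : Set (ℝ × ℝ)} {p : ℝ → ℝ} (h : Body K p) (hs : ContDiff ℝ 7 p) :
    ∃ c Θ, Coord p Θ c := by
  obtain ⟨c, hc, Θ, h1, h2⟩ := exists_inverse_coord (f := fun θ => (p θ + p (θ + π)) ^ 2)
    (by have := hs.continuous; fun_prop) (fun θ => by have := h.width_pos θ; positivity)
    (fun θ => by
      have : p (θ + π + π) = p θ := by rw [← h.periodic θ]; congr 1; ring
      simp only [this]
      ring)
  exact ⟨c, Θ, hs, h.periodic, h.width_pos, hc, h1, h2⟩

namespace Coord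

variable {p Θ : ℝ → ℝ} {c : ℝ}

lemma contDiff (h : Coord p Θ c) : ContDiff ℝ 7 Θ := by
  have hd : deriv Θ = (fun θ => c * (p θ + p (θ + π)) ^ 2) ∘ Θ :=
    funext fun x => (h.derivΘ x).deriv
  have hF : ContDiff ℝ 7 (fun θ => c * (p θ + p (θ + π)) ^ 2) := by
    have := h.smooth
    have h2 : ContDiff ℝ 7 (fun θ => p (θ + π)) := this.comp (contDiff_id.add contDiff_const)
    exact contDiff_const.mul ((this.add h2).pow 2)
  have key : ∀ n : ℕ, n ≤ 7 → ContDiff ℝ n Θ := by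
    intro n
    induction n with
    | zero =>
      intro _
      rw [Nat.cast_zero]
      exact contDiff_zero.2 (continuous_iff_continuousAt.2 fun x => (h.derivΘ x).continuousAt)
    | succ n ih =>
      intro hn
      push_cast
      refine contDiff_succ_iff_deriv.2 ⟨fun x => (h.derivΘ x).differentiableAt, by simp, ?_⟩
      rw [hd]
      exact (hF.of_le (by exact_mod_cast Nat.le_of_succ_le hn)).comp (ih (by omega))
  exact_mod_cast key 7 le_rfl

lemma perΘ' (h : Coord p Θ c) (x : ℝ) : Θ (x + 2 * π) = Θ x + 2 * π := by
  rw [two_mul, ← add_assoc, h.perΘ, h.perΘ, add_assoc]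

lemma geomData (h : Coord p Θ c) : GeomData (fun x => p (Θ x)) (fun x => p (Θ x + π))
    (fun x => c * (p (Θ x) + p (Θ x + π)) ^ 2) Θ := by
  have hP : ContDiff ℝ 7 (fun x => p (Θ x)) := h.smooth.comp h.contDiff
  have hR : ContDiff ℝ 7 (fun x => p (Θ x + π)) :=
    h.smooth.comp (h.contDiff.add contDiff_const)
  have hPp : Function.Periodic (fun x => p (Θ x)) (2 * π) := fun x => by
    simp only [h.perΘ', h.per _]
  have hRp : Function.Periodic (fun x => p (Θ x + π)) (2 * π) := fun x => by
    simp only [h.perΘ', add_right_comm, h.per _]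
  refine ⟨hP, hR, contDiff_const.mul ((hP.add hR).pow 2), hPp, hRp, fun x => ?_, fun x => ?_,
    fun x => h.width _, h.derivΘ, h.perΘ'⟩
  · have h1 := hPp x
    have h2 := hRp x
    beta_reduce at h1 h2 ⊢
    rw [h1, h2]
  · have := h.width (Θ x)
    have := h.cpos
    positivity

end Coord

end DualBilliard

namespace DualBilliard

open Filter Topology

/-- Signed distance from the tangency point at angle `a` to the tangent line at angle `b`. -/
noncomputable def lfwd (p : ℝ → ℝ) (a b : ℝ) : ℝ :=
  (p b - p a * Real.cos (b - a)) / Real.sin (b - a) - deriv p a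

/-- Signed distance from the tangent line at angle `a` to the tangency point at angle `b`. -/
noncomputable def lbwd (p : ℝ → ℝ) (a b : ℝ) : ℝ :=
  (p a - p b * Real.cos (b - a)) / Real.sin (b - a) + deriv p b

/-- The area generating function in angular coordinates. -/
noncomputable def angGen (p : ℝ → ℝ) (θ φ : ℝ) : ℝ :=
  (p θ * p (φ + π) + (p θ ^ 2 + p (φ + π) ^ 2) / 2 * Real.cos (θ - φ)) / Real.sin (θ - φ)

lemma hasDerivAt_angGen {p θ φ : ℝ → ℝ} (hp : Differentiable ℝ p) {θ' φ' t : ℝ}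
    (hθ : HasDerivAt θ θ' t) (hφ : HasDerivAt φ φ' t) (hs : Real.sin (θ t - φ t) ≠ 0) :
    HasDerivAt (fun t => angGen p (θ t) (φ t))
      ((-lfwd p (θ t) (φ t + π) ^ 2 + deriv p (θ t) ^ 2 - p (θ t) ^ 2) / 2 * θ' +
        (lbwd p (θ t) (φ t + π) ^ 2 - deriv p (φ t + π) ^ 2 + p (φ t + π) ^ 2) / 2 * φ') t := by
  have hP : HasDerivAt (fun t => p (θ t)) (deriv p (θ t) * θ') t :=
    (hp (θ t)).hasDerivAt.comp t hθ
  have hR : HasDerivAt (fun t => p (φ t + π)) (deriv p (φ t + π) * φ') t :=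
    (hp (φ t + π)).hasDerivAt.comp t (hφ.add_const π)
  have hζ := hθ.fun_sub hφ
  have := ((hP.fun_mul hR).fun_add ((((hP.fun_pow 2).fun_add (hR.fun_pow 2)).div_const 2).fun_mul
    hζ.cos)).fun_div hζ.sin hs
  refine this.congr_deriv ?_
  have e1 : φ t + π - θ t = π - (θ t - φ t) := by ring
  unfold lfwd lbwd
  rw [e1, Real.sin_pi_sub, Real.cos_pi_sub]
  have hsc := Real.sin_sq_add_cos_sq (θ t - φ t)
  generalize Real.sin (θ t - φ t) = S at hs hsc ⊢
  generalize Real.cos (θ t - φ t) = C at hsc ⊢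
  generalize p (θ t) = P
  generalize p (φ t + π) = R
  generalize deriv p (θ t) = P'
  generalize deriv p (φ t + π) = R'
  field_simp
  push_cast
  have hC : C ^ 2 = 1 - S ^ 2 := by linarith
  ring_nf
  simp only [hC]
  ring

lemma abs_sub_le_of_deriv {p : ℝ → ℝ} (hp : Differentiable ℝ p) {M : ℝ}
    (hM : ∀ x, |deriv p x| ≤ M) (x y : ℝ) : |p y - p x| ≤ M * |y - x| :=
  convex_univ.norm_image_sub_le_of_norm_deriv_le (fun x _ => hp x) (fun x _ => hM x)
    (Set.mem_univ x) (Set.mem_univ y)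

lemma periodic_deriv {p : ℝ → ℝ} {T : ℝ} (h : Function.Periodic p T) :
    Function.Periodic (deriv p) T := fun x => by
  have : (fun y => p (y + T)) = p := funext h
  rw [← deriv_comp_add_const, this]

namespace Coord

variable {p Θ : ℝ → ℝ} {c : ℝ}

lemma exists_deriv_bound (h : Coord p Θ c) :
    ∃ M, 0 < M ∧ (∀ x, |p x| ≤ M) ∧ (∀ x, |deriv p x| ≤ M) := by
  have hc : Continuous (deriv p) := h.smooth.continuous_deriv (by norm_num)
  obtain ⟨_, x₁, h₁⟩ := exists_bounds_of_periodic (f := fun x => |p x|)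
    h.smooth.continuous.abs (fun x => by simp only [h.per x])
  obtain ⟨_, x₂, h₂⟩ := exists_bounds_of_periodic (f := fun x => |deriv p x|)
    hc.abs (fun x => by simp only [periodic_deriv h.per x])
  refine ⟨|p x₁| + |deriv p x₂| + 1, by positivity, fun x => ?_, fun x => ?_⟩
  · linarith [(h₁ x).2, abs_nonneg (deriv p x₂)]
  · linarith [(h₂ x).2, abs_nonneg (p x₁)]

/-- Nearly antipodal tangent lines meet far away. -/
lemma exists_far (h : Coord p Θ c) (Λ : ℝ) : ∃ ζ₀ : ℝ, 0 < ζ₀ ∧ ζ₀ ≤ 1 ∧ ∀ θ φ : ℝ,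
    0 < θ - φ → θ - φ ≤ ζ₀ → Λ < lfwd p θ (φ + π) ∧ Λ < lbwd p θ (φ + π) := by
  obtain ⟨M, hM, hp, hp'⟩ := h.exists_deriv_bound
  obtain ⟨x₀, _, hx₀⟩ := exists_bounds_of_periodic (f := fun x => p x + p (x + π))
    (by have := h.smooth.continuous; fun_prop) (fun x => by
      have := h.per (x + π)
      simp only [h.per x]
      rw [← this]
      ring_nf)
  have hw := h.width x₀
  obtain ⟨w, hwd⟩ : ∃ w, w = p x₀ + p (x₀ + π) := ⟨_, rfl⟩
  rw [← hwd] at hw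
  refine ⟨min 1 (min (w / (4 * M)) (w / (2 * (|Λ| + M + 1)))), by positivity, by simp,
    fun θ φ h0 h1 => ?_⟩
  obtain ⟨ζ, hζ⟩ : ∃ ζ, ζ = θ - φ := ⟨_, rfl⟩
  rw [← hζ] at h0 h1
  have hz1 : ζ ≤ 1 := h1.trans (min_le_left _ _)
  have hz2 : ζ * (4 * M) ≤ w := by
    rw [← le_div_iff₀ (by positivity)]
    exact h1.trans ((min_le_right _ _).trans (min_le_left _ _))
  have hz3 : ζ * (2 * (|Λ| + M + 1)) ≤ w := by
    rw [← le_div_iff₀ (by positivity)]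
    exact h1.trans ((min_le_right _ _).trans (min_le_right _ _))
  have hS0 : 0 < Real.sin ζ := Real.sin_pos_of_pos_of_lt_pi h0 (by linarith [Real.pi_gt_three])
  have hS1 : Real.sin ζ ≤ ζ := Real.sin_le h0.le
  have hC1 : 1 - Real.cos ζ ≤ ζ := by
    have := Real.one_sub_sq_div_two_le_cos (x := ζ)
    nlinarith
  have hC0 : 0 ≤ 1 - Real.cos ζ := by linarith [Real.cos_le_one ζ]
  have hd : |p θ - p φ| ≤ M * ζ := by
    have := abs_sub_le_of_deriv (h.smooth.differentiable (by norm_num)) hp' φ θ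
    rwa [← hζ, abs_of_pos h0] at this
  have hwφ : w ≤ p φ + p (φ + π) := by rw [hwd]; exact (hx₀ φ).1
  have e1 : φ + π - θ = π - ζ := by rw [hζ]; ring
  have hbd : ∀ y, y * (1 - Real.cos ζ) ≤ M * ζ ∨ M < y := fun y => by
    by_cases hy : y ≤ M
    · left
      calc y * (1 - Real.cos ζ) ≤ M * (1 - Real.cos ζ) := by gcongr
        _ ≤ M * ζ := by gcongr
    · right; linarith
  have hbd' : ∀ x, p x * (1 - Real.cos ζ) ≤ M * ζ := fun x =>
    (hbd (p x)).resolve_right (not_lt.2 ((le_abs_self _).trans (hp x)))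
  have key : ∀ num, w / 2 ≤ num → Λ + M < num / Real.sin ζ := fun num hnum => by
    rw [lt_div_iff₀ hS0]
    have : (Λ + M) * Real.sin ζ ≤ (|Λ| + M) * ζ := by
      calc (Λ + M) * Real.sin ζ ≤ (|Λ| + M) * Real.sin ζ := by gcongr; exact le_abs_self Λ
        _ ≤ (|Λ| + M) * ζ := by gcongr
    nlinarith
  unfold lfwd lbwd
  rw [e1, Real.sin_pi_sub, Real.cos_pi_sub]
  have hd1 := abs_le.1 hd
  constructor
  · have := key (p (φ + π) - p θ * -Real.cos ζ) (by linarith [hbd' θ])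
    linarith [(abs_le.1 (hp' θ)).2]
  · have := key (p θ - p (φ + π) * -Real.cos ζ) (by linarith [hbd' (φ + π)])
    linarith [(abs_le.1 (hp' (φ + π))).1]

lemma genH_eq (h : Coord p Θ c) (ε x s : ℝ) :
    genH (fun x => p (Θ x)) (fun x => p (Θ x + π))
      (fun x => c * (p (Θ x) + p (Θ x + π)) ^ 2) Θ ε x s =
    ε * c * angGen p (Θ x) (Θ (x - ε * (1 - s))) := by
  have := h.width (Θ x)
  unfold genH angGen
  field_simp

lemma exists_lipschitz (h : Coord p Θ c) : ∃ C, 0 < C ∧ ∀ x y, |Θ y - Θ x| ≤ C * |y - x| := by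
  obtain ⟨M, hM, hp, -⟩ := h.exists_deriv_bound
  have hc := h.cpos
  refine ⟨c * (M + M) ^ 2, by positivity, fun x y => abs_sub_le_of_deriv
    (fun x => (h.derivΘ x).differentiableAt) (fun x => ?_) x y⟩
  rw [(h.derivΘ x).deriv, abs_of_nonneg (by positivity)]
  gcongr
  · exact (h.width _).le
  · exact (le_abs_self _).trans (hp _)
  · exact (le_abs_self _).trans (hp _)

lemma strictMono (h : Coord p Θ c) : StrictMono Θ :=
  strictMono_of_hasDerivAt_pos h.derivΘ fun x => by
    have := h.width (Θ x)
    have := h.cpos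
    positivity

end Coord

/-- An invariant curve of the dual billiard map, given by its sequence of tangency angles. -/
structure TCurve (p Θ : ℝ → ℝ) (Λ ε : ℝ) (u : ℝ → ℝ) : Prop where
  lip : ∀ x y, |u y - u x - (y - x)| ≤ |y - x| / 4
  per : ∀ x, u (x + 2 * π) = u x + 2 * π
  shift : ∀ x, |u (x + (π - ε)) - u x - (π - ε)| ≤ ε / 4
  sinPos : ∀ x, 0 < Real.sin (Θ (u (x + (π - ε))) - Θ (u x))
  bigFwd : ∀ x, Λ < lfwd p (Θ (u x)) (Θ (u (x + (π - ε))))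
  bigBwd : ∀ x, Λ < lbwd p (Θ (u x)) (Θ (u (x + (π - ε))))
  reflect : ∀ x, lfwd p (Θ (u (x + (π - ε)))) (Θ (u (x + (π - ε) + (π - ε)))) =
    lbwd p (Θ (u x)) (Θ (u (x + (π - ε))))

lemma Coord.exists_tCurve {p Θ : ℝ → ℝ} {c : ℝ} (h : Coord p Θ c) {Λ : ℝ} (hΛ : 0 ≤ Λ) :
    ∃ ε₀ : ℝ, 0 < ε₀ ∧ ∀ ε u, 0 < ε → ε ≤ ε₀ →
      ELCurve ε (π - ε) (genH (fun x => p (Θ x)) (fun x => p (Θ x + π))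
        (fun x => c * (p (Θ x) + p (Θ x + π)) ^ 2) Θ ε) u → TCurve p Θ Λ ε u := by
  obtain ⟨ζ₀, hζ₀, hζ₁, hfar⟩ := h.exists_far Λ
  obtain ⟨C, hC, hΘ⟩ := h.exists_lipschitz
  refine ⟨ζ₀ / (2 * C), by positivity, fun ε u hε hε₀ hu => ?_⟩
  rw [le_div_iff₀ (by positivity)] at hε₀
  have hp : Differentiable ℝ p := h.smooth.differentiable (by norm_num)
  have hback : ∀ y, Θ (y - π) + π = Θ y := fun y => by rw [← h.perΘ, sub_add_cancel]
  have hζ : ∀ x, 0 < Θ (u x) - Θ (u (x + (π - ε)) - π) ∧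
      Θ (u x) - Θ (u (x + (π - ε)) - π) ≤ ζ₀ := fun x => by
    have h1 := abs_le.1 (hu.shift x)
    refine ⟨sub_pos.2 (h.strictMono (by linarith)), (le_abs_self _).trans ((hΘ _ _).trans ?_)⟩
    rw [abs_of_pos (by linarith)]
    nlinarith
  have hsin : ∀ x, 0 < Real.sin (Θ (u x) - Θ (u (x + (π - ε)) - π)) := fun x =>
    Real.sin_pos_of_pos_of_lt_pi (hζ x).1 (by linarith [(hζ x).2, Real.pi_gt_three])
  have hfar' : ∀ x, Λ < lfwd p (Θ (u x)) (Θ (u (x + (π - ε)))) ∧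
      Λ < lbwd p (Θ (u x)) (Θ (u (x + (π - ε)))) := fun x => by
    have := hfar _ _ (hζ x).1 (hζ x).2
    rwa [hback] at this
  have hεne := hε.ne'
  refine ⟨hu.lip, hu.per, hu.shift, fun x => ?_, fun x => (hfar' x).1, fun x => (hfar' x).2,
    fun x => ?_⟩
  · have := hsin x
    rw [← Real.sin_pi_sub] at this
    convert! this using 2
    rw [← hback (u (x + (π - ε)))]
    ring
  · obtain ⟨y, hyd⟩ : ∃ y, y = x + (π - ε) := ⟨_, rfl⟩
    obtain ⟨a, b, b', ha, hb, hb', hel⟩ := hu.el y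
    have hyx : y - (π - ε) = x := by rw [hyd]; ring
    rw [hyx] at hb'
    rw [← hyd]
    have hX : u y - ε * (1 - (u (y + (π - ε)) - u y - (π - ε)) / ε) = u (y + (π - ε)) - π := by
      field_simp
      ring
    have hX' : u x - ε * (1 - (u y - u x - (π - ε)) / ε) = u y - π := by
      field_simp
      ring
    simp only [h.genH_eq] at ha hb hb'
    have hsin' := hsin x
    rw [← hyd] at hsin'
    have ha' := (hasDerivAt_angGen (t := u y) hp (h.derivΘ (u y))
      ((h.derivΘ (u y - ε * (1 - (u (y + (π - ε)) - u y - (π - ε)) / ε))).comp_sub_const (u y)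
        (ε * (1 - (u (y + (π - ε)) - u y - (π - ε)) / ε)))
      (by rw [hX]; exact (hsin y).ne')).const_mul (ε * c)
    have hlin : ∀ v s : ℝ, HasDerivAt (fun t : ℝ => v - ε * (1 - t)) ε s := fun v s => by
      simpa using (((hasDerivAt_id s).const_sub 1).const_mul ε).const_sub v
    have hb1 := (hasDerivAt_angGen (t := (u (y + (π - ε)) - u y - (π - ε)) / ε) hp
      (hasDerivAt_const _ (Θ (u y))) ((h.derivΘ _).comp _ (hlin (u y) _))
      (by simp only [Function.comp]; rw [hX]; exact (hsin y).ne')).const_mul (ε * c)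
    have hb1' := (hasDerivAt_angGen (t := (u y - u x - (π - ε)) / ε) hp
      (hasDerivAt_const _ (Θ (u x))) ((h.derivΘ _).comp _ (hlin (u x) _))
      (by simp only [Function.comp]; rw [hX']; exact hsin'.ne')).const_mul (ε * c)
    have ea := ha.unique ha'
    have eb := hb.unique hb1
    have eb' := hb'.unique hb1'
    simp only [Function.comp, hX, hX', hback] at ea eb eb'
    have hper : p (Θ (u y - π)) = p (Θ (u y) + π) := by
      rw [← h.per, ← hback (u y)]
      congr 1
      ring
    rw [hper] at eb'
    have hfy := (hfar' y).1
    have hbx := (hfar' x).2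
    rw [← hyd] at hbx
    have hw := h.width (Θ (u y))
    have hc := h.cpos
    rw [ea, eb, eb'] at hel
    have hzero : ε ^ 2 * c * (c * (p (Θ (u y)) + p (Θ (u y) + π)) ^ 2) / 2 *
        (lbwd p (Θ (u x)) (Θ (u y)) ^ 2 - lfwd p (Θ (u y)) (Θ (u (y + (π - ε)))) ^ 2) = 0 := by
      linear_combination hel
    have := (mul_eq_zero.1 hzero).resolve_left (by positivity)
    exact (pow_left_inj₀ (by linarith) (by linarith) two_ne_zero).1 (by linarith)

end DualBilliard

namespace DualBilliard

open Filter Topology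

lemma exists_log_of_nullhomotopic {X : Type*} [TopologicalSpace X] {K : Set (ℝ × ℝ)}
    {f : C(X, (Kᶜ : Set (ℝ × ℝ)))} (hf : f.Nullhomotopic) {c : ℝ × ℝ} (hc : c ∈ K) :
    ∃ L : C(X, ℂ), ∀ x, Complex.exp (L x) =
      (((f x : ℝ × ℝ).1 - c.1 : ℝ) : ℂ) + (((f x : ℝ × ℝ).2 - c.2 : ℝ) : ℂ) * Complex.I := by
  let j : C((Kᶜ : Set (ℝ × ℝ)), {z : ℂ // z ≠ 0}) :=
    ⟨fun w => ⟨(((w : ℝ × ℝ).1 - c.1 : ℝ) : ℂ) + (((w : ℝ × ℝ).2 - c.2 : ℝ) : ℂ) * Complex.I,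
      fun h0 => w.2 (by
        have h1 := congrArg Complex.re h0
        have h2 := congrArg Complex.im h0
        simp only [Complex.add_re, Complex.mul_re, Complex.ofReal_re, Complex.I_re, mul_zero,
          Complex.ofReal_im, Complex.I_im, mul_one, sub_zero, add_zero, Complex.zero_re,
          Complex.add_im, Complex.mul_im, zero_add, Complex.zero_im, sub_eq_zero] at h1 h2
        have : (w : ℝ × ℝ) = c := Prod.ext h1 h2
        rwa [this])⟩, by fun_prop⟩
  obtain ⟨y, hy⟩ := hf.comp_right j
  obtain ⟨H⟩ := hy.symm
  let L₀ : C(X, ℂ) := ContinuousMap.const X (Complex.log y)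
  have h0 : ∀ a, H.toContinuousMap (0, a) =
      (fun z : ℂ => (⟨_, z.exp_ne_zero⟩ : {z : ℂ // z ≠ 0})) (L₀ a) := fun a => by
    have := H.apply_zero a
    refine this.trans (Subtype.ext ?_)
    exact (Complex.exp_log y.2).symm
  let F := Complex.isCoveringMap_exp.liftHomotopy H.toContinuousMap L₀ h0
  have hF := Complex.isCoveringMap_exp.liftHomotopy_lifts H.toContinuousMap L₀ h0
  refine ⟨F.comp ⟨fun x => (1, x), by fun_prop⟩, fun x => ?_⟩
  have h1 := congrArg Subtype.val (congrFun hF (1, x))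
  have h2 := congrArg Subtype.val (H.apply_one x)
  exact h1.trans h2

lemma eq_of_exp_eq_one {D : ℝ → ℂ} (hD : Continuous D) (h : ∀ x, Complex.exp (D x) = 1)
    (x y : ℝ) : D x = D y :=
  Complex.isCoveringMap_exp.const_of_comp hD
    (fun a b => Subtype.ext ((h a).trans (h b).symm)) x y

lemma foot_add_lfwd (p : ℝ → ℝ) {a b : ℝ} (hs : Real.sin (b - a) ≠ 0) :
    foot p a + lfwd p a b • tang a = foot p b - lbwd p a b • tang b := by
  have e := Real.sin_sub b a
  have e' := Real.cos_sub b a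
  have ha := Real.sin_sq_add_cos_sq a
  have hb := Real.sin_sq_add_cos_sq b
  unfold foot lfwd lbwd tang
  ext
  · simp only [Prod.fst_add, Prod.smul_fst, smul_eq_mul, Prod.fst_sub]
    field_simp
    rw [e, e']
    linear_combination (p a * Real.sin b) * ha + (p b * Real.sin a) * hb
  · simp only [Prod.snd_add, Prod.smul_snd, smul_eq_mul, Prod.snd_sub]
    field_simp
    rw [e, e']
    linear_combination (-p a * Real.cos b) * ha - (p b * Real.cos a) * hb

/-- The point of the curve `u` with parameter `x`. -/
noncomputable def curvePt (p Θ u : ℝ → ℝ) (α x : ℝ) : ℝ × ℝ :=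
  foot p (Θ (u x)) + lfwd p (Θ (u x)) (Θ (u (x + α))) • tang (Θ (u x))

lemma strictMono_of_near_id {u : ℝ → ℝ} (h : ∀ x y, |u y - u x - (y - x)| ≤ |y - x| / 4) :
    StrictMono u := fun x y hxy => by
  have := abs_le.1 (h x y)
  rw [abs_of_pos (sub_pos.2 hxy)] at this
  linarith

lemma continuous_of_near_id {u : ℝ → ℝ} (h : ∀ x y, |u y - u x - (y - x)| ≤ |y - x| / 4) :
    Continuous u := by
  have : LipschitzWith 2 u := LipschitzWith.of_dist_le_mul fun x y => by
    rw [Real.dist_eq, Real.dist_eq]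
    have h1 := h y x
    have h2 := abs_add_le (u x - u y - (x - y)) (x - y)
    rw [sub_add_cancel] at h2
    push_cast
    linarith [abs_nonneg (x - y)]
  exact this.continuous

namespace TCurve

variable {K : Set (ℝ × ℝ)} {p Θ u : ℝ → ℝ} {c Λ ε : ℝ} {Φ : ℝ × ℝ → ℝ × ℝ}

lemma curvePt_eq (hu : TCurve p Θ Λ ε u) (x : ℝ) : curvePt p Θ u (π - ε) x =
    foot p (Θ (u (x + (π - ε)))) -
      lbwd p (Θ (u x)) (Θ (u (x + (π - ε)))) • tang (Θ (u (x + (π - ε)))) :=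
  foot_add_lfwd p (hu.sinPos x).ne'

lemma apply_curvePt (hu : TCurve p Θ Λ ε u) (h : Body K p) (hΦ : IsDualBilliard K p Φ)
    (hΛ : 0 ≤ Λ) (x : ℝ) :
    Φ (curvePt p Θ u (π - ε) x) = curvePt p Θ u (π - ε) (x + (π - ε)) := by
  rw [hu.curvePt_eq, hΦ.apply h (hΛ.trans_lt (hu.bigBwd x)), curvePt, hu.reflect]

lemma curvePt_notMem (hu : TCurve p Θ Λ ε u) (h : Body K p) (hΛ : 0 ≤ Λ) (x : ℝ) :
    curvePt p Θ u (π - ε) x ∉ K :=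
  h.notMem (hΛ.trans_lt (hu.bigFwd x)).ne'

lemma angle_add (hu : TCurve p Θ Λ ε u) (hc : Coord p Θ c) (x : ℝ) (k : ℤ) :
    Θ (u (x + k * (2 * π))) = Θ (u x) + k * (2 * π) := by
  have key : ∀ (n : ℕ) x, Θ (u (x + n * (2 * π))) = Θ (u x) + n * (2 * π) := by
    intro n
    induction n with
    | zero => simp
    | succ n ih =>
      intro x
      have : x + (n + 1 : ℕ) * (2 * π) = x + n * (2 * π) + 2 * π := by push_cast; ring
      rw [this, hu.per, hc.perΘ', ih]
      push_cast
      ring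
  obtain ⟨n, rfl | rfl⟩ := k.eq_nat_or_neg
  · exact_mod_cast key n x
  · have := key n (x + -n * (2 * π))
    rw [show x + -n * (2 * π) + n * (2 * π) = x by ring] at this
    push_cast
    linarith

lemma continuous_angle (hu : TCurve p Θ Λ ε u) (hc : Coord p Θ c) :
    Continuous fun x => Θ (u x) :=
  hc.contDiff.continuous.comp (continuous_of_near_id hu.lip)

lemma continuous_curvePt (hu : TCurve p Θ Λ ε u) (hc : Coord p Θ c) :
    Continuous (curvePt p Θ u (π - ε)) := by
  have h1 := hu.continuous_angle hc
  have h2 : Continuous fun x => Θ (u (x + (π - ε))) := h1.comp (by fun_prop)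
  have h3 := hc.smooth.continuous
  have h4 : Continuous (deriv p) := hc.smooth.continuous_deriv (by norm_num)
  have key : ∀ θ θ' : ℝ → ℝ, Continuous θ → Continuous θ' →
      (∀ x, Real.sin (θ' x - θ x) ≠ 0) →
      Continuous fun x => foot p (θ x) + lfwd p (θ x) (θ' x) • tang (θ x) := by
    intro θ θ' hθ hθ' hne
    unfold foot lfwd tang
    fun_prop (disch := assumption)
  exact key _ _ h1 h2 fun x => (hu.sinPos x).ne'

lemma curvePt_periodic (hu : TCurve p Θ Λ ε u) (h : Body K p) (hc : Coord p Θ c) :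
    Function.Periodic (curvePt p Θ u (π - ε)) (2 * π) := fun x => by
  have h1 := hu.angle_add hc x 1
  have h2 := hu.angle_add hc (x + (π - ε)) 1
  rw [add_right_comm] at h2
  rw [Int.cast_one, one_mul] at h1 h2
  have h3 := h.foot_add_int (Θ (u x)) 1
  have h4 := Body.tang_add_int (Θ (u x)) 1
  rw [Int.cast_one, one_mul] at h3 h4
  have h5 : lfwd p (Θ (u x) + 2 * π) (Θ (u (x + (π - ε))) + 2 * π) =
      lfwd p (Θ (u x)) (Θ (u (x + (π - ε)))) := by
    unfold lfwd
    rw [h.periodic, h.periodic, periodic_deriv h.periodic, add_sub_add_right_eq_sub]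
  unfold curvePt
  rw [h1, h2, h3, h4, h5]

lemma curvePt_inj (hu : TCurve p Θ Λ ε u) (h : Body K p) (hc : Coord p Θ c) (hΛ : 0 ≤ Λ)
    {x y : ℝ} (he : curvePt p Θ u (π - ε) x = curvePt p Θ u (π - ε) y) :
    ∃ k : ℤ, y = x + k * (2 * π) := by
  obtain ⟨k, hk⟩ := h.tangent_unique
    (mul_pos (hΛ.trans_lt (hu.bigFwd x)) (hΛ.trans_lt (hu.bigFwd y))) he
  rw [← hu.angle_add hc] at hk
  exact ⟨k, (hc.strictMono.comp (strictMono_of_near_id hu.lip)).injective hk⟩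

lemma dot_tang_le (h : Body K p) {w : ℝ × ℝ} (hw : w ∈ K) {M : ℝ} (hM : ∀ θ, |p θ| ≤ M)
    (hM' : ∀ θ, |deriv p θ| ≤ M) (θ l : ℝ) :
    l - 2 * M ≤ ((foot p θ + l • tang θ).1 - w.1) * -Real.sin θ +
      ((foot p θ + l • tang θ).2 - w.2) * Real.cos θ := by
  have h1 := (h.le_supp hw (θ + π / 2)).trans ((le_abs_self _).trans (hM _))
  rw [Real.cos_add_pi_div_two, Real.sin_add_pi_div_two] at h1
  have h2 := (abs_le.1 (hM' θ)).1
  simp only [foot, tang, Prod.fst_add, Prod.snd_add, Prod.smul_fst, Prod.smul_snd, smul_eq_mul]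
  have h3 : (p θ * Real.cos θ - deriv p θ * Real.sin θ + l * -Real.sin θ) * -Real.sin θ +
      (p θ * Real.sin θ + deriv p θ * Real.cos θ + l * Real.cos θ) * Real.cos θ =
      deriv p θ + l := by
    linear_combination (deriv p θ + l) * Real.sin_sq_add_cos_sq θ
  nlinarith

theorem dbInvCircle (hu : TCurve p Θ Λ ε u) (h : Body K p) (hc : Coord p Θ c)
    (hΦ : IsDualBilliard K p Φ) {M : ℝ} (hM0 : 0 ≤ M) (hM : ∀ θ, |p θ| ≤ M)
    (hM' : ∀ θ, |deriv p θ| ≤ M) (hΛ : 2 * M ≤ Λ) :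
    DBInvCircle K Φ (Set.range (curvePt p Θ u (π - ε))) := by
  have hΛ0 : 0 ≤ Λ := by linarith
  have : Fact (0 < 2 * π) := ⟨Real.two_pi_pos⟩
  let zs : ℝ → (Kᶜ : Set (ℝ × ℝ)) :=
    fun x => ⟨curvePt p Θ u (π - ε) x, hu.curvePt_notMem h hΛ0 x⟩
  have hzs : Continuous zs := (hu.continuous_curvePt hc).subtype_mk _
  have hzp : Function.Periodic zs (2 * π) := fun x => Subtype.ext (hu.curvePt_periodic h hc x)
  let ℓ : C(AddCircle (2 * π), (Kᶜ : Set (ℝ × ℝ))) :=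
    ⟨hzp.lift, continuous_coinduced_dom.2 hzs⟩
  have hℓ : ∀ x : ℝ, ℓ (x : AddCircle (2 * π)) = zs x := fun x => rfl
  have hrange : Set.range (curvePt p Θ u (π - ε)) = Subtype.val '' Set.range ℓ := by
    ext w
    constructor
    · rintro ⟨x, rfl⟩
      exact ⟨zs x, ⟨x, hℓ x⟩, rfl⟩
    · rintro ⟨-, ⟨a, rfl⟩, rfl⟩
      obtain ⟨x, rfl⟩ := QuotientAddGroup.mk_surjective a
      exact ⟨x, rfl⟩
  refine ⟨?_, ?_, ?_, ℓ, ?_, ?_, hrange⟩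
  · rintro - ⟨x, rfl⟩
    exact hu.curvePt_notMem h hΛ0 x
  · rw [hrange]
    exact (isCompact_range ℓ.continuous).image continuous_subtype_val
  · ext w
    constructor
    · rintro ⟨-, ⟨x, rfl⟩, rfl⟩
      exact ⟨_, (hu.apply_curvePt h hΦ hΛ0 x).symm⟩
    · rintro ⟨x, rfl⟩
      refine ⟨_, ⟨x - (π - ε), rfl⟩, ?_⟩
      rw [hu.apply_curvePt h hΦ hΛ0, sub_add_cancel]
  · intro a b hab
    obtain ⟨x, rfl⟩ := QuotientAddGroup.mk_surjective a
    obtain ⟨y, rfl⟩ := QuotientAddGroup.mk_surjective b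
    obtain ⟨k, rfl⟩ := hu.curvePt_inj h hc hΛ0 (congrArg Subtype.val hab)
    have : ((x + k * (2 * π) : ℝ) : AddCircle (2 * π)) = x := by
      have h0 : ((k * (2 * π) : ℝ) : AddCircle (2 * π)) = 0 :=
        (AddCircle.coe_eq_zero_iff _).2 ⟨k, by simp⟩
      rw [AddCircle.coe_add, h0, add_zero]
    exact this.symm
  · intro hnull
    obtain ⟨w, hw⟩ := h.interior_nonempty.mono interior_subset
    obtain ⟨L, hL⟩ := exists_log_of_nullhomotopic hnull hw
    let θ : ℝ → ℝ := fun x => Θ (u x)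
    let z : ℝ → ℝ × ℝ := curvePt p Θ u (π - ε)
    let B : ℝ → ℝ := fun x => ((z x).1 - w.1) * -Real.sin (θ x) + ((z x).2 - w.2) * Real.cos (θ x)
    let A : ℝ → ℝ := fun x => ((z x).1 - w.1) * Real.cos (θ x) + ((z x).2 - w.2) * Real.sin (θ x)
    have hz : Continuous z := hu.continuous_curvePt hc
    have hθ : Continuous θ := hu.continuous_angle hc
    have hB : ∀ x, 0 < B x := fun x => by
      have := dot_tang_le h hw hM hM' (θ x) (lfwd p (Θ (u x)) (Θ (u (x + (π - ε)))))
      have h2 := hu.bigFwd x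
      refine lt_of_lt_of_le ?_ this
      linarith
    let q : ℝ → ℂ := fun x => (B x : ℂ) - A x * Complex.I
    have hq : ∀ x, q x ∈ Complex.slitPlane := fun x => Or.inl (by simpa [q] using hB x)
    have hqc : Continuous q := by
      simp only [q, A, B]
      fun_prop
    let D : ℝ → ℂ := fun x => L (x : AddCircle (2 * π)) -
      ((θ x + π / 2 : ℝ) * Complex.I + Complex.log (q x))
    have hD : Continuous D := by
      have h1 : Continuous fun x : ℝ => L (x : AddCircle (2 * π)) :=
        L.continuous.comp (AddCircle.continuous_mk' _)
      have h2 : Continuous fun x => Complex.log (q x) := hqc.clog hq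
      exact h1.sub ((by fun_prop : Continuous fun x => ((θ x + π / 2 : ℝ) : ℂ) * Complex.I).add h2)
    have hexp : ∀ x, Complex.exp (D x) = 1 := fun x => by
      have hq0 : q x ≠ 0 := Complex.slitPlane_ne_zero (hq x)
      rw [Complex.exp_sub, Complex.exp_add, Complex.exp_log hq0, hL, hℓ, Complex.exp_mul_I,
        ← Complex.ofReal_cos, ← Complex.ofReal_sin, Real.cos_add_pi_div_two,
        Real.sin_add_pi_div_two, div_eq_one_iff_eq]
      · have hcs := Real.sin_sq_add_cos_sq (θ x)
        apply Complex.ext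
        · simp [q, A, B, zs, -Complex.ofReal_sin, -Complex.ofReal_cos]
          change (z x).1 - w.1 = _
          linear_combination (-((z x).1 - w.1)) * hcs
        · simp [q, A, B, zs, -Complex.ofReal_sin, -Complex.ofReal_cos]
          change (z x).2 - w.2 = _
          linear_combination (-((z x).2 - w.2)) * hcs
      · refine mul_ne_zero (fun h0 => ?_) hq0
        have h1 := congrArg Complex.re h0
        have h2 := congrArg Complex.im h0
        simp [-Complex.ofReal_sin, -Complex.ofReal_cos] at h1 h2
        have := Real.sin_sq_add_cos_sq (θ x)
        rw [h1, h2] at this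
        norm_num at this
    have h2π := eq_of_exp_eq_one hD hexp (0 + 2 * π) 0
    have hθ2 : θ (0 + 2 * π) = θ 0 + 2 * π := by
      simp only [θ, hu.per, hc.perΘ']
    have hz2 : z (0 + 2 * π) = z 0 := hu.curvePt_periodic h hc 0
    have hq2 : q (0 + 2 * π) = q 0 := by
      simp only [q, A, B, hθ2, hz2, Real.cos_add_two_pi, Real.sin_add_two_pi]
    have hL2 : ((0 + 2 * π : ℝ) : AddCircle (2 * π)) = (0 : ℝ) := by
      rw [zero_add, AddCircle.coe_period]
      rfl
    simp only [D, hq2, hθ2, hL2] at h2π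
    have h3 := congrArg Complex.im h2π
    simp at h3

lemma lt_hausdorffDist (hu : TCurve p Θ Λ ε u) (h : Body K p)
    {M : ℝ} (hM : ∀ θ, |p θ| ≤ M) (hM' : ∀ θ, |deriv p θ| ≤ M) {N : ℝ}
    (hΛ : 2 * M + 2 * N ≤ Λ) (hcomp : IsCompact (Set.range (curvePt p Θ u (π - ε)))) :
    N < Metric.hausdorffDist (Set.range (curvePt p Θ u (π - ε))) (frontier K) := by
  have hne : K.Nonempty := h.interior_nonempty.mono interior_subset
  have hfK : frontier K ⊆ K := h.compact.isClosed.frontier_subset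
  have hfne : (frontier K).Nonempty :=
    nonempty_frontier_iff.2 ⟨hne, fun hK => noncompact_univ (ℝ × ℝ) (hK ▸ h.compact)⟩
  obtain ⟨x⟩ : Nonempty ℝ := ⟨0⟩
  have hfin := Metric.hausdorffEDist_ne_top_of_nonempty_of_bounded
    (Set.range_nonempty (curvePt p Θ u (π - ε))) hfne hcomp.isBounded
    (h.compact.isBounded.subset hfK)
  refine lt_of_lt_of_le ?_ (Metric.infDist_le_hausdorffDist_of_mem (Set.mem_range_self x) hfin)
  obtain ⟨l, hl⟩ : ∃ l, l = lfwd p (Θ (u x)) (Θ (u (x + (π - ε)))) := ⟨_, rfl⟩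
  have hlΛ : Λ < l := hl ▸ hu.bigFwd x
  have : (l - 2 * M) / 2 ≤ Metric.infDist (curvePt p Θ u (π - ε) x) (frontier K) := by
    refine (Metric.le_infDist hfne).2 fun w hw => ?_
    have h1 := dot_tang_le h (hfK hw) hM hM' (Θ (u x)) l
    rw [hl] at h1
    change _ ≤ ((curvePt p Θ u (π - ε) x).1 - w.1) * _ +
      ((curvePt p Θ u (π - ε) x).2 - w.2) * _ at h1
    rw [← hl] at h1
    have hd1 : |(curvePt p Θ u (π - ε) x).1 - w.1| ≤ dist (curvePt p Θ u (π - ε) x) w := by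
      rw [Prod.dist_eq, ← Real.dist_eq]
      exact le_max_left _ _
    have hd2 : |(curvePt p Θ u (π - ε) x).2 - w.2| ≤ dist (curvePt p Θ u (π - ε) x) w := by
      rw [Prod.dist_eq, ← Real.dist_eq]
      exact le_max_right _ _
    have aux : ∀ a b d : ℝ, |a| ≤ d → |b| ≤ 1 → a * b ≤ d := fun a b d ha hb =>
      (le_abs_self _).trans ((abs_mul a b).trans_le (by nlinarith [abs_nonneg a, abs_nonneg b]))
    have h3 := aux _ (-Real.sin (Θ (u x))) _ hd1 (by
      rw [abs_neg]; exact Real.abs_sin_le_one _)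
    have h4 := aux _ (Real.cos (Θ (u x))) _ hd2 (Real.abs_cos_le_one _)
    linarith
  linarith

end TCurve

end DualBilliard

namespace DualBilliard

open Filter Topology

/-- A lift of a circle homeomorphism that is bi-Lipschitz close to a translation. -/
structure NearId (u : ℝ → ℝ) : Prop where
  lip : ∀ x y, |u y - u x - (y - x)| ≤ |y - x| / 4
  per : ∀ x, u (x + 2 * π) = u x + 2 * π

namespace NearId

variable {u u' : ℝ → ℝ}

lemma bounds (h : NearId u) {x y : ℝ} (hxy : x ≤ y) :
    3 / 4 * (y - x) ≤ u y - u x ∧ u y - u x ≤ 5 / 4 * (y - x) := by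
  have := abs_le.1 (h.lip x y)
  rw [abs_of_nonneg (sub_nonneg.2 hxy)] at this
  constructor <;> linarith

lemma surjective (h : NearId u) : Function.Surjective u := fun y => by
  obtain ⟨R, hR⟩ : ∃ R, R = |y - u 0| / (3 / 4) := ⟨_, rfl⟩
  have hR0 : 0 ≤ R := by rw [hR]; positivity
  have hR' : |y - u 0| = 3 / 4 * R := by rw [hR]; ring
  have h1 := (h.bounds hR0).1
  have h2 := (h.bounds (neg_nonpos.2 hR0)).1
  have h3 := abs_le.1 hR'.le
  exact mem_range_of_exists_le_of_exists_ge (continuous_of_near_id h.lip)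
    ⟨-R, by linarith⟩ ⟨R, by linarith⟩

lemma apply_inv (h : NearId u) (x : ℝ) : u (Function.invFun u x) = x :=
  Function.rightInverse_invFun h.surjective x

lemma inv_apply (h : NearId u) (x : ℝ) : Function.invFun u (u x) = x :=
  Function.leftInverse_invFun (strictMono_of_near_id h.lip).injective x

lemma inv_mono (h : NearId u) : Monotone (Function.invFun u) := fun x y hxy => by
  by_contra! hlt
  have := strictMono_of_near_id h.lip hlt
  rw [h.apply_inv, h.apply_inv] at this
  linarith

lemma inv_bounds (h : NearId u) {x y : ℝ} (hxy : x ≤ y) :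
    4 / 5 * (y - x) ≤ Function.invFun u y - Function.invFun u x ∧
      Function.invFun u y - Function.invFun u x ≤ 4 / 3 * (y - x) := by
  have := h.bounds (h.inv_mono hxy)
  rw [h.apply_inv, h.apply_inv] at this
  constructor <;> linarith

lemma inv_abs (h : NearId u) (x y : ℝ) :
    |Function.invFun u y - Function.invFun u x| ≤ 4 / 3 * |y - x| := by
  rcases le_total x y with hxy | hxy
  · rw [abs_of_nonneg (sub_nonneg.2 hxy), abs_of_nonneg (sub_nonneg.2 (h.inv_mono hxy))]
    exact (h.inv_bounds hxy).2
  · rw [abs_sub_comm, abs_sub_comm y, abs_of_nonneg (sub_nonneg.2 hxy),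
      abs_of_nonneg (sub_nonneg.2 (h.inv_mono hxy))]
    exact (h.inv_bounds hxy).2

lemma abs_bound (h : NearId u) (x y : ℝ) : |u y - u x| ≤ 5 / 4 * |y - x| := by
  have h1 := h.lip x y
  have h2 := abs_add_le (u y - u x - (y - x)) (y - x)
  rw [sub_add_cancel] at h2
  linarith

lemma lipschitz_inv (h : NearId u) : LipschitzWith (4 / 3) (Function.invFun u) :=
  LipschitzWith.of_dist_le_mul fun x y => by
    rw [Real.dist_eq, Real.dist_eq]
    push_cast
    exact h.inv_abs y x

lemma inv_per (h : NearId u) (x : ℝ) :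
    Function.invFun u (x + 2 * π) = Function.invFun u x + 2 * π := by
  apply (strictMono_of_near_id h.lip).injective
  rw [h.apply_inv, h.per, h.apply_inv]

lemma continuous (h : NearId u) : Continuous u := continuous_of_near_id h.lip

end NearId

/-- The circle map conjugated by `u` to the translation by `α`. -/
noncomputable def conjShift (u : ℝ → ℝ) (α x : ℝ) : ℝ := u (Function.invFun u x + α)

lemma NearId.continuous_conjShift {u : ℝ → ℝ} (h : NearId u) (α : ℝ) :
    Continuous (conjShift u α) :=
  h.continuous.comp (h.lipschitz_inv.continuous.add_const α)

/-- Under a map with Lipschitz inverse, Lebesgue integrals over images are controlled. -/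
lemma lintegral_comp_le {u v : ℝ → ℝ} {C : NNReal} (hu : Measurable u) (hv : LipschitzWith C v)
    (huv : ∀ x, v (u x) = x) (F : ℝ → ENNReal) (hF : Measurable F) (s : Set ℝ)
    (hs : MeasurableSet s) : ∫⁻ ζ in u ⁻¹' s, F (u ζ) ≤ C * ∫⁻ x in s, F x := by
  have hle : Measure.map u volume ≤ (C : ENNReal) • (volume : Measure ℝ) := by
    refine Measure.le_iff.2 fun t ht => ?_
    rw [Measure.map_apply hu ht, Measure.smul_apply, smul_eq_mul]
    have hsub : u ⁻¹' t ⊆ v '' t := fun x hx => ⟨u x, hx, huv x⟩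
    refine (measure_mono hsub).trans ?_
    have := hv.hausdorffMeasure_image_le (d := 1) zero_le_one t
    rw [hausdorffMeasure_real] at this
    simpa using this
  rw [← setLIntegral_map hs hF hu, ← smul_eq_mul, ← lintegral_smul_measure,
    ← Measure.restrict_smul]
  exact lintegral_mono' (Measure.restrict_mono le_rfl hle) le_rfl

/-- A nonnegative Lipschitz function with small integral is small. -/
lemma le_of_integral_le {φ : ℝ → ℝ} {L δ t : ℝ} (hφ : Continuous φ) (h0 : ∀ x, 0 ≤ φ x)
    (hL : ∀ x y, |φ y - φ x| ≤ L * |y - x|) (hL0 : 0 ≤ L) (hδ : 0 < δ) (hδ1 : δ ≤ 1)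
    (hint : ∫ x in t..t + 2 * π, φ x = 2 * π * δ) : φ t ≤ (2 * π + L) * √δ := by
  obtain ⟨w, hwd⟩ : ∃ w, w = √δ := ⟨_, rfl⟩
  have hw : 0 < w := hwd ▸ Real.sqrt_pos.2 hδ
  have hw1 : w ≤ 1 := hwd ▸ (Real.sqrt_le_one.2 hδ1)
  have hww : δ = w * w := by rw [hwd, Real.mul_self_sqrt hδ.le]
  have hpi := Real.pi_gt_three
  have h1 : ∫ x in t..t + w, φ x ≤ ∫ x in t..t + 2 * π, φ x :=
    intervalIntegral.integral_mono_interval le_rfl (by linarith) (by linarith)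
      (Eventually.of_forall h0) (hφ.intervalIntegrable _ _)
  have h2 : ∫ _ in t..t + w, (φ t - L * w) ≤ ∫ x in t..t + w, φ x := by
    refine intervalIntegral.integral_mono_on (by linarith) (by simp) (hφ.intervalIntegrable _ _)
      fun x hx => ?_
    have h3 := (abs_le.1 (hL t x)).1
    rw [abs_of_nonneg (by linarith [hx.1])] at h3
    nlinarith [hx.2]
  rw [intervalIntegral.integral_const, smul_eq_mul, add_sub_cancel_left] at h2
  rw [← hwd]
  have h3 : w * (φ t - L * w) ≤ w * (2 * π * w) := by
    rw [hint, hww] at h1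
    linarith
  have := le_of_mul_le_mul_left h3 hw
  linarith

/-- Comparison of two disjoint conjugated translations. -/
theorem conjShift_compare {u u' : ℝ → ℝ} (hu : NearId u) (hu' : NearId u') {α α' : ℝ}
    (hα : α' < α) (hne : ∀ x, conjShift u α x ≠ conjShift u' α' x) :
    (∀ x, conjShift u' α' x < conjShift u α x) ∧
    ENNReal.ofReal (α - α') ≤
      ∫⁻ x in Set.Ico 0 (2 * π), ENNReal.ofReal (conjShift u α x - conjShift u' α' x) ∧
    (α - α' ≤ 1 → ∀ x, conjShift u α x - conjShift u' α' x ≤ 20 * √(α - α')) := by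
  obtain ⟨v, hv⟩ : ∃ v, v = Function.invFun u := ⟨_, rfl⟩
  obtain ⟨δ, hδ⟩ : ∃ δ, δ = α - α' := ⟨_, rfl⟩
  have hδ0 : 0 < δ := by rw [hδ]; linarith
  have hvc : Continuous v := hv ▸ hu.lipschitz_inv.continuous
  have hf := hu.continuous_conjShift α
  have hf' := hu'.continuous_conjShift α'
  have hvmono : StrictMono v := by
    rw [hv]
    intro x y hxy
    have := (hu.inv_bounds hxy.le).1
    linarith
  let φ : ℝ → ℝ := fun ζ => v (u' ζ) + α - v (u' (ζ + α'))
  have hφc : Continuous φ := by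
    have := hu'.continuous
    fun_prop
  have hφ : ∀ ζ, φ ζ = v (conjShift u α (u' ζ)) - v (conjShift u' α' (u' ζ)) := fun ζ => by
    simp only [φ, conjShift, hv, hu.inv_apply, hu'.inv_apply]
  have hφint : ∀ t, ∫ x in t..t + 2 * π, φ x = 2 * π * δ := fun t => by
    let m : ℝ → ℝ := fun ζ => v (u' ζ) - ζ
    have hmc : Continuous m := by
      have := hu'.continuous
      fun_prop
    have hmp : Function.Periodic m (2 * π) := fun x => by
      simp only [m, hu'.per, hv, hu.inv_per]
      ring
    have e : φ = fun ζ => m ζ - m (ζ + α') + δ := by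
      funext ζ
      simp only [φ, m, hδ]
      ring
    have hmc' : Continuous fun ζ => m (ζ + α') := by fun_prop
    rw [e]
    rw [intervalIntegral.integral_add (f := fun ζ => m ζ - m (ζ + α')) (g := fun _ => δ)
      ((hmc.sub hmc').intervalIntegrable _ _) (by simp),
      intervalIntegral.integral_sub (hmc.intervalIntegrable _ _) (hmc'.intervalIntegrable _ _),
      intervalIntegral.integral_comp_add_right m α', add_right_comm,
      hmp.intervalIntegral_add_eq (t + α') t, sub_self, intervalIntegral.integral_const]
    simp
  have hpos : ∀ x, conjShift u' α' x < conjShift u α x := by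
    by_contra! hcon
    obtain ⟨x₀, hx₀⟩ := hcon
    have hall : ∀ x, conjShift u α x ≤ conjShift u' α' x := by
      by_contra! hcon
      obtain ⟨y₀, hy₀⟩ := hcon
      obtain ⟨w, hw⟩ := mem_range_of_exists_le_of_exists_ge (c := (0 : ℝ)) (hf.sub hf')
        ⟨x₀, by simpa using hx₀⟩ ⟨y₀, by simpa using hy₀.le⟩
      exact hne w (sub_eq_zero.1 hw)
    have h1 : 0 ≤ ∫ x in (0 : ℝ)..0 + 2 * π, -φ x :=
      intervalIntegral.integral_nonneg (by linarith [Real.pi_pos]) fun x _ => by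
        rw [hφ]
        linarith [hvmono.monotone (hall (u' x))]
    rw [intervalIntegral.integral_neg] at h1
    rw [hφint] at h1
    have : 0 < 2 * π * δ := by positivity
    linarith
  have hbd : ∀ ζ, 4 / 5 * (conjShift u α (u' ζ) - conjShift u' α' (u' ζ)) ≤ φ ζ ∧
      φ ζ ≤ 4 / 3 * (conjShift u α (u' ζ) - conjShift u' α' (u' ζ)) := fun ζ => by
    rw [hφ, hv]
    exact hu.inv_bounds (hpos _).le
  have hφ0 : ∀ ζ, 0 ≤ φ ζ := fun ζ => by linarith [(hbd ζ).1, hpos (u' ζ)]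
  refine ⟨hpos, ?_, fun hδ1 x => ?_⟩
  · have h1 := lintegral_comp_le hu'.continuous.measurable hu'.lipschitz_inv hu'.inv_apply
      (fun x => ENNReal.ofReal (conjShift u α x - conjShift u' α' x))
      (hf.sub hf').measurable.ennreal_ofReal (Set.Ico 0 (2 * π)) measurableSet_Ico
    obtain ⟨t, ht⟩ : ∃ t, t = Function.invFun u' 0 := ⟨_, rfl⟩
    have hpre : u' ⁻¹' Set.Ico 0 (2 * π) = Set.Ico t (t + 2 * π) := by
      have hm := strictMono_of_near_id hu'.lip
      have e1 : u' t = 0 := ht ▸ hu'.apply_inv 0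
      have e2 : u' (t + 2 * π) = 2 * π := by rw [hu'.per, e1, zero_add]
      ext y
      have i1 := hm.le_iff_le (a := t) (b := y)
      have i2 := hm.lt_iff_lt (a := y) (b := t + 2 * π)
      rw [e1] at i1
      rw [e2] at i2
      rw [Set.mem_preimage, Set.mem_Ico, Set.mem_Ico, i1, i2]
    have h2 : ENNReal.ofReal (3 / 4 * (2 * π * δ)) ≤ ∫⁻ ζ in u' ⁻¹' Set.Ico 0 (2 * π),
        ENNReal.ofReal (conjShift u α (u' ζ) - conjShift u' α' (u' ζ)) := by
      rw [hpre, ← hφint t, ← intervalIntegral.integral_const_mul,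
        intervalIntegral.integral_of_le (by linarith [Real.pi_pos]),
        ← integral_Ico_eq_integral_Ioc, ofReal_integral_eq_lintegral_ofReal]
      · refine lintegral_mono fun ζ => ENNReal.ofReal_le_ofReal ?_
        linarith [(hbd ζ).2]
      · exact ((continuous_const.mul hφc).integrableOn_Icc).mono_set Set.Ico_subset_Icc_self
      · exact Eventually.of_forall fun ζ => mul_nonneg (by norm_num) (hφ0 ζ)
    have h3 : ENNReal.ofReal (4 / 3) * ENNReal.ofReal δ ≤ ENNReal.ofReal (3 / 4 * (2 * π * δ)) := by
      rw [← ENNReal.ofReal_mul (by norm_num)]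
      refine ENNReal.ofReal_le_ofReal ?_
      nlinarith [Real.pi_gt_three]
    have h4 : ((4 / 3 : NNReal) : ENNReal) = ENNReal.ofReal (4 / 3) := by
      rw [ENNReal.ofReal]
      congr 1
      ext
      rw [Real.coe_toNNReal _ (by norm_num)]
      norm_num
    rw [h4] at h1
    rw [← hδ]
    exact (ENNReal.mul_le_mul_iff_right (by simp) ENNReal.ofReal_ne_top).1 (h3.trans (h2.trans h1))
  · rw [← hδ] at hδ1 ⊢
    obtain ⟨ζ, rfl⟩ := hu'.surjective x
    have h1 := le_of_integral_le (t := ζ) (L := 10 / 3) hφc hφ0 (fun x y => by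
      have a1 := hu.inv_abs (u' x) (u' y)
      have a2 := hu.inv_abs (u' (x + α')) (u' (y + α'))
      have a3 := hu'.abs_bound x y
      have a4 := hu'.abs_bound (x + α') (y + α')
      rw [add_sub_add_right_eq_sub] at a4
      simp only [φ, hv]
      have e : Function.invFun u (u' y) + α - Function.invFun u (u' (y + α')) -
          (Function.invFun u (u' x) + α - Function.invFun u (u' (x + α'))) =
          (Function.invFun u (u' y) - Function.invFun u (u' x)) -
          (Function.invFun u (u' (y + α')) - Function.invFun u (u' (x + α'))) := by ring
      rw [e]
      refine (abs_sub _ _).trans ?_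
      linarith) (by norm_num) hδ0 hδ1 (hφint ζ)
    have h2 := (hbd ζ).1
    have h3 := Real.sqrt_nonneg δ
    nlinarith [Real.pi_lt_d2]

end DualBilliard

namespace DualBilliard

open Filter Topology

/-- A monotone family of graphs over a circle, indexed by a set of parameters of positive
measure, whose area between consecutive graphs dominates the gap in the parameter, covers a
compact set of positive area. -/
theorem exists_pos_measure_graphs {D : Set ℝ} (hD : IsCompact D) (hD1 : D ⊆ Set.Icc 0 1)
    (hDpos : 0 < volume D) {f : ℝ → ℝ → ℝ} (hf : ∀ ε ∈ D, Continuous (f ε))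
    (hcmp : ∀ a ∈ D, ∀ b ∈ D, a < b → (∀ x, f b x < f a x) ∧
      ENNReal.ofReal (b - a) ≤ ∫⁻ x in Set.Ico 0 (2 * π), ENNReal.ofReal (f a x - f b x) ∧
      ∀ x, f a x - f b x ≤ 20 * √(b - a)) :
    ∃ S : Set (ℝ × ℝ), MeasurableSet S ∧ 0 < volume S ∧
      ∀ q ∈ S, q.1 ∈ Set.Ico 0 (2 * π) ∧ ∃ ε ∈ D, q.2 = f ε q.1 := by
  obtain ⟨P, hP⟩ : ∃ P : Set (ℝ × ℝ), P = D ×ˢ Set.Icc 0 (2 * π) := ⟨_, rfl⟩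
  have hanti : ∀ a ∈ D, ∀ b ∈ D, a ≤ b → ∀ x, f b x ≤ f a x := fun a ha b hb hab x => by
    rcases hab.eq_or_lt with rfl | h
    · rfl
    · exact ((hcmp a ha b hb h).1 x).le
  have hclose : ∀ a ∈ D, ∀ b ∈ D, ∀ x, |f a x - f b x| ≤ 20 * √|a - b| := fun a ha b hb x => by
    rcases lt_trichotomy a b with h | rfl | h
    · rw [abs_of_nonneg (sub_nonneg.2 ((hcmp a ha b hb h).1 x).le), abs_sub_comm,
        abs_of_pos (sub_pos.2 h)]
      exact (hcmp a ha b hb h).2.2 x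
    · simp
    · rw [abs_sub_comm, abs_of_nonneg (sub_nonneg.2 ((hcmp b hb a ha h).1 x).le),
        abs_of_pos (sub_pos.2 h)]
      exact (hcmp b hb a ha h).2.2 x
  have hcont : ContinuousOn (fun q : ℝ × ℝ => f q.1 q.2) P := by
    intro q hq
    rw [hP] at hq
    have hbd : ∀ᶠ z in 𝓝[P] q, |f z.1 z.2 - f q.1 q.2| ≤
        20 * √|z.1 - q.1| + |f q.1 z.2 - f q.1 q.2| := by
      filter_upwards [self_mem_nhdsWithin] with z hz
      rw [hP] at hz
      have h1 := hclose z.1 hz.1 q.1 hq.1 z.2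
      have h2 := abs_sub_le (f z.1 z.2) (f q.1 z.2) (f q.1 q.2)
      linarith
    have hlim : Tendsto (fun z : ℝ × ℝ => 20 * √|z.1 - q.1| + |f q.1 z.2 - f q.1 q.2|)
        (𝓝[P] q) (𝓝 0) := by
      have hc := hf q.1 hq.1
      have : Continuous fun z : ℝ × ℝ => 20 * √|z.1 - q.1| + |f q.1 z.2 - f q.1 q.2| := by
        fun_prop
      refine ((this.tendsto' q 0 (by simp)).mono_left nhdsWithin_le_nhds)
    refine tendsto_iff_dist_tendsto_zero.2 (squeeze_zero' (Eventually.of_forall fun _ =>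
      dist_nonneg) ?_ hlim)
    simpa only [Real.dist_eq] using hbd
  obtain ⟨S, hS⟩ : ∃ S, S = (fun q : ℝ × ℝ => (q.2, f q.1 q.2)) '' P := ⟨_, rfl⟩
  have hScomp : IsCompact S := by
    rw [hS]
    refine IsCompact.image_of_continuousOn ?_ (continuousOn_snd.prodMk hcont)
    rw [hP]
    exact hD.prod isCompact_Icc
  have hthick : ∀ δ, 0 < δ → volume D ≤ volume (Metric.cthickening δ S) := by
    intro δ hδ
    obtain ⟨n, hn⟩ := exists_nat_gt ((20 / δ) ^ 2)
    have hn0 : (0 : ℝ) < n := lt_of_le_of_lt (by positivity) hn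
    have hsq : 20 * √(1 / n) ≤ δ := by
      rw [Real.sqrt_div' _ hn0.le, Real.sqrt_one, mul_one_div, div_le_iff₀ (Real.sqrt_pos.2 hn0),
        ← div_le_iff₀' hδ]
      exact Real.le_sqrt_of_sq_le hn.le
    let I : ℕ → Set ℝ := fun k => Set.Icc (k / n) ((k + 1) / n)
    have hR : ∀ k : ℕ, ∃ R : Set (ℝ × ℝ), MeasurableSet R ∧ volume (D ∩ I k) ≤ volume R ∧
        R ⊆ Metric.cthickening δ S ∧
        ∀ q ∈ R, ∃ a ∈ D ∩ I k, ∃ b ∈ D ∩ I k, f b q.1 < q.2 ∧ q.2 < f a q.1 := by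
      intro k
      rcases (D ∩ I k).eq_empty_or_nonempty with he | hne
      · exact ⟨∅, MeasurableSet.empty, by simp [he], by simp, by simp⟩
      have hc : IsCompact (D ∩ I k) := hD.inter_right isClosed_Icc
      obtain ⟨a, ha, hamin⟩ := hc.exists_isMinOn hne continuousOn_id
      obtain ⟨b, hb, hbmax⟩ := hc.exists_isMaxOn hne continuousOn_id
      have hab : a ≤ b := hamin hb
      have hba : b - a ≤ 1 / n := by
        have h1 := hb.2.2
        have h2 := ha.2.1
        rw [add_div] at h1
        linarith
      refine ⟨regionBetween (f b) (f a) (Set.Ico 0 (2 * π)), measurableSet_regionBetween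
        (hf b hb.1).measurable (hf a ha.1).measurable measurableSet_Ico, ?_, ?_, ?_⟩
      · have h1 : volume (D ∩ I k) ≤ ENNReal.ofReal (b - a) := by
          rw [← Real.volume_Icc]
          exact measure_mono fun x hx => ⟨hamin hx, hbmax hx⟩
        refine h1.trans ?_
        rw [Measure.volume_eq_prod, volume_regionBetween_eq_lintegral
          (hf b hb.1).measurable.aemeasurable (hf a ha.1).measurable.aemeasurable
          measurableSet_Ico]
        rcases hab.eq_or_lt with rfl | h
        · simp
        · exact (hcmp a ha.1 b hb.1 h).2.1
      · intro q hq
        refine Metric.mem_cthickening_of_dist_le q (q.1, f a q.1) δ S ?_ ?_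
        · rw [hS, hP]
          exact ⟨(a, q.1), ⟨ha.1, Set.Ico_subset_Icc_self hq.1⟩, rfl⟩
        · have h1 := hclose a ha.1 b hb.1 q.1
          rw [abs_sub_comm a, abs_of_nonneg (sub_nonneg.2 hab)] at h1
          have h2 := Real.sqrt_le_sqrt hba
          rw [Prod.dist_eq]
          refine max_le (by simpa using hδ.le) ?_
          rw [Real.dist_eq, abs_le]
          have h3 := abs_le.1 h1
          constructor <;> linarith [hq.2.1, hq.2.2]
      · exact fun q hq => ⟨a, ha, b, hb, hq.2.1, hq.2.2⟩
    choose R hRm hRv hRs hRab using hR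
    have hdisj : Pairwise (Function.onFun Disjoint R) := by
      have key : ∀ k l, k < l → Disjoint (R k) (R l) := by
        intro k l hkl
        refine Set.disjoint_left.2 fun q hk hl => ?_
        obtain ⟨-, -, b, hb, hb', -⟩ := hRab k q hk
        obtain ⟨a, ha, -, -, -, ha'⟩ := hRab l q hl
        have h1 : b ≤ a := hb.2.2.trans (le_trans (by
          have : (k : ℝ) + 1 ≤ l := by exact_mod_cast hkl
          gcongr) ha.2.1)
        have h2 := hanti b hb.1 a ha.1 h1 q.1
        linarith
      intro k l hkl
      rcases lt_or_gt_of_ne hkl with h | h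
      · exact key k l h
      · exact (key l k h).symm
    calc volume D ≤ volume (⋃ k, D ∩ I k) := by
          refine measure_mono fun x hx => Set.mem_iUnion.2 ⟨⌊x * n⌋₊, hx, ?_, ?_⟩
          · rw [div_le_iff₀ hn0]
            exact Nat.floor_le (mul_nonneg (hD1 hx).1 hn0.le)
          · rw [le_div_iff₀ hn0]
            exact (Nat.lt_floor_add_one _).le
      _ ≤ ∑' k, volume (D ∩ I k) := measure_iUnion_le _
      _ ≤ ∑' k, volume (R k) := ENNReal.tsum_le_tsum hRv
      _ = volume (⋃ k, R k) := (measure_iUnion hdisj hRm).symm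
      _ ≤ volume (Metric.cthickening δ S) := measure_mono (Set.iUnion_subset hRs)
  have hvol : volume D ≤ volume S :=
    ge_of_tendsto ((tendsto_measure_cthickening_of_isCompact hScomp).mono_left
      (nhdsWithin_le_nhds (s := Set.Ioi 0))) (by
        filter_upwards [self_mem_nhdsWithin] with δ hδ using hthick δ hδ)
  have hnull : volume {q : ℝ × ℝ | q.1 = 2 * π} = 0 := by
    have : {q : ℝ × ℝ | q.1 = 2 * π} = {2 * π} ×ˢ Set.univ := by
      ext q
      simp
    rw [this, Measure.volume_eq_prod, Measure.prod_prod]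
    simp
  refine ⟨S \ {q | q.1 = 2 * π}, hScomp.measurableSet.diff
    (measurableSet_eq_fun measurable_fst measurable_const), ?_, ?_⟩
  · rw [measure_sdiff_null hnull]
    exact hDpos.trans_le hvol
  · rintro q ⟨hq, hne⟩
    rw [hS, hP] at hq
    obtain ⟨⟨ε, x⟩, ⟨hε, hx⟩, rfl⟩ := hq
    exact ⟨⟨hx.1, lt_of_le_of_ne hx.2 hne⟩, ε, hε, rfl⟩

end DualBilliard

namespace DualBilliard

open Filter Topology

variable {K : Set (ℝ × ℝ)} {p Θ : ℝ → ℝ} {c Λ : ℝ}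

lemma Coord.perInt (hc : Coord p Θ c) (x : ℝ) (k : ℤ) :
    Θ (x + k * (2 * π)) = Θ x + k * (2 * π) := by
  have hper : Function.Periodic (fun y => Θ y - y) (2 * π) := fun y => by
    simp only [hc.perΘ']
    ring
  have := hper.int_mul k x
  beta_reduce at this
  linarith

lemma int_eq_zero_of_near {k : ℤ} {x y : ℝ} (he : y = x + k * (2 * π)) (hxy : |y - x| < 2 * π) :
    k = 0 := by
  rw [he, add_sub_cancel_left, abs_mul, abs_of_pos (by positivity : (0 : ℝ) < 2 * π)] at hxy
  have h1 : |(k : ℝ)| < 1 := by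
    by_contra! h
    nlinarith [Real.pi_pos]
  have h2 : |k| < 1 := by exact_mod_cast h1
  exact Int.abs_lt_one_iff.1 h2

namespace TCurve

variable {u u' : ℝ → ℝ} {ε ε' : ℝ}

lemma nearId (hu : TCurve p Θ Λ ε u) : NearId u := ⟨hu.lip, hu.per⟩

lemma next_eq (hu : TCurve p Θ Λ ε u) (hu' : TCurve p Θ Λ ε' u') (h : Body K p)
    (hc : Coord p Θ c) (hΛ : 0 ≤ Λ) (hε : 0 < ε) (hε1 : ε ≤ 1) (hε' : 0 < ε') (hε1' : ε' ≤ 1)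
    {x y : ℝ} (h0 : u x = u' y) (h1 : u (x + (π - ε)) = u' (y + (π - ε'))) :
    u (x + (π - ε) + (π - ε)) = u' (y + (π - ε') + (π - ε')) := by
  have e : curvePt p Θ u (π - ε) (x + (π - ε)) = curvePt p Θ u' (π - ε') (y + (π - ε')) := by
    rw [curvePt, curvePt, hu.reflect, hu'.reflect, h0, h1]
  rw [hu.curvePt_eq, hu'.curvePt_eq, sub_eq_add_neg (foot _ _), sub_eq_add_neg (foot _ _),
    ← neg_smul, ← neg_smul] at e
  obtain ⟨k, hk⟩ := h.tangent_unique (by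
    rw [neg_mul_neg]
    exact mul_pos (hΛ.trans_lt (hu.bigBwd _)) (hΛ.trans_lt (hu'.bigBwd _))) e
  rw [← hc.perInt] at hk
  have hk' := hc.strictMono.injective hk
  have hpi := Real.pi_gt_three
  have hk0 : k = 0 := int_eq_zero_of_near hk' (by
    have h2 := abs_le.1 (hu.shift (x + (π - ε)))
    have h3 := abs_le.1 (hu'.shift (y + (π - ε')))
    rw [h1] at h2
    rw [abs_lt]
    constructor <;> linarith)
  rw [hk', hk0]
  simp

lemma rotation_eq (hu : TCurve p Θ Λ ε u) (hu' : TCurve p Θ Λ ε' u') (h : Body K p)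
    (hc : Coord p Θ c) (hΛ : 0 ≤ Λ) (hε : 0 < ε) (hε1 : ε ≤ 1) (hε' : 0 < ε') (hε1' : ε' ≤ 1)
    {x y : ℝ} (h0 : u x = u' y) (h1 : u (x + (π - ε)) = u' (y + (π - ε'))) : ε = ε' := by
  have key : ∀ n : ℕ, u (x + n * (π - ε)) = u' (y + n * (π - ε')) ∧
      u (x + n * (π - ε) + (π - ε)) = u' (y + n * (π - ε') + (π - ε')) := by
    intro n
    induction n with
    | zero => simpa using ⟨h0, h1⟩
    | succ n ih =>
      have e1 : x + (n + 1 : ℕ) * (π - ε) = x + n * (π - ε) + (π - ε) := by push_cast; ring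
      have e2 : y + (n + 1 : ℕ) * (π - ε') = y + n * (π - ε') + (π - ε') := by push_cast; ring
      rw [e1, e2]
      exact ⟨ih.2, hu.next_eq hu' h hc hΛ hε hε1 hε' hε1' ih.1 ih.2⟩
  have hbd : ∀ {v : ℝ → ℝ}, NearId v → ∃ B, ∀ z, |v z - z| ≤ B := fun {v} hv => by
    have hper : Function.Periodic (fun z => |v z - z|) (2 * π) := fun z => by
      simp only [hv.per, add_sub_add_right_eq_sub]
    obtain ⟨_, z₂, hz⟩ := exists_bounds_of_periodic
      (by have := hv.continuous; fun_prop : Continuous fun z => |v z - z|) hper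
    exact ⟨_, fun z => (hz z).2⟩
  obtain ⟨B, hB⟩ := hbd hu.nearId
  obtain ⟨B', hB'⟩ := hbd hu'.nearId
  by_contra hne
  obtain ⟨n, hn⟩ := exists_nat_gt ((B + B' + |x - y|) / |ε - ε'|)
  rw [div_lt_iff₀ (abs_pos.2 (sub_ne_zero.2 hne))] at hn
  have b1 := hB (x + n * (π - ε))
  have b2 := hB' (y + n * (π - ε'))
  rw [(key n).1] at b1
  have e : (n : ℝ) * (ε - ε') = (u' (y + n * (π - ε')) - (x + n * (π - ε))) -
      (u' (y + n * (π - ε')) - (y + n * (π - ε'))) + (x - y) := by ring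
  have e' := congrArg abs e
  rw [abs_mul, Nat.abs_cast] at e'
  have b3 := abs_add_le ((u' (y + n * (π - ε')) - (x + n * (π - ε))) -
      (u' (y + n * (π - ε')) - (y + n * (π - ε')))) (x - y)
  have b4 := abs_sub (u' (y + n * (π - ε')) - (x + n * (π - ε)))
      (u' (y + n * (π - ε')) - (y + n * (π - ε')))
  linarith

end TCurve

/-- The exterior point where the backward ray at coordinate `q.1` meets the tangent line at
coordinate `q.2`. -/
noncomputable def crossPt (p Θ : ℝ → ℝ) (q : ℝ × ℝ) : ℝ × ℝ :=
  foot p (Θ q.1) + lfwd p (Θ q.1) (Θ q.2) • tang (Θ q.1)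

lemma Coord.differentiableAt_crossPt (hc : Coord p Θ c) {q : ℝ × ℝ}
    (hs : Real.sin (Θ q.2 - Θ q.1) ≠ 0) : DifferentiableAt ℝ (crossPt p Θ) q := by
  have h1 : Differentiable ℝ p := hc.smooth.differentiable (by norm_num)
  have h2 : Differentiable ℝ (deriv p) :=
    ((contDiff_succ_iff_deriv (n := 6)).1 hc.smooth).2.2.differentiable (by norm_num)
  have h3 : Differentiable ℝ Θ := fun x => (hc.derivΘ x).differentiableAt
  unfold crossPt foot lfwd tang
  generalize deriv p = p' at *
  fun_prop (disch := assumption)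

lemma angle_deriv_eq_zero {Z : ℝ → ℝ × ℝ} {A : ℝ → ℝ} {A' l : ℝ} (hp : Differentiable ℝ p)
    (hA : HasDerivAt A A' 0) (hZ : HasDerivAt Z 0 0)
    (hloc : ∀ᶠ t in 𝓝 0, (Z t).1 * Real.cos (A t) + (Z t).2 * Real.sin (A t) = p (A t))
    (hl : l ≠ 0) (hZ0 : Z 0 = foot p (A 0) + l • tang (A 0)) : A' = 0 := by
  have d1 : HasDerivAt (fun t => (Z t).1) 0 0 := hZ.fst
  have d2 : HasDerivAt (fun t => (Z t).2) 0 0 := hZ.snd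
  have h1 := (d1.fun_mul hA.cos).fun_add (d2.fun_mul hA.sin)
  have h2 := (hp (A 0)).hasDerivAt.comp 0 hA
  have h3 := (h1.congr_of_eventuallyEq (hloc.mono fun t ht => ht.symm)).unique h2
  rw [hZ0] at h3
  simp only [foot, tang, Prod.fst_add, Prod.snd_add, Prod.smul_fst, Prod.smul_snd,
    smul_eq_mul] at h3
  have h4 : l * A' = 0 := by
    linear_combination h3 - (l + deriv p (A 0)) * A' * Real.sin_sq_add_cos_sq (A 0)
  exact (mul_eq_zero.1 h4).resolve_left hl

lemma Coord.det_fderiv_crossPt_ne_zero (hc : Coord p Θ c) {q : ℝ × ℝ}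
    (hs : Real.sin (Θ q.2 - Θ q.1) ≠ 0) (hf : lfwd p (Θ q.1) (Θ q.2) ≠ 0)
    (hb : lbwd p (Θ q.1) (Θ q.2) ≠ 0) : (fderiv ℝ (crossPt p Θ) q).det ≠ 0 := by
  intro hdet
  obtain ⟨v, hv, hv0⟩ := (Submodule.ne_bot_iff _).1
    (LinearMap.bot_lt_ker_of_det_eq_zero (f := (fderiv ℝ (crossPt p Θ) q : ℝ × ℝ →ₗ[ℝ] ℝ × ℝ))
      hdet).ne'
  have hv' : fderiv ℝ (crossPt p Θ) q v = 0 := hv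
  have hp : Differentiable ℝ p := hc.smooth.differentiable (by norm_num)
  have hΘc : Continuous Θ := hc.contDiff.continuous
  have hline : HasDerivAt (fun t : ℝ => q + t • v) v 0 := by
    simpa using ((hasDerivAt_id (0 : ℝ)).smul_const v).const_add q
  have hZ : HasDerivAt (fun t : ℝ => crossPt p Θ (q + t • v)) 0 0 := by
    have hd := (hc.differentiableAt_crossPt hs).hasFDerivAt
    have := HasFDerivAt.comp_hasDerivAt (f := fun t : ℝ => q + t • v) (x := 0)
      (by simpa using hd) hline
    rwa [hv'] at this
  have hΘpos : ∀ x, c * (p (Θ x) + p (Θ x + π)) ^ 2 ≠ 0 := fun x => by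
    have := hc.width (Θ x)
    have := hc.cpos
    positivity
  have hA : ∀ (x w : ℝ), HasDerivAt (fun t : ℝ => Θ (x + t * w))
      (c * (p (Θ x) + p (Θ x + π)) ^ 2 * w) 0 := fun x w => by
    have h1 : HasDerivAt (fun t : ℝ => x + t * w) w 0 := by
      simpa using ((hasDerivAt_id (0 : ℝ)).mul_const w).const_add x
    exact HasDerivAt.comp (h₂ := Θ) (h := fun t : ℝ => x + t * w) 0
      (by simpa using hc.derivΘ x) h1
  have hev : ∀ᶠ t : ℝ in 𝓝 0, Real.sin (Θ (q.2 + t * v.2) - Θ (q.1 + t * v.1)) ≠ 0 := by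
    have : Continuous fun t : ℝ => Real.sin (Θ (q.2 + t * v.2) - Θ (q.1 + t * v.1)) := by
      fun_prop
    exact this.continuousAt.eventually_ne (by simpa using hs)
  have h1 := angle_deriv_eq_zero (l := lfwd p (Θ q.1) (Θ q.2)) hp (hA q.1 v.1) hZ
    (Eventually.of_forall fun t => Body.dot_foot_normal p _ _) hf (by simp [crossPt])
  have h2 := angle_deriv_eq_zero (l := -lbwd p (Θ q.1) (Θ q.2)) hp (hA q.2 v.2) hZ
    (hev.mono fun t ht => by
      have e := foot_add_lfwd p ht
      have : crossPt p Θ (q + t • v) = foot p (Θ (q.2 + t * v.2)) +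
          (-lbwd p (Θ (q.1 + t * v.1)) (Θ (q.2 + t * v.2))) • tang (Θ (q.2 + t * v.2)) := by
        rw [neg_smul, ← sub_eq_add_neg, ← e]
        rfl
      rw [this]
      exact Body.dot_foot_normal p _ _) (neg_ne_zero.2 hb) (by
      simpa [crossPt, sub_eq_add_neg] using foot_add_lfwd p hs)
  exact hv0 (Prod.ext ((mul_eq_zero.1 h1).resolve_left (hΘpos _))
    ((mul_eq_zero.1 h2).resolve_left (hΘpos _)))

/-- The crossing map sends a set of positive measure to a set of positive measure. -/
lemma Coord.measure_image_crossPt_pos (hc : Coord p Θ c) (h : Body K p) {S : Set (ℝ × ℝ)}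
    (hS : MeasurableSet S) (hpos : 0 < volume S) (hS1 : ∀ q ∈ S, q.1 ∈ Set.Ico 0 (2 * π))
    (hS2 : ∀ q ∈ S, |q.2 - q.1 - π| < π / 2)
    (hs : ∀ q ∈ S, Real.sin (Θ q.2 - Θ q.1) ≠ 0) (hf : ∀ q ∈ S, 0 < lfwd p (Θ q.1) (Θ q.2))
    (hb : ∀ q ∈ S, 0 < lbwd p (Θ q.1) (Θ q.2)) : 0 < volume (crossPt p Θ '' S) := by
  have hinj : Set.InjOn (crossPt p Θ) S := by
    intro q hq q' hq' he
    obtain ⟨k, hk⟩ := h.tangent_unique (mul_pos (hf q hq) (hf q' hq')) he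
    have he' : foot p (Θ q.2) + (-lbwd p (Θ q.1) (Θ q.2)) • tang (Θ q.2) =
        foot p (Θ q'.2) + (-lbwd p (Θ q'.1) (Θ q'.2)) • tang (Θ q'.2) := by
      rw [neg_smul, neg_smul, ← sub_eq_add_neg, ← sub_eq_add_neg, ← foot_add_lfwd p (hs q hq),
        ← foot_add_lfwd p (hs q' hq')]
      exact he
    obtain ⟨m, hm⟩ := h.tangent_unique (by
      rw [neg_mul_neg]
      exact mul_pos (hb q hq) (hb q' hq')) he'
    rw [← hc.perInt] at hk hm
    have hk' := hc.strictMono.injective hk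
    have hm' := hc.strictMono.injective hm
    have a1 := hS1 q hq
    have a2 := hS1 q' hq'
    have hk0 : k = 0 := int_eq_zero_of_near hk' (by
      rw [abs_lt]
      constructor <;> linarith [a1.1, a1.2, a2.1, a2.2])
    have e1 : q'.1 = q.1 := by rw [hk', hk0]; simp
    have hm0 : m = 0 := int_eq_zero_of_near hm' (by
      have b1 := abs_lt.1 (hS2 q hq)
      have b2 := abs_lt.1 (hS2 q' hq')
      rw [abs_lt]
      constructor <;> linarith)
    exact Prod.ext e1.symm (by rw [hm', hm0]; simp)
  have himg := lintegral_abs_det_fderiv_eq_addHaar_image (volume : Measure (ℝ × ℝ)) hS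
    (fun q hq => (hc.differentiableAt_crossPt (hs q hq)).hasFDerivAt.hasFDerivWithinAt) hinj
  rw [← himg]
  have hmeas : Measurable fun q => ENNReal.ofReal |(fderiv ℝ (crossPt p Θ) q).det| :=
    (ContinuousLinearMap.continuous_det.measurable.comp
      (measurable_fderiv ℝ (crossPt p Θ))).abs.ennreal_ofReal
  rw [setLIntegral_pos_iff hmeas]
  refine hpos.trans_le (measure_mono fun q hq => ⟨?_, hq⟩)
  simpa [abs_pos] using
    hc.det_fderiv_crossPt_ne_zero (hs q hq) (hf q hq).ne' (hb q hq).ne'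

end DualBilliard

namespace DualBilliard

open Filter Topology

/-- The invariant curves with large tangent lengths fill a set of positive measure. -/
theorem exists_measure_pos {K : Set (ℝ × ℝ)} {p : ℝ → ℝ} {Φ : ℝ × ℝ → ℝ × ℝ} (h : Body K p)
    (hs : ContDiff ℝ 7 p) (hΦ : IsDualBilliard K p Φ) {N : ℝ} (hN : 0 < N) :
    0 < volume (⋃₀ {Ω : Set (ℝ × ℝ) | DBInvCircle K Φ Ω ∧
      N < Metric.hausdorffDist Ω (frontier K)}) := by
  obtain ⟨c, Θ, hc⟩ := h.exists_coord hs
  obtain ⟨M, hM0, hM, hM'⟩ := hc.exists_deriv_bound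
  have hΛ : 0 ≤ 2 * M + 2 * N := by positivity
  obtain ⟨γ, hγ, hdioph⟩ := exists_dioph_set
  obtain ⟨ε₁, hε₁, hcurve⟩ := hc.geomData.exists_elCurve hγ
  obtain ⟨ε₂, hε₂, htcurve⟩ := hc.exists_tCurve hΛ
  obtain ⟨ε₀, hε₀⟩ : ∃ ε₀, ε₀ = min (min ε₁ ε₂) 1 := ⟨_, rfl⟩
  have h1 : ε₀ ≤ ε₁ := hε₀ ▸ (min_le_left _ _).trans (min_le_left _ _)
  have h2 : ε₀ ≤ ε₂ := hε₀ ▸ (min_le_left _ _).trans (min_le_right _ _)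
  have h3 : ε₀ ≤ 1 := hε₀ ▸ min_le_right _ _
  have h4 : 0 < ε₀ := by rw [hε₀]; positivity
  obtain ⟨D, hD, hDsub, hDpos, hDd⟩ := hdioph ε₀ h4 h3
  have hpos : ∀ ε ∈ D, 0 < ε := fun ε hε => by linarith [(hDsub hε).1]
  have hle : ∀ ε ∈ D, ε ≤ 1 := fun ε hε => (hDsub hε).2.trans h3
  have hex : ∀ ε, ∃ u, ε ∈ D → TCurve p Θ (2 * M + 2 * N) ε u := fun ε => by
    by_cases hε : ε ∈ D
    · obtain ⟨u, hu⟩ := hcurve ε (π - ε) (hpos ε hε) ((hDsub hε).2.trans h1) (hDd ε hε)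
      exact ⟨u, fun _ => htcurve ε u (hpos ε hε) ((hDsub hε).2.trans h2) hu⟩
    · exact ⟨id, fun h => absurd h hε⟩
  choose u hu using hex
  obtain ⟨S, hS, hSpos, hSq⟩ := exists_pos_measure_graphs hD
    (fun ε hε => ⟨(hpos ε hε).le, hle ε hε⟩) hDpos
    (f := fun ε => conjShift (u ε) (π - ε))
    (fun ε hε => (hu ε hε).nearId.continuous_conjShift _) (fun a ha b hb hab => by
      have hcmp := conjShift_compare (hu a ha).nearId (hu b hb).nearId (α := π - a)
        (α' := π - b) (by linarith) fun x he => hab.ne ((hu a ha).rotation_eq (hu b hb) h hc hΛ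
          (hpos a ha) (hle a ha) (hpos b hb) (hle b hb)
          (((hu a ha).nearId.apply_inv x).trans ((hu b hb).nearId.apply_inv x).symm) he)
      rw [show π - a - (π - b) = b - a by ring] at hcmp
      exact ⟨hcmp.1, hcmp.2.1, hcmp.2.2 (by linarith [hpos a ha, hle b hb])⟩)
  have hpar : ∀ q ∈ S, ∃ ε ∈ D, ∃ x, q.1 = u ε x ∧ q.2 = u ε (x + (π - ε)) := fun q hq => by
    obtain ⟨-, ε, hε, he⟩ := hSq q hq
    exact ⟨ε, hε, Function.invFun (u ε) q.1, ((hu ε hε).nearId.apply_inv _).symm, he⟩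
  refine (hc.measure_image_crossPt_pos h hS hSpos (fun q hq => (hSq q hq).1) (fun q hq => ?_)
    (fun q hq => ?_) (fun q hq => ?_) (fun q hq => ?_)).trans_le (measure_mono ?_)
  · obtain ⟨ε, hε, x, e1, e2⟩ := hpar q hq
    have := abs_le.1 ((hu ε hε).shift x)
    rw [e1, e2, abs_lt]
    constructor <;> linarith [hpos ε hε, hle ε hε, Real.pi_gt_three]
  · obtain ⟨ε, hε, x, e1, e2⟩ := hpar q hq
    rw [e1, e2]
    exact ((hu ε hε).sinPos x).ne'
  · obtain ⟨ε, hε, x, e1, e2⟩ := hpar q hq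
    rw [e1, e2]
    exact hΛ.trans_lt ((hu ε hε).bigFwd x)
  · obtain ⟨ε, hε, x, e1, e2⟩ := hpar q hq
    rw [e1, e2]
    exact hΛ.trans_lt ((hu ε hε).bigBwd x)
  · rintro _ ⟨q, hq, rfl⟩
    obtain ⟨ε, hε, x, e1, e2⟩ := hpar q hq
    have hcirc := (hu ε hε).dbInvCircle h hc hΦ hM0.le hM hM' (by linarith)
    refine ⟨_, ⟨hcirc, (hu ε hε).lt_hausdorffDist h hM hM' le_rfl hcirc.2.1⟩, x, ?_⟩
    rw [curvePt, crossPt, e1, e2]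

end DualBilliard

theorem stmt12
    (K : Set (ℝ × ℝ))
    (hKcomp : IsCompact K) (hKconv : Convex ℝ K) (hKstrict : StrictConvex ℝ K)
    (hKint : (interior K).Nonempty)
    (p : ℝ → ℝ) (hp : ∀ θ : ℝ, p θ = suppFn K θ)
    (hpC2 : ContDiff ℝ 2 p)
    (r : ℕ) (hr : 4 < r)
    (hρCr : ContDiff ℝ r (fun θ => p θ + deriv (deriv p) θ))
    (Φ : ℝ × ℝ → ℝ × ℝ)
    (hΦ : ∀ z : ℝ × ℝ, z ∉ K → ∃ θ l : ℝ, ∃ a : ℝ × ℝ, 0 < l ∧ a ∈ K ∧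
      a.1 * Real.cos θ + a.2 * Real.sin θ = p θ ∧
      z = a - l • ((-Real.sin θ, Real.cos θ) : ℝ × ℝ) ∧
      Φ z = (2 : ℝ) • a - z)
    :
    ∀ N : ℝ, 0 < N →
      0 < volume (⋃₀ {Ω : Set (ℝ × ℝ) | DBInvCircle K Φ Ω ∧
        N < Metric.hausdorffDist Ω (frontier K)}) := by
  intro N hN
  exact DualBilliard.exists_measure_pos
    ⟨hKcomp, hKint, hp, hpC2.differentiable (by norm_num)⟩
    (DualBilliard.contDiff_seven_of_curvature hpC2 hr hρCr) hΦ hN
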